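/- Let β ≥ −1 be an integer or half-integer, n ∈ ℕ and k ∈ {1,…,n}. If 2β + n is odd, then there exist rational numbers q_0, q_2, q_4, … such that 𝐉_{n,k}(β) = q_0 + q_2·π^{−2} + q_4·π^{−4} + … + q_{n−k}·π^{−(n−k)} if n−k is even, and 𝐉_{n,k}(β) = q_0 + q_2·π^{−2} + q_4·π^{−4} + … + q_{n−k−1}·π^{−(n−k−1)} if n−k is odd. -/

import Mathlib

open MeasureTheory Real

noncomputable section

/-- The uniform probability measure on the unit sphere of `ℝ^m`. -/
def sphereUnif (m : ℕ) : Measure (Metric.sphere (0 : EuclideanSpace ℝ (Fin m)) 1) :=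
  ((volume : Measure (EuclideanSpace ℝ (Fin m))).toSphere Set.univ)⁻¹ •
    (volume : Measure (EuclideanSpace ℝ (Fin m))).toSphere

/-- The internal angle of a set `P ⊆ ℝ^m` at a reference point `g₀` (a point in the
relative interior of the face of interest): the normalized spherical Lebesgue measure of
the set of directions `u` on the unit sphere with `g₀ + ε • u ∈ P` for some `ε > 0`. -/
def internalAngle {m : ℕ} (g₀ : EuclideanSpace ℝ (Fin m))
    (P : Set (EuclideanSpace ℝ (Fin m))) : ℝ :=
  (sphereUnif m {u : Metric.sphere (0 : EuclideanSpace ℝ (Fin m)) 1 |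
    ∃ ε : ℝ, 0 < ε ∧ g₀ + ε • (u : EuclideanSpace ℝ (Fin m)) ∈ P}).toReal

/-- The beta density `f_{d,β}` on `ℝ^d`. -/
def betaDensity (d : ℕ) (β : ℝ) (x : EuclideanSpace ℝ (Fin d)) : ℝ :=
  (Real.Gamma ((d : ℝ) / 2 + β + 1) / (Real.pi ^ ((d : ℝ) / 2) * Real.Gamma (β + 1))) *
    (if ‖x‖ < 1 then (1 - ‖x‖ ^ 2) ^ β else 0)

/-- The beta distribution on `ℝ^d` with parameter `β > -1`; for `β = -1` it is
interpreted as the uniform distribution on the unit sphere `S^{d-1}`. -/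
def betaMeasure (d : ℕ) (β : ℝ) : Measure (EuclideanSpace ℝ (Fin d)) :=
  if β = -1 then
    Measure.map
      (fun u : Metric.sphere (0 : EuclideanSpace ℝ (Fin d)) 1 => (u : EuclideanSpace ℝ (Fin d)))
      (sphereUnif d)
  else
    volume.withDensity fun x => ENNReal.ofReal (betaDensity d β x)

/-- `J n k β`: the expected internal angle of the beta simplex `[X_1,…,X_n]` at its face
`[X_1,…,X_k]`, where `X_1,…,X_n` are i.i.d. points in `ℝ^(n-1)` with beta density
`f_{n-1,β}`. The reference point in the relative interior of the face is its centroid. -/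
def J (n k : ℕ) (β : ℝ) : ℝ :=
  ∫ X : Fin n → EuclideanSpace ℝ (Fin (n - 1)),
    internalAngle
      ((k : ℝ)⁻¹ • ∑ i ∈ Finset.univ.filter (fun i : Fin n => (i : ℕ) < k), X i)
      (convexHull ℝ (Set.range X))
    ∂(Measure.pi fun _ : Fin n => betaMeasure (n - 1) β)

/-- `Jb n k β = binom(n,k) * J n k β`, the expected internal angle sum `𝐉_{n,k}(β)`. -/
def Jb (n k : ℕ) (β : ℝ) : ℝ := (n.choose k : ℝ) * J n k β

/-! ### Linear programming in general position -/

section LinearProgramming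

variable {ι V : Type*} [AddCommGroup V] [Module ℝ V]

/-- The Farkas lemma for finitely many generators. -/
theorem farkas_finset (s : Finset ι) : ∀ (v : ι → V) (e : V),
    (∃ μ : ι → ℝ, (∀ i ∈ s, 0 ≤ μ i) ∧ ∑ i ∈ s, μ i • v i = e) ∨
      ∃ d : Module.Dual ℝ V, (∀ i ∈ s, d (v i) ≤ 0) ∧ 0 < d e := by
  classical
  induction s using Finset.induction_on with
  | empty =>
    intro v e
    by_cases he : e = 0
    · exact Or.inl ⟨0, by simp, by simp [he]⟩
    · obtain ⟨d, hd⟩ := Module.Projective.exists_dual_eq_one ℝ he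
      exact Or.inr ⟨d, by simp, by simp [hd]⟩
  | insert j s hj ih =>
    intro v e
    rcases ih v e with ⟨μ, hμ, he⟩ | ⟨d, hd, hde⟩
    · refine Or.inl ⟨Function.update μ j 0, ?_, ?_⟩
      · intro i hi
        by_cases hij : i = j
        · simp [hij]
        · simpa [hij] using hμ i (by simpa [hij] using hi)
      · rw [Finset.sum_insert hj, ← he]
        simp only [Function.update_self, zero_smul, zero_add]
        refine Finset.sum_congr rfl fun i hi => ?_
        rw [Function.update_of_ne (by rintro rfl; exact hj hi)]
    by_cases hdj : d (v j) ≤ 0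
    · exact Or.inr ⟨d, by simpa using ⟨hdj, hd⟩, hde⟩
    push Not at hdj
    rcases ih (fun i => v i - (d (v i) / d (v j)) • v j) (e - (d e / d (v j)) • v j) with
      ⟨μ, hμ, he⟩ | ⟨d', hd', hde'⟩
    · left
      refine ⟨Function.update μ j (d e / d (v j) - ∑ i ∈ s, μ i * (d (v i) / d (v j))), ?_, ?_⟩
      · intro i hi
        by_cases hij : i = j
        · subst hij
          have h1 : 0 ≤ d e / d (v i) := by positivity
          have h2 : ∑ k ∈ s, μ k * (d (v k) / d (v i)) ≤ 0 :=
            Finset.sum_nonpos fun k hk => mul_nonpos_of_nonneg_of_nonpos (hμ k hk)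
              (div_nonpos_of_nonpos_of_nonneg (hd k hk) hdj.le)
          simp only [Function.update_self]
          linarith
        · simpa [hij] using hμ i (by simpa [hij] using hi)
      · rw [Finset.sum_insert hj]
        have : ∑ i ∈ s, Function.update μ j
            (d e / d (v j) - ∑ i ∈ s, μ i * (d (v i) / d (v j))) i • v i = ∑ i ∈ s, μ i • v i :=
          Finset.sum_congr rfl fun i hi => by
            rw [Function.update_of_ne (by rintro rfl; exact hj hi)]
        rw [this]
        simp only [smul_sub, Finset.sum_sub_distrib, smul_smul] at he
        rw [← Finset.sum_smul] at he
        simp only [Function.update_self, sub_smul]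
        have := sub_eq_iff_eq_add.1 he
        rw [this]
        abel
    · right
      refine ⟨d' ∘ₗ (LinearMap.id - (d.smulRight ((d (v j))⁻¹ • v j))), ?_, ?_⟩
      · intro i hi
        rcases Finset.mem_insert.1 hi with rfl | hi
        · simp [smul_smul, mul_inv_cancel₀ hdj.ne']
        · simpa [smul_smul, div_eq_mul_inv] using hd' i hi
      · simpa [smul_smul, div_eq_mul_inv] using hde'


theorem exists_dual_of_linearIndepOn {v : ι → V} {G : Set ι} (h : LinearIndepOn ℝ v G)
    (w : ι → ℝ) : ∃ c : Module.Dual ℝ V, ∀ i ∈ G, c (v i) = w i := by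
  have h' : LinearIndependent ℝ (fun i : G => v i) := h
  obtain ⟨c, hc⟩ := LinearMap.exists_extend ((Module.Basis.span h').constr ℝ fun i : G => w i)
  refine ⟨c, fun i hi => ?_⟩
  have h1 := LinearMap.congr_fun hc (Module.Basis.span h' ⟨i, hi⟩)
  rw [Module.Basis.constr_basis] at h1
  rw [← h1]
  simp [Module.Basis.span_apply]

theorem span_eq_top_of_card [FiniteDimensional ℝ V] {v : ι → V} {G : Finset ι}
    (h : LinearIndepOn ℝ v (G : Set ι))
    (hG : G.card = Module.finrank ℝ V) : Submodule.span ℝ (v '' G) = ⊤ := by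
  have h' : LinearIndependent ℝ (fun i : G => v i) := h
  have := h'.span_eq_top_of_card_eq_finrank' (by simpa using hG)
  rw [← this]
  congr 1
  ext x; simp

variable [Fintype ι]

/-- `c` is feasible for the primal program `c (v i) = z i` on `F`, `c (v i) ≤ z i`. -/
def PrimalFeas (v : ι → V) (z : ι → ℝ) (F : Finset ι) (c : Module.Dual ℝ V) : Prop :=
  (∀ i ∈ F, c (v i) = z i) ∧ ∀ i, c (v i) ≤ z i

/-- `μ` is a representation of `e`, supported on `G` and nonnegative off `F`. -/
def DualFeas (v : ι → V) (F : Finset ι) (e : V) (G : Finset ι) (μ : ι → ℝ) : Prop :=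
  (∀ i ∉ G, μ i = 0) ∧ ∑ i, μ i • v i = e ∧ ∀ i ∉ F, 0 ≤ μ i

theorem apply_eq_sum_of_dualFeas {v : ι → V} {F G : Finset ι} {e : V} {μ : ι → ℝ}
    (h : DualFeas v F e G μ) (c : Module.Dual ℝ V) : c e = ∑ i, μ i * c (v i) := by
  rw [← h.2.1, map_sum]; simp

theorem mul_le_mul_of_feas {v : ι → V} {z : ι → ℝ} {F G : Finset ι} {e : V} {μ : ι → ℝ}
    {c : Module.Dual ℝ V} (h : DualFeas v F e G μ) (hc : PrimalFeas v z F c) (i : ι) :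
    μ i * c (v i) ≤ μ i * z i := by
  by_cases hi : i ∈ F
  · rw [hc.1 i hi]
  · exact mul_le_mul_of_nonneg_left (hc.2 i) (h.2.2 i hi)

theorem weak_duality {v : ι → V} {z : ι → ℝ} {F G : Finset ι} {e : V} {μ : ι → ℝ}
    {c : Module.Dual ℝ V} (h : DualFeas v F e G μ) (hc : PrimalFeas v z F c) :
    c e ≤ ∑ i, μ i * z i := by
  rw [apply_eq_sum_of_dualFeas h]
  exact Finset.sum_le_sum fun i _ => mul_le_mul_of_feas h hc i

theorem complementary_slackness {v : ι → V} {z : ι → ℝ} {F G : Finset ι} {e : V} {μ : ι → ℝ}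
    {c : Module.Dual ℝ V} (h : DualFeas v F e G μ) (hc : PrimalFeas v z F c)
    (heq : ∑ i, μ i * z i ≤ c e) (i : ι) (hi : μ i ≠ 0) : c (v i) = z i := by
  rw [apply_eq_sum_of_dualFeas h] at heq
  have := (Finset.sum_eq_sum_iff_of_le fun i _ => mul_le_mul_of_feas h hc i).1
    (le_antisymm (Finset.sum_le_sum fun i _ => mul_le_mul_of_feas h hc i) heq) i (Finset.mem_univ i)
  exact mul_left_cancel₀ hi this

theorem exists_sum_of_mem_span [DecidableEq ι] {v : ι → V} {G : Finset ι} {x : V}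
    (hx : x ∈ Submodule.span ℝ (v '' G)) :
    ∃ ν : ι → ℝ, (∀ i ∉ G, ν i = 0) ∧ ∑ i, ν i • v i = x := by
  obtain ⟨c, hc⟩ := (Submodule.mem_span_image_finset_iff_exists_fun ℝ).1 hx
  refine ⟨fun i => if h : i ∈ G then c ⟨i, h⟩ else 0, fun i hi => by simp [hi], ?_⟩
  rw [← hc, ← Finset.sum_subset (Finset.subset_univ G) fun i _ hi => by simp [hi],
    ← Finset.sum_attach G]
  exact Finset.sum_congr rfl fun i _ => by simp

theorem linearIndepOn_of_card_le {v : ι → V} {H : Finset ι}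
    (g1 : ∀ G : Finset ι, G.card = Module.finrank ℝ V → LinearIndepOn ℝ v (G : Set ι))
    (hm : Module.finrank ℝ V ≤ Fintype.card ι) (hH : H.card ≤ Module.finrank ℝ V) :
    LinearIndepOn ℝ v (H : Set ι) := by
  obtain ⟨G, hHG, hG⟩ := Finset.exists_superset_card_eq hH (by simpa using hm)
  exact (g1 G hG).mono (by exact_mod_cast hHG)

theorem eq_zero_of_sum_eq_zero {v : ι → V} {H : Finset ι} (h : LinearIndepOn ℝ v (H : Set ι))
    {ν : ι → ℝ} (h0 : ∀ i ∉ H, ν i = 0) (hs : ∑ i, ν i • v i = 0) : ν = 0 := by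
  funext i
  by_cases hi : i ∈ H
  · refine (linearIndepOn_finset_iff.1 h) ν ?_ i hi
    rw [← hs]
    refine Finset.sum_subset (Finset.subset_univ _) fun j _ hj => by simp [h0 j hj]
  · exact h0 i hi

/-- The ratio test: moving along `-ν` until a coordinate off `F` vanishes. -/
theorem exists_ratio [DecidableEq ι] (F : Finset ι) {μ ν : ι → ℝ} (hμ : ∀ i ∉ F, 0 ≤ μ i)
    (hν : ∃ i ∉ F, 0 < ν i) :
    ∃ t : ℝ, ∃ j ∉ F, 0 < ν j ∧ t = μ j / ν j ∧ ∀ i ∉ F, 0 ≤ μ i - t * ν i := by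
  obtain ⟨j, hj, hmin⟩ := Finset.exists_min_image
    (Finset.univ.filter fun i => i ∉ F ∧ 0 < ν i) (fun i => μ i / ν i)
    (by obtain ⟨i, h1, h2⟩ := hν; exact ⟨i, by simp [h1, h2]⟩)
  simp only [Finset.mem_filter, Finset.mem_univ, true_and] at hj hmin
  refine ⟨μ j / ν j, j, hj.1, hj.2, rfl, fun i hi => ?_⟩
  by_cases h : 0 < ν i
  · have := hmin i ⟨hi, h⟩
    rw [le_div_iff₀ h] at this
    linarith
  · have h1 : 0 ≤ μ j / ν j := div_nonneg (hμ j hj.1) hj.2.le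
    nlinarith [hμ i hi]

/-- The Carathéodory theorem for a cone with lineality space spanned by `F`. -/
theorem exists_basic_dualFeas [FiniteDimensional ℝ V] {v : ι → V} {F : Finset ι} {e : V}
    (g1 : ∀ G : Finset ι, G.card = Module.finrank ℝ V → LinearIndepOn ℝ v (G : Set ι))
    (hm : Module.finrank ℝ V ≤ Fintype.card ι) (hF : F.card ≤ Module.finrank ℝ V)
    (h : ∃ μ, DualFeas v F e Finset.univ μ) :
    ∃ G : Finset ι, F ⊆ G ∧ G.card = Module.finrank ℝ V ∧ ∃ μ, DualFeas v F e G μ := by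
  classical
  obtain ⟨H, hmem, hmin⟩ := Finset.exists_min_image
    (Finset.univ.filter fun H : Finset ι => ∃ μ, F ⊆ H ∧ DualFeas v F e H μ) Finset.card
    (by obtain ⟨μ, hμ⟩ := h; exact ⟨Finset.univ, by simpa using ⟨μ, hμ⟩⟩)
  simp only [Finset.mem_filter, Finset.mem_univ, true_and] at hmem hmin
  obtain ⟨μ, hFH, hμ⟩ := hmem
  by_cases hH : H.card ≤ Module.finrank ℝ V
  · obtain ⟨G, hHG, hG⟩ := Finset.exists_superset_card_eq hH (by simpa using hm)
    exact ⟨G, hFH.trans hHG, hG, μ, fun i hi => hμ.1 i fun hi' => hi (hHG hi'), hμ.2⟩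
  exfalso
  push Not at hH
  have hdep : ¬ LinearIndepOn ℝ v (H : Set ι) := fun hli => by
    have h' : LinearIndependent ℝ (fun i : H => v i) := hli
    have := h'.fintype_card_le_finrank
    simp at this
    omega
  rw [linearIndepOn_finset_iff] at hdep
  push Not at hdep
  obtain ⟨ν, hν, i₀, hi₀, hne⟩ := hdep
  obtain ⟨ν, hνH, hν, hne⟩ : ∃ ν : ι → ℝ, (∀ i ∉ H, ν i = 0) ∧ ∑ i, ν i • v i = 0 ∧ ν ≠ 0 := by
    refine ⟨fun i => if i ∈ H then ν i else 0, fun i hi => by simp [hi], ?_, fun h => ?_⟩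
    · rw [← hν]; simp [ite_smul, Finset.sum_ite_mem]
    · exact hne (by simpa [hi₀] using congrFun h i₀)
  have hoff : ∃ i ∉ F, ν i ≠ 0 := by
    by_contra! hcon
    exact hne (eq_zero_of_sum_eq_zero (linearIndepOn_of_card_le g1 hm hF) hcon hν)
  obtain ⟨ν, hνH, hν, hpos⟩ : ∃ ν : ι → ℝ, (∀ i ∉ H, ν i = 0) ∧ ∑ i, ν i • v i = 0 ∧
      ∃ i ∉ F, 0 < ν i := by
    obtain ⟨i, hi, hi'⟩ := hoff
    rcases lt_or_gt_of_ne hi' with hlt | hgt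
    · exact ⟨-ν, fun i hi => by simp [hνH i hi], by simp [hν], i, hi, by simpa using hlt⟩
    · exact ⟨ν, hνH, hν, i, hi, hgt⟩
  obtain ⟨t, j, hjF, hνj, rfl, ht⟩ := exists_ratio F hμ.2.2 hpos
  have hjH : j ∈ H := by by_contra hj; exact hνj.ne' (hνH j hj)
  have := hmin (H.erase j) (by
    refine ⟨fun i => μ i - μ j / ν j * ν i, ?_, ?_, ?_, ht⟩
    · intro i hi
      exact Finset.mem_erase.2 ⟨by rintro rfl; exact hjF hi, hFH hi⟩
    · intro i hi
      by_cases hij : i = j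
      · subst hij; field_simp; simp
      · have : i ∉ H := fun h => hi (Finset.mem_erase.2 ⟨hij, h⟩)
        simp [hμ.1 i this, hνH i this]
    · simp only [sub_smul, mul_smul, Finset.sum_sub_distrib, ← Finset.smul_sum, hν, hμ.2.1]
      simp)
  have h2 := Finset.card_erase_lt_of_mem hjH
  omega

/-- A simplicial piece: `G` carries an optimal basis. -/
def OptimalBasis (v : ι → V) (z : ι → ℝ) (F : Finset ι) (e : V) (G : Finset ι) : Prop :=
  (∃ c, PrimalFeas v z G c) ∧ ∃ μ, DualFeas v F e G μ

/-- The primal program is unbounded in the direction `e`. -/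
def UnboundedDir (v : ι → V) (F : Finset ι) (e : V) : Prop :=
  ∃ d : Module.Dual ℝ V, PrimalFeas v 0 F d ∧ 0 < d e

theorem unboundedDir_or_dualFeas (v : ι → V) (F : Finset ι) (e : V) :
    (∃ μ, DualFeas v F e Finset.univ μ) ∨ UnboundedDir v F e := by
  classical
  let w : ι ⊕ F → V := Sum.elim v (fun i => - v i)
  rcases farkas_finset Finset.univ w e with ⟨μ, hμ, he⟩ | ⟨d, hd, hde⟩
  · left
    refine ⟨fun i => μ (Sum.inl i) - if h : i ∈ F then μ (Sum.inr ⟨i, h⟩) else 0, by simp, ?_, ?_⟩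
    · rw [← he, Fintype.sum_sum_type]
      simp only [w, Sum.elim_inl, Sum.elim_inr, sub_smul, Finset.sum_sub_distrib, smul_neg,
        Finset.sum_neg_distrib, ← sub_eq_add_neg]
      congr 1
      rw [← Finset.sum_subset (Finset.subset_univ F), ← Finset.sum_attach F]
      · exact Finset.sum_congr rfl fun i _ => by simp
      · intro i _ hi; simp [hi]
    · intro i hi; simpa [hi] using hμ (Sum.inl i) (by simp)
  · right
    have h1 : ∀ i, d (v i) ≤ 0 := fun i => hd (Sum.inl i) (by simp)
    refine ⟨d, ⟨fun i hi => le_antisymm (h1 i) ?_, h1⟩, hde⟩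
    have := hd (Sum.inr ⟨i, hi⟩) (by simp)
    simpa [w] using this

theorem not_unboundedDir_of_dualFeas {v : ι → V} {F G : Finset ι} {e : V} {μ : ι → ℝ}
    (h : DualFeas v F e G μ) : ¬ UnboundedDir v F e := by
  rintro ⟨d, hd, hde⟩
  have := weak_duality h hd
  simp at this
  linarith

theorem OptimalBasis.exists_primalFeas {v : ι → V} {z : ι → ℝ} {F G : Finset ι} {e : V}
    (hFG : F ⊆ G) (h : OptimalBasis v z F e G) : ∃ c, PrimalFeas v z F c :=
  h.1.imp fun _ hc => ⟨fun i hi => hc.1 i (hFG hi), hc.2⟩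

theorem exists_primalFeas_of_unboundedDir [FiniteDimensional ℝ V] {v : ι → V} {z : ι → ℝ}
    {F : Finset ι}
    {e : V}
    (g1 : ∀ G : Finset ι, G.card = Module.finrank ℝ V → LinearIndepOn ℝ v (G : Set ι))
    (hm : Module.finrank ℝ V ≤ Fintype.card ι)
    (h : UnboundedDir v F e) : ∃ c, PrimalFeas v z F c := by
  classical
  obtain ⟨d, hd, hde⟩ := h
  let H : Finset ι := Finset.univ.filter fun i => d (v i) = 0
  have hH : H.card ≤ Module.finrank ℝ V := by
    by_contra! hcon
    obtain ⟨G, hGH, hG⟩ := Finset.exists_subset_card_eq hcon.le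
    have hspan := span_eq_top_of_card (g1 G hG) hG
    have : d = 0 := by
      refine LinearMap.ext_on_range (v := fun i : G => v i) ?_ fun i => ?_
      · rw [← hspan]; congr 1; ext x; simp
      · simpa [H] using hGH i.2
    simp [this] at hde
  obtain ⟨c, hc⟩ := exists_dual_of_linearIndepOn (linearIndepOn_of_card_le g1 hm hH) z
  have hex : ∃ t : ℝ, 0 ≤ t ∧ ∀ i, c (v i) + t * d (v i) ≤ z i := by
    have : ∀ i, ∃ t : ℝ, ∀ s, t ≤ s → c (v i) + s * d (v i) ≤ z i := by
      intro i
      rcases (hd.2 i).lt_or_eq with hlt | heq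
      · refine ⟨(z i - c (v i)) / d (v i), fun s hs => ?_⟩
        have hlt' : d (v i) < 0 := by simpa using hlt
        rw [div_le_iff_of_neg hlt'] at hs
        linarith
      · refine ⟨0, fun s _ => ?_⟩
        have : d (v i) = 0 := by simpa using heq
        rw [hc i (by simp [H, this]), this]; simp
    choose t ht using this
    refine ⟨∑ i, |t i|, by positivity, fun i => ht i _ ?_⟩
    exact (le_abs_self _).trans (Finset.single_le_sum (f := fun i => |t i|)
      (fun i _ => abs_nonneg _) (Finset.mem_univ i))
  obtain ⟨t, _, ht⟩ := hex
  refine ⟨c + t • d, fun i hi => ?_, fun i => by simpa using ht i⟩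
  have : d (v i) = 0 := by simpa using hd.1 i hi
  simp [this, hc i (by simp [H, this])]

theorem OptimalBasis.eq {v : ι → V} {z : ι → ℝ} {F : Finset ι} {e : V} {G G' : Finset ι}
    (g2 : ∀ c : Module.Dual ℝ V, ∀ H : Finset ι, (∀ i ∈ H, c (v i) = z i) →
      H.card ≤ Module.finrank ℝ V)
    (g3 : ∀ G : Finset ι, F ⊆ G → G.card = Module.finrank ℝ V → ∀ μ, DualFeas v F e G μ →
      ∀ i ∈ G, i ∉ F → μ i ≠ 0)
    (hFG : F ⊆ G) (hG : G.card = Module.finrank ℝ V)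
    (hFG' : F ⊆ G') (hG' : G'.card = Module.finrank ℝ V)
    (h : OptimalBasis v z F e G) (h' : OptimalBasis v z F e G') : G = G' := by
  classical
  obtain ⟨⟨c, hc⟩, μ, hμ⟩ := h
  obtain ⟨⟨c', hc'⟩, μ', hμ'⟩ := h'
  have hcF : PrimalFeas v z F c := ⟨fun i hi => hc.1 i (hFG hi), hc.2⟩
  have hcF' : PrimalFeas v z F c' := ⟨fun i hi => hc'.1 i (hFG' hi), hc'.2⟩
  have e1 : c e = ∑ i, μ i * z i := by
    rw [apply_eq_sum_of_dualFeas hμ]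
    refine Finset.sum_congr rfl fun i _ => ?_
    by_cases hi : i ∈ G
    · rw [hc.1 i hi]
    · simp [hμ.1 i hi]
  have e2 : c' e = ∑ i, μ' i * z i := by
    rw [apply_eq_sum_of_dualFeas hμ']
    refine Finset.sum_congr rfl fun i _ => ?_
    by_cases hi : i ∈ G'
    · rw [hc'.1 i hi]
    · simp [hμ'.1 i hi]
  have h1 : ∑ i, μ i * z i ≤ c' e := by
    rw [← e1, e2]; exact weak_duality hμ' hcF
  have key : ∀ i ∈ G, c' (v i) = z i := by
    intro i hi
    by_cases hiF : i ∈ F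
    · exact hcF'.1 i hiF
    · exact complementary_slackness hμ hcF' h1 i (g3 G hFG hG μ hμ i hi hiF)
  have hcard := g2 c' (G ∪ G') fun i hi => by
    rcases Finset.mem_union.1 hi with hi | hi
    · exact key i hi
    · exact hc'.1 i hi
  have a1 : G = G ∪ G' := Finset.eq_of_subset_of_card_le Finset.subset_union_left (by omega)
  have a2 : G' = G ∪ G' := Finset.eq_of_subset_of_card_le Finset.subset_union_right (by omega)
  exact a1.trans a2.symm

/-- Strong duality in general position: a feasible bounded program has an optimal basis. -/
theorem exists_optimalBasis [FiniteDimensional ℝ V] {v : ι → V} {z : ι → ℝ} {F : Finset ι} {e : V}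
    (g1 : ∀ G : Finset ι, G.card = Module.finrank ℝ V → LinearIndepOn ℝ v (G : Set ι))
    (g3 : ∀ G : Finset ι, F ⊆ G → G.card = Module.finrank ℝ V → ∀ μ, DualFeas v F e G μ →
      ∀ i ∈ G, i ∉ F → μ i ≠ 0)
    (hm : Module.finrank ℝ V ≤ Fintype.card ι) (hF : F.card ≤ Module.finrank ℝ V)
    (hL : ∃ c, PrimalFeas v z F c) (hU : ¬ UnboundedDir v F e) :
    ∃ G : Finset ι, F ⊆ G ∧ G.card = Module.finrank ℝ V ∧ OptimalBasis v z F e G := by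
  classical
  obtain ⟨G₀, hFG₀, hG₀, μ₀, hμ₀⟩ := exists_basic_dualFeas g1 hm hF
    ((unboundedDir_or_dualFeas v F e).resolve_right hU)
  let 𝒟 : Finset (Finset ι) := Finset.univ.filter fun G =>
    F ⊆ G ∧ G.card = Module.finrank ℝ V ∧ ∃ μ, DualFeas v F e G μ
  have hex : ∀ G : Finset ι, ∃ μ, (∃ μ, DualFeas v F e G μ) → DualFeas v F e G μ := by
    intro G
    by_cases h : ∃ μ, DualFeas v F e G μ
    · exact ⟨h.choose, fun _ => h.choose_spec⟩
    · exact ⟨0, fun h' => absurd h' h⟩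
  choose sol hsol using hex
  obtain ⟨G, hGmem, hmin⟩ := Finset.exists_min_image 𝒟 (fun G => ∑ i, sol G i * z i)
    ⟨G₀, by simp only [𝒟, Finset.mem_filter, Finset.mem_univ, true_and]; exact ⟨hFG₀, hG₀, μ₀, hμ₀⟩⟩
  simp only [𝒟, Finset.mem_filter, Finset.mem_univ, true_and] at hGmem hmin
  obtain ⟨hFG, hG, hμex⟩ := hGmem
  have hμ := hsol G hμex
  set μ := sol G
  refine ⟨G, hFG, hG, ?_, μ, hμ⟩
  obtain ⟨c, hc⟩ := exists_dual_of_linearIndepOn (g1 G hG) z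
  refine ⟨c, hc, ?_⟩
  by_contra! hcon
  obtain ⟨j, hj⟩ := hcon
  have hjG : j ∉ G := fun h => hj.ne' (hc j h)
  obtain ⟨ν, hνG, hν⟩ := exists_sum_of_mem_span (v := v) (G := G) (x := v j)
    (by rw [span_eq_top_of_card (g1 G hG) hG]; trivial)
  have hcj : c (v j) = ∑ i, ν i * z i := by
    rw [← hν, map_sum]
    refine Finset.sum_congr rfl fun i _ => ?_
    by_cases hi : i ∈ G
    · simp [hc i hi]
    · simp [hνG i hi]
  obtain ⟨c₀, hc₀⟩ := hL
  have hpos : ∃ i ∉ F, 0 < ν i := by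
    by_contra! hneg
    have : c₀ (v j) = ∑ i, ν i * c₀ (v i) := by rw [← hν, map_sum]; simp
    have h2 : ∑ i, ν i * z i ≤ ∑ i, ν i * c₀ (v i) := by
      refine Finset.sum_le_sum fun i _ => ?_
      by_cases hi : i ∈ F
      · rw [hc₀.1 i hi]
      · exact mul_le_mul_of_nonpos_left (hc₀.2 i) (hneg i hi)
    have := hc₀.2 j
    linarith
  obtain ⟨t, i₀, hi₀F, hνi₀, htdef, ht⟩ := exists_ratio F hμ.2.2 hpos
  have hi₀G : i₀ ∈ G := by by_contra h; exact hνi₀.ne' (hνG i₀ h)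
  have hjF : j ∉ F := fun h => hjG (hFG h)
  have hνj : ν j = 0 := hνG j hjG
  have htpos : 0 < t := by
    rw [htdef]
    exact div_pos (lt_of_le_of_ne (hμ.2.2 i₀ hi₀F) (g3 G hFG hG μ hμ i₀ hi₀G hi₀F).symm) hνi₀
  let G' := insert j (G.erase i₀)
  have hG' : G'.card = Module.finrank ℝ V := by
    rw [Finset.card_insert_of_notMem (fun h => hjG (Finset.mem_of_mem_erase h)),
      Finset.card_erase_of_mem hi₀G, ← hG]
    have := Finset.card_pos.2 ⟨i₀, hi₀G⟩
    omega
  have hFG' : F ⊆ G' := fun i hi => Finset.mem_insert_of_mem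
    (Finset.mem_erase.2 ⟨by rintro rfl; exact hi₀F hi, hFG hi⟩)
  let μ' : ι → ℝ := fun i => μ i - t * ν i + if i = j then t else 0
  have hμ' : DualFeas v F e G' μ' := by
    refine ⟨fun i hi => ?_, ?_, fun i hi => ?_⟩
    · have hij : i ≠ j := by rintro rfl; exact hi (Finset.mem_insert_self _ _)
      simp only [μ', hij, if_false, add_zero]
      by_cases hii : i = i₀
      · subst hii; rw [htdef]; field_simp; simp
      · have : i ∉ G := fun h => hi (Finset.mem_insert_of_mem (Finset.mem_erase.2 ⟨hii, h⟩))
        simp [hμ.1 i this, hνG i this]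
    · simp only [μ', add_smul, sub_smul, mul_smul, Finset.sum_add_distrib, Finset.sum_sub_distrib,
        ← Finset.smul_sum, hν, hμ.2.1]
      simp
    · have := ht i hi
      simp only [μ']
      split_ifs <;> linarith
  have huniq : sol G' = μ' := by
    have h1 := hsol G' ⟨μ', hμ'⟩
    have : sol G' - μ' = 0 := eq_zero_of_sum_eq_zero (g1 G' hG')
      (fun i hi => by simp [h1.1 i hi, hμ'.1 i hi])
      (by simp [sub_smul, Finset.sum_sub_distrib, h1.2.1, hμ'.2.1])
    exact sub_eq_zero.1 this
  have hle := hmin G' ⟨hFG', hG', μ', hμ'⟩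
  rw [huniq] at hle
  have : ∑ i, μ' i * z i = ∑ i, μ i * z i - t * ∑ i, ν i * z i + t * z j := by
    simp only [μ', add_mul, sub_mul, Finset.sum_add_distrib, Finset.sum_sub_distrib, Finset.mul_sum,
      mul_assoc]
    simp
  rw [this, ← hcj] at hle
  nlinarith

end LinearProgramming

/-! ### Arithmetic of the trigonometric integrals -/

section Arithmetic

/-- The rational span of `π⁰, π⁻², …, π^(-2 j)` with `2 j ≤ r`. -/
def piSpan (r : ℕ) : Submodule ℚ ℝ :=
  Submodule.span ℚ {x | ∃ j : ℕ, 2 * j ≤ r ∧ x = π ^ (-(2 * (j : ℤ)))}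

theorem piSpan_mono {r s : ℕ} (h : r ≤ s) : piSpan r ≤ piSpan s :=
  Submodule.span_mono fun _ ⟨j, hj, hx⟩ => ⟨j, hj.trans h, hx⟩

theorem mul_mem_piSpan {r s : ℕ} {x y : ℝ} (hx : x ∈ piSpan r) (hy : y ∈ piSpan s) :
    x * y ∈ piSpan (r + s) := by
  have h := Submodule.mul_mem_mul hx hy
  rw [piSpan, piSpan, Submodule.span_mul_span] at h
  refine Submodule.span_mono ?_ h
  rintro _ ⟨_, ⟨i, hi, rfl⟩, _, ⟨j, hj, rfl⟩, rfl⟩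
  refine ⟨i + j, by omega, ?_⟩
  simp only
  rw [← zpow_add₀ pi_ne_zero]
  congr 1
  push_cast
  ring

theorem ratCast_mul_mem {M : Submodule ℚ ℝ} {x : ℝ} (q : ℚ) (hx : x ∈ M) : (q : ℝ) * x ∈ M := by
  rw [← Rat.smul_def]
  exact M.smul_mem q hx

theorem ratCast_mem_piSpan (q : ℚ) (r : ℕ) : (q : ℝ) ∈ piSpan r := by
  rw [← mul_one (q : ℝ)]
  exact ratCast_mul_mem q (Submodule.subset_span ⟨0, by omega, by simp⟩)

theorem exists_coeff_of_mem_piSpan {r : ℕ} {x : ℝ} (hx : x ∈ piSpan r) :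
    ∃ q : ℕ → ℚ, x = ∑ j ∈ Finset.range (r / 2 + 1), (q j : ℝ) * π ^ (-(2 * (j : ℤ))) := by
  induction hx using Submodule.span_induction with
  | mem x h =>
    obtain ⟨j, hj, rfl⟩ := h
    refine ⟨fun i => if i = j then 1 else 0, ?_⟩
    rw [Finset.sum_eq_single j]
    · simp
    · intro i _ hij; simp [hij]
    · intro h; exact absurd (Finset.mem_range.2 (by omega)) h
  | zero => exact ⟨0, by simp⟩
  | add x y _ _ hx hy =>
    obtain ⟨q, rfl⟩ := hx
    obtain ⟨q', rfl⟩ := hy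
    exact ⟨fun j => q j + q' j, by simp [add_mul, Finset.sum_add_distrib]⟩
  | smul a x _ hx =>
    obtain ⟨q, rfl⟩ := hx
    refine ⟨fun j => a * q j, ?_⟩
    rw [Rat.smul_def, Finset.mul_sum]
    exact Finset.sum_congr rfl fun j _ => by push_cast; ring

/-- The rational span of `π^c` with `1 ≤ c ≤ d` and `c ≡ d` modulo `2`. -/
def piPowSpan (d : ℕ) : Submodule ℚ ℝ :=
  Submodule.span ℚ {x | ∃ c : ℕ, 1 ≤ c ∧ c ≤ d ∧ Even (c + d) ∧ x = π ^ c}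

theorem piPowSpan_mono {d e : ℕ} (h : d ≤ e) (h' : Even (d + e)) : piPowSpan d ≤ piPowSpan e :=
  Submodule.span_mono fun _ ⟨c, h1, h2, h3, hx⟩ => ⟨c, h1, h2.trans h, by grind, hx⟩

theorem div_pi_pow_mem_piSpan {d : ℕ} {x : ℝ} (hx : x ∈ piPowSpan (d + 1)) :
    x / π ^ (d + 1) ∈ piSpan d := by
  induction hx using Submodule.span_induction with
  | mem x h =>
    obtain ⟨c, h1, h2, h3, rfl⟩ := h
    obtain ⟨i, hi⟩ : ∃ i, d + 1 = c + 2 * i := ⟨(d + 1 - c) / 2, by grind⟩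
    refine Submodule.subset_span ⟨i, by omega, ?_⟩
    rw [hi, pow_add, zpow_neg, div_mul_eq_div_div, div_self (pow_ne_zero _ pi_ne_zero), one_div]
    norm_cast
  | zero => simp
  | add x y _ _ hx hy => rw [add_div]; exact add_mem hx hy
  | smul a x _ hx =>
    rw [Rat.smul_def, mul_div_assoc]
    exact ratCast_mul_mem a hx

theorem integral_pow_mul_sin_pow_mul_cos (a q : ℕ) :
    (2 * q + 2 : ℝ) * ∫ t in (0 : ℝ)..π, t ^ (a + 1) * (sin t ^ (2 * q + 1) * cos t) =
      -((a + 1 : ℝ) * ∫ t in (0 : ℝ)..π, t ^ a * sin t ^ (2 * q + 2)) := by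
  have h := intervalIntegral.integral_mul_deriv_eq_deriv_mul (a := 0) (b := π)
    (u := fun t : ℝ => t ^ (a + 1)) (u' := fun t => ((a + 1 : ℕ) : ℝ) * t ^ a)
    (v := fun t => sin t ^ (2 * q + 2)) (v' := fun t => (2 * q + 2) * (sin t ^ (2 * q + 1) * cos t))
    (fun t _ => by simpa using hasDerivAt_pow (a + 1) t)
    (fun t _ => by
      have := (hasDerivAt_sin t).fun_pow (2 * q + 2)
      convert this using 1
      push_cast
      ring)
    (by apply Continuous.intervalIntegrable; fun_prop)
    (by apply Continuous.intervalIntegrable; fun_prop)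
  simp only [sin_pi, sin_zero] at h
  rw [← intervalIntegral.integral_const_mul, ← intervalIntegral.integral_const_mul]
  have e : ∀ t : ℝ, (2 * q + 2) * (t ^ (a + 1) * (sin t ^ (2 * q + 1) * cos t)) =
      t ^ (a + 1) * ((2 * q + 2) * (sin t ^ (2 * q + 1) * cos t)) := fun t => by ring
  simp only [e, h]
  simp [mul_assoc]

theorem integral_pow_mul_sin_pow_succ (a q : ℕ) :
    (2 * q + 2 : ℝ) * ∫ t in (0 : ℝ)..π, t ^ (a + 1) * sin t ^ (2 * q + 2) =
      (2 * q + 1 : ℝ) * (∫ t in (0 : ℝ)..π, t ^ (a + 1) * sin t ^ (2 * q)) +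
      (a + 1 : ℝ) * ∫ t in (0 : ℝ)..π, t ^ a * (sin t ^ (2 * q + 1) * cos t) := by
  have h := intervalIntegral.integral_mul_deriv_eq_deriv_mul (a := 0) (b := π)
    (u := fun t : ℝ => t ^ (a + 1)) (u' := fun t => ((a + 1 : ℕ) : ℝ) * t ^ a)
    (v := fun t => sin t ^ (2 * q + 1) * cos t)
    (v' := fun t => (2 * q + 1) * sin t ^ (2 * q) - (2 * q + 2) * sin t ^ (2 * q + 2))
    (fun t _ => by simpa using hasDerivAt_pow (a + 1) t)
    (fun t _ => by
      have := ((hasDerivAt_sin t).fun_pow (2 * q + 1)).fun_mul (hasDerivAt_cos t)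
      convert this using 1
      push_cast
      have := sin_sq_add_cos_sq t
      have h2 : cos t ^ 2 = 1 - sin t ^ 2 := by linarith
      linear_combination (-(2 * q + 1) * sin t ^ (2 * q)) * h2)
    (by apply Continuous.intervalIntegrable; fun_prop)
    (by apply Continuous.intervalIntegrable; fun_prop)
  simp only [sin_pi, sin_zero, mul_sub] at h
  rw [intervalIntegral.integral_sub (by apply Continuous.intervalIntegrable; fun_prop)
    (by apply Continuous.intervalIntegrable; fun_prop)] at h
  simp only [← mul_assoc, mul_comm (_ ^ (a + 1)) (_ + _)] at h
  simp only [mul_assoc, intervalIntegral.integral_const_mul] at h ⊢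
  push_cast at h
  have : (0 : ℝ) ^ (2 * q + 1) = 0 := by simp
  simp only [this] at h
  linarith

theorem integral_sin_pow_even_eq_rat (q : ℕ) :
    ∃ r : ℚ, 0 < r ∧ ∫ t in (0 : ℝ)..π, sin t ^ (2 * q) = r * π := by
  refine ⟨∏ i ∈ Finset.range q, (2 * i + 1) / (2 * i + 2), ?_, ?_⟩
  · exact Finset.prod_pos fun i _ => by positivity
  · rw [integral_sin_pow_even]; push_cast; ring

theorem integral_pow_mul_sin_pow_mem (a : ℕ) :
    (∀ q : ℕ, ∫ t in (0 : ℝ)..π, t ^ a * sin t ^ (2 * q) ∈ piPowSpan (a + 1)) ∧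
    (∀ q : ℕ, ∫ t in (0 : ℝ)..π, t ^ a * (sin t ^ (2 * q + 1) * cos t) ∈ piPowSpan a) := by
  induction a with
  | zero =>
    refine ⟨fun q => ?_, fun q => ?_⟩
    · obtain ⟨r, -, hr⟩ := integral_sin_pow_even_eq_rat q
      simp only [pow_zero, one_mul, hr]
      exact ratCast_mul_mem r (Submodule.subset_span ⟨1, by simp, by simp, by decide, by simp⟩)
    · have : ∫ t in (0 : ℝ)..π, t ^ 0 * (sin t ^ (2 * q + 1) * cos t) = 0 := by
        have := integral_sin_pow_mul_cos_pow_odd (a := 0) (b := π) (2 * q + 1) 0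
        simpa using this
      rw [this]
      exact zero_mem _
  | succ a ih =>
    have hB : ∀ q : ℕ, ∫ t in (0 : ℝ)..π, t ^ (a + 1) * (sin t ^ (2 * q + 1) * cos t) ∈
        piPowSpan (a + 1) := by
      intro q
      have h := integral_pow_mul_sin_pow_mul_cos a q
      have h2 := ratCast_mul_mem (-((a + 1) / (2 * q + 2)) : ℚ) (ih.1 (q + 1))
      convert h2 using 1
      push_cast
      rw [show 2 * (q + 1) = 2 * q + 2 by ring]
      generalize (∫ t in (0 : ℝ)..π, t ^ (a + 1) * (sin t ^ (2 * q + 1) * cos t)) = x at h ⊢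
      generalize (∫ t in (0 : ℝ)..π, t ^ a * sin t ^ (2 * q + 2)) = y at h ⊢
      field_simp
      linarith
    refine ⟨fun q => ?_, hB⟩
    induction q with
    | zero =>
      simp only [mul_zero, pow_zero, mul_one, integral_pow]
      have := ratCast_mul_mem (M := piPowSpan (a + 1 + 1)) (x := π ^ (a + 2)) (1 / (a + 2) : ℚ)
        (Submodule.subset_span ⟨a + 2, by simp, by simp, by grind, rfl⟩)
      convert this using 1
      push_cast
      rw [zero_pow (by omega)]
      ring
    | succ q ihq =>
      have h := integral_pow_mul_sin_pow_succ a q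
      have h1 := ratCast_mul_mem ((2 * q + 1) / (2 * q + 2) : ℚ) ihq
      have h2 := ratCast_mul_mem ((a + 1) / (2 * q + 2) : ℚ)
        (piPowSpan_mono (d := a) (e := a + 1 + 1) (by omega) (by grind) (ih.2 q))
      convert add_mem h1 h2 using 1
      push_cast
      rw [show 2 * (q + 1) = 2 * q + 2 by ring]
      generalize (∫ t in (0 : ℝ)..π, t ^ (a + 1) * sin t ^ (2 * q + 2)) = x at h ⊢
      generalize (∫ t in (0 : ℝ)..π, t ^ (a + 1) * sin t ^ (2 * q)) = y at h ⊢
      generalize (∫ t in (0 : ℝ)..π, t ^ a * (sin t ^ (2 * q + 1) * cos t)) = w at h ⊢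
      field_simp
      linarith

/-- The rational span of the functions `t^a sin^b cos^c` with `a ≤ d` and `b ≡ c ≡ d - a`
modulo `2`. -/
def trigSpan (d : ℕ) : Submodule ℚ (ℝ → ℝ) :=
  Submodule.span ℚ {f | ∃ a b c : ℕ, a ≤ d ∧ Even (a + b + d) ∧ Even (b + c) ∧
    f = fun t => t ^ a * (sin t ^ b * cos t ^ c)}

theorem mul_mem_trigSpan {d e : ℕ} {f g : ℝ → ℝ} (hf : f ∈ trigSpan d) (hg : g ∈ trigSpan e) :
    f * g ∈ trigSpan (d + e) := by
  have h := Submodule.mul_mem_mul hf hg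
  rw [trigSpan, trigSpan, Submodule.span_mul_span] at h
  refine Submodule.span_mono ?_ h
  rintro _ ⟨_, ⟨a, b, c, h1, h2, h3, rfl⟩, _, ⟨a', b', c', h1', h2', h3', rfl⟩, rfl⟩
  refine ⟨a + a', b + b', c + c', by omega, by grind, by grind, ?_⟩
  funext t
  simp only [Pi.mul_apply]
  ring

theorem pow_mem_trigSpan {f : ℝ → ℝ} (hf : f ∈ trigSpan 1) (N : ℕ) : f ^ N ∈ trigSpan N := by
  induction N with
  | zero => exact Submodule.subset_span ⟨0, 0, 0, by simp, by simp, by simp, by ext; simp⟩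
  | succ N ih => rw [pow_succ]; exact mul_mem_trigSpan ih hf

theorem sin_pow_mem_trigSpan (q : ℕ) : (fun t : ℝ => sin t ^ (2 * q)) ∈ trigSpan 0 :=
  Submodule.subset_span ⟨0, 2 * q, 0, by simp, by simp, by simp, by ext; simp⟩

theorem integral_sin_pow_mem_trigSpan (q : ℕ) :
    (fun t : ℝ => ∫ s in (0 : ℝ)..t, sin s ^ (2 * q)) ∈ trigSpan 1 := by
  induction q with
  | zero => exact Submodule.subset_span ⟨1, 0, 0, by simp, by decide, by simp, by ext; simp⟩
  | succ q ih =>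
    have h1 : (fun t : ℝ => t ^ 0 * (sin t ^ (2 * q + 1) * cos t ^ 1)) ∈ trigSpan 1 :=
      Submodule.subset_span ⟨0, 2 * q + 1, 1, by simp, by grind, by grind, rfl⟩
    convert add_mem ((trigSpan 1).smul_mem (-(1 / (2 * q + 2)) : ℚ) h1)
      ((trigSpan 1).smul_mem ((2 * q + 1) / (2 * q + 2) : ℚ) ih) using 1
    funext t
    rw [show 2 * (q + 1) = 2 * q + 2 by ring, integral_sin_pow]
    simp only [Pi.add_apply, Pi.smul_apply, Rat.smul_def]
    push_cast
    rw [sin_zero, zero_pow (by omega)]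
    ring

theorem integral_mem_of_mem_trigSpan {d : ℕ} {f : ℝ → ℝ} (hf : f ∈ trigSpan d) :
    Continuous f ∧ ∫ t in (0 : ℝ)..π, f t ∈ piPowSpan (d + 1) := by
  induction hf using Submodule.span_induction with
  | mem f h =>
    obtain ⟨a, b, c, h1, h2, h3, rfl⟩ := h
    refine ⟨by fun_prop, ?_⟩
    induction c using Nat.strong_induction_on generalizing b with
    | _ c ih =>
      match c with
      | 0 =>
        obtain ⟨q, rfl⟩ : ∃ q, b = 2 * q := ⟨b / 2, by grind⟩
        simpa using piPowSpan_mono (by omega) (by grind) ((integral_pow_mul_sin_pow_mem a).1 q)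
      | 1 =>
        obtain ⟨q, rfl⟩ : ∃ q, b = 2 * q + 1 := ⟨b / 2, by grind⟩
        simpa using piPowSpan_mono (by omega) (by grind) ((integral_pow_mul_sin_pow_mem a).2 q)
      | c + 2 =>
        have e : (fun t : ℝ => t ^ a * (sin t ^ b * cos t ^ (c + 2))) =
            fun t => t ^ a * (sin t ^ b * cos t ^ c) - t ^ a * (sin t ^ (b + 2) * cos t ^ c) := by
          funext t
          have := cos_sq' t
          rw [pow_add (cos t), this]
          ring
        rw [e, intervalIntegral.integral_sub (by apply Continuous.intervalIntegrable; fun_prop)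
          (by apply Continuous.intervalIntegrable; fun_prop)]
        exact sub_mem (ih c (by omega) b h2 (by grind)) (ih c (by omega) (b + 2) (by grind)
          (by grind))
  | zero => exact ⟨continuous_const, by simp⟩
  | add f g _ _ hf hg =>
    refine ⟨hf.1.add hg.1, ?_⟩
    simp only [Pi.add_apply]
    rw [intervalIntegral.integral_add (hf.1.intervalIntegrable _ _) (hg.1.intervalIntegrable _ _)]
    exact add_mem hf.2 hg.2
  | smul r f _ hf =>
    refine ⟨hf.1.const_smul r, ?_⟩
    simp only [Pi.smul_apply, Rat.smul_def]
    rw [intervalIntegral.integral_const_mul]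
    exact ratCast_mul_mem r hf.2

/-- The weighted moments of the normalized incomplete integral of `sin^(2 p)`. -/
theorem integral_ratio_mem_piSpan (p q N : ℕ) :
    (∫ t in (0 : ℝ)..π, sin t ^ (2 * q) *
      ((∫ s in (0 : ℝ)..t, sin s ^ (2 * p)) / ∫ s in (0 : ℝ)..π, sin s ^ (2 * p)) ^ N) /
      (∫ t in (0 : ℝ)..π, sin t ^ (2 * q)) ∈ piSpan N := by
  obtain ⟨r, hr, hr'⟩ := integral_sin_pow_even_eq_rat p
  obtain ⟨s, hs, hs'⟩ := integral_sin_pow_even_eq_rat q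
  have h := mul_mem_trigSpan (sin_pow_mem_trigSpan q)
    (pow_mem_trigSpan (integral_sin_pow_mem_trigSpan p) N)
  rw [zero_add] at h
  have h2 := ratCast_mul_mem (1 / (r ^ N * s)) (div_pi_pow_mem_piSpan
    (integral_mem_of_mem_trigSpan h).2)
  convert h2 using 1
  rw [hr', hs']
  simp only [div_pow, ← mul_div_assoc, intervalIntegral.integral_div, Pi.mul_apply, Pi.pow_apply]
  have := pi_ne_zero
  have hr2 : (r : ℝ) ≠ 0 := by exact_mod_cast hr.ne'
  have hs2 : (s : ℝ) ≠ 0 := by exact_mod_cast hs.ne'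
  push_cast
  field_simp
  ring

end Arithmetic

/-! ### Product measures and affine changes of variables -/

section ChangeOfVariables

theorem lintegral_fin_prod_eq_prod {X : Type*} [MeasurableSpace X] (μ : Measure X) [SigmaFinite μ]
    (n : ℕ) (f : Fin n → X → ENNReal) (hf : ∀ i, Measurable (f i)) :
    ∫⁻ x : Fin n → X, ∏ i, f i (x i) ∂(Measure.pi fun _ => μ) = ∏ i, ∫⁻ x, f i x ∂μ := by
  induction n with
  | zero => simp
  | succ n ih =>
    rw [← ((measurePreserving_piFinSuccAbove (fun _ : Fin (n + 1) => μ) 0).symm).lintegral_comp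
      (by fun_prop)]
    rw [Fin.prod_univ_succ, ← ih _ fun i => hf i.succ,
      ← lintegral_prod_mul (hf 0).aemeasurable
        (Finset.measurable_prod _ fun i _ => (hf i.succ).comp (measurable_pi_apply i)).aemeasurable]
    refine lintegral_congr fun x => ?_
    simp [Fin.prod_univ_succ, MeasurableEquiv.piFinSuccAbove_symm_apply, Fin.insertNthEquiv]

theorem pi_withDensity {X : Type*} [MeasurableSpace X] (μ : Measure X) [SigmaFinite μ]
    (n : ℕ) {w : X → ENNReal} (hw : Measurable w) [SigmaFinite (μ.withDensity w)] :
    (Measure.pi fun _ : Fin n => μ.withDensity w) =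
      (Measure.pi fun _ : Fin n => μ).withDensity fun x => ∏ i, w (x i) := by
  refine Measure.pi_eq fun s hs => ?_
  rw [withDensity_apply _ (MeasurableSet.univ_pi hs),
    ← lintegral_indicator (MeasurableSet.univ_pi hs)]
  have : (Set.univ.pi s).indicator (fun x : Fin n → X => ∏ i, w (x i)) =
      fun x => ∏ i, (s i).indicator w (x i) := by
    funext x
    by_cases hx : x ∈ Set.univ.pi s
    · rw [Set.indicator_of_mem hx]
      exact Finset.prod_congr rfl fun i _ => by rw [Set.indicator_of_mem (hx i trivial)]
    · rw [Set.indicator_of_notMem hx]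
      simp only [Set.mem_pi, not_forall] at hx
      obtain ⟨i, -, hi⟩ := hx
      exact (Finset.prod_eq_zero (Finset.mem_univ i) (Set.indicator_of_notMem hi _)).symm
  rw [this, lintegral_fin_prod_eq_prod μ n (fun i => (s i).indicator w) fun i => hw.indicator (hs i)]
  refine Finset.prod_congr rfl fun i _ => ?_
  rw [withDensity_apply _ (hs i), lintegral_indicator (hs i)]

variable {E : Type*} [NormedAddCommGroup E] [NormedSpace ℝ E] [FiniteDimensional ℝ E]
  [MeasurableSpace E] [BorelSpace E] (μ : Measure E) [μ.IsAddHaarMeasure]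

theorem lintegral_comp_affine {T : E →ₗ[ℝ] E} (hT : LinearMap.det T ≠ 0) (v : E)
    {f : E → ENNReal} (hf : Measurable f) :
    ∫⁻ x, f x ∂μ = ENNReal.ofReal |LinearMap.det T| * ∫⁻ x, f (T x + v) ∂μ := by
  have hTm : Measurable T := T.continuous_of_finiteDimensional.measurable
  have h1 : ∫⁻ x, f (T x + v) ∂μ = ∫⁻ x, f (x + v) ∂(μ.map T) :=
    (lintegral_map (f := fun x => f (x + v)) (by fun_prop) hTm).symm
  rw [h1, Measure.map_linearMap_addHaar_eq_smul_addHaar μ hT, lintegral_smul_measure,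
    lintegral_add_right_eq_self, smul_eq_mul, ← mul_assoc, ← ENNReal.ofReal_mul (abs_nonneg _),
    ← abs_mul, mul_inv_cancel₀ hT]
  simp

theorem lintegral_pi_comp_affine (m : ℕ) {T : E →ₗ[ℝ] E} (hT : LinearMap.det T ≠ 0) (v : E)
    {f : (Fin m → E) → ENNReal} (hf : Measurable f) :
    ∫⁻ x, f x ∂(Measure.pi fun _ => μ) = ENNReal.ofReal |LinearMap.det T| ^ m *
      ∫⁻ x, f (fun i => T (x i) + v) ∂(Measure.pi fun _ => μ) := by
  have hdet : LinearMap.det (LinearMap.pi fun i : Fin m => T.comp (LinearMap.proj i)) =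
      LinearMap.det T ^ m := by
    rw [LinearMap.det_pi]; simp
  rw [lintegral_comp_affine (Measure.pi fun _ => μ) (hdet ▸ pow_ne_zero m hT) (fun _ => v) hf, hdet,
    abs_pow, ENNReal.ofReal_pow (abs_nonneg _)]
  rfl

end ChangeOfVariables

/-! ### Beta weights and their marginals -/

section BetaWeights

/-- Euclidean space of dimension `l`. -/
abbrev Euc (l : ℕ) := EuclideanSpace ℝ (Fin l)

/-- The weight `(1 - r)^γ` for `r < 1`, where `r` stands for a squared norm. -/
def wgt (γ r : ℝ) : ENNReal := ENNReal.ofReal (if r < 1 then (1 - r) ^ γ else 0)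

@[fun_prop]
theorem measurable_wgt (γ : ℝ) : Measurable (wgt γ) :=
  (Measurable.ite measurableSet_Iio (by fun_prop) measurable_const).ennreal_ofReal

theorem wgt_of_one_le {γ r : ℝ} (hr : 1 ≤ r) : wgt γ r = 0 := by
  simp [wgt, not_lt.2 hr]

theorem wgt_add_mul {γ r : ℝ} (hr : r < 1) (y : ℝ) :
    wgt γ (r + (1 - r) * y) = ENNReal.ofReal ((1 - r) ^ γ) * wgt γ y := by
  have h1 : 0 < 1 - r := by linarith
  have h2 : r + (1 - r) * y < 1 ↔ y < 1 := by
    constructor <;> intro h <;> nlinarith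
  simp only [wgt, h2]
  split_ifs with hy
  · rw [← ENNReal.ofReal_mul (rpow_nonneg h1.le _), ← mul_rpow h1.le (by linarith)]
    congr 2; ring
  · simp

/-- The marginals of beta weights are beta weights. -/
theorem lintegral_wgt_add {E : Type*} [NormedAddCommGroup E] [NormedSpace ℝ E]
    [FiniteDimensional ℝ E] [MeasurableSpace E] [BorelSpace E] (μ : Measure E)
    [μ.IsAddHaarMeasure] (γ r : ℝ) :
    ∫⁻ y, wgt γ (r + ‖y‖ ^ 2) ∂μ =
      wgt (γ + Module.finrank ℝ E / 2) r * ∫⁻ y, wgt γ (‖y‖ ^ 2) ∂μ := by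
  rcases lt_or_ge r 1 with h | h
  · have h1 : 0 < 1 - r := by linarith
    have hs : 0 < √(1 - r) := sqrt_pos.2 h1
    have hdet : LinearMap.det (√(1 - r) • (LinearMap.id : E →ₗ[ℝ] E)) =
        √(1 - r) ^ Module.finrank ℝ E := by
      rw [LinearMap.det_smul, LinearMap.det_id, mul_one]
    have hm : Measurable fun y : E => wgt γ (r + ‖y‖ ^ 2) := by fun_prop
    rw [lintegral_comp_affine μ (hdet ▸ (pow_pos hs _).ne') 0 hm, hdet]
    have : ∀ y : E, wgt γ (r + ‖(√(1 - r) • (LinearMap.id : E →ₗ[ℝ] E)) y + 0‖ ^ 2) =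
        ENNReal.ofReal ((1 - r) ^ γ) * wgt γ (‖y‖ ^ 2) := by
      intro y
      rw [← wgt_add_mul h]
      simp only [LinearMap.smul_apply, LinearMap.id_apply, add_zero, norm_smul, mul_pow, norm_eq_abs,
        sq_abs, sq_sqrt h1.le]
    simp only [this]
    rw [lintegral_const_mul _ (by fun_prop), ← mul_assoc, abs_of_pos (pow_pos hs _),
      ← ENNReal.ofReal_mul (pow_pos hs _).le, wgt, if_pos h]
    congr 2
    rw [sqrt_eq_rpow, ← rpow_natCast, ← rpow_mul h1.le, ← rpow_add h1]
    congr 1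
    ring
  · rw [wgt_of_one_le h, zero_mul]
    have : ∀ y : E, wgt γ (r + ‖y‖ ^ 2) = 0 := fun y => wgt_of_one_le (by nlinarith [sq_nonneg ‖y‖])
    simp [this]

theorem lintegral_wgt_sq {γ : ℝ} (hγ : -1 < γ) :
    ∫⁻ t : ℝ, wgt γ (t ^ 2) = ENNReal.ofReal (√π * Gamma (γ + 1) / Gamma (γ + 1 + 1 / 2)) := by
  have hb : 0 < ProbabilityTheory.beta (γ + 1) (γ + 1) :=
    ProbabilityTheory.beta_pos (by linarith) (by linarith)
  have h1 := ProbabilityTheory.lintegral_betaPDF_eq_one (α := γ + 1) (β := γ + 1) (by linarith)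
    (by linarith)
  have hdet : LinearMap.det ((2 : ℝ) • (LinearMap.id : ℝ →ₗ[ℝ] ℝ)) = 2 := by
    rw [LinearMap.det_smul, LinearMap.det_id]; simp
  rw [lintegral_comp_affine volume (T := (2 : ℝ) • (LinearMap.id : ℝ →ₗ[ℝ] ℝ))
    (by rw [hdet]; exact two_ne_zero) (-1) (by fun_prop), hdet]
  have e : ∀ x : ℝ, wgt γ ((((2 : ℝ) • (LinearMap.id : ℝ →ₗ[ℝ] ℝ)) x + -1) ^ 2) =
      ENNReal.ofReal (4 ^ γ * ProbabilityTheory.beta (γ + 1) (γ + 1)) *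
        ProbabilityTheory.betaPDF (γ + 1) (γ + 1) x := by
    intro x
    have hx : (((2 : ℝ) • (LinearMap.id : ℝ →ₗ[ℝ] ℝ)) x + -1) ^ 2 = 1 - 4 * (x * (1 - x)) := by
      simp; ring
    have h2 : 1 - 4 * (x * (1 - x)) < 1 ↔ 0 < x ∧ x < 1 := by
      constructor
      · intro h
        exact ⟨by nlinarith [sq_nonneg x], by nlinarith [sq_nonneg (1 - x)]⟩
      · rintro ⟨h, h'⟩
        nlinarith [mul_pos h (sub_pos.2 h')]
    rw [hx, wgt, ProbabilityTheory.betaPDF_eq,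
      ← ENNReal.ofReal_mul (mul_nonneg (by positivity) hb.le)]
    simp only [h2]
    congr 1
    split_ifs with h
    · rw [sub_sub_cancel, mul_rpow (by norm_num) (mul_nonneg h.1.le (by linarith [h.2])),
        mul_rpow h.1.le (by linarith [h.2])]
      simp only [add_sub_cancel_right]
      field_simp
    · simp
  simp only [e]
  rw [lintegral_const_mul' _ _ ENNReal.ofReal_ne_top, h1, mul_one,
    ← ENNReal.ofReal_mul (by positivity)]
  congr 1
  have hG := Gamma_mul_Gamma_add_half (γ + 1)
  have g1 := (Gamma_pos_of_pos (show 0 < γ + 1 by linarith)).ne'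
  have g2 := (Gamma_pos_of_pos (show 0 < γ + 1 + 1 / 2 by linarith)).ne'
  have g3 := (Gamma_pos_of_pos (show 0 < 2 * (γ + 1) by linarith)).ne'
  rw [ProbabilityTheory.beta, ← two_mul]
  have h4 : (4 : ℝ) ^ γ * 2 * 2 ^ (1 - 2 * (γ + 1)) = 1 := by
    rw [show (4 : ℝ) = 2 ^ (2 : ℝ) by norm_num, ← rpow_mul (by norm_num),
      ← rpow_add_one (by norm_num), ← rpow_add (by norm_num)]
    ring_nf
    simp
  rw [abs_of_pos two_pos]
  rw [eq_div_iff g2]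
  calc _ = 4 ^ γ * 2 * Gamma (γ + 1) / Gamma (2 * (γ + 1)) *
        (Gamma (γ + 1) * Gamma (γ + 1 + 1 / 2)) := by ring
    _ = (4 : ℝ) ^ γ * 2 * 2 ^ (1 - 2 * (γ + 1)) * (√π * Gamma (γ + 1)) := by
        rw [hG]; field_simp
    _ = _ := by rw [h4, one_mul]

theorem finrank_withLp_prod (l : ℕ) : Module.finrank ℝ (WithLp 2 (Euc l × ℝ)) = l + 1 := by
  rw [(WithLp.linearEquiv 2 ℝ (Euc l × ℝ)).finrank_eq]
  simp

/-- An isometric splitting of one coordinate. -/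
def splitIso (l : ℕ) : Euc (l + 1) ≃ₗᵢ[ℝ] WithLp 2 (Euc l × ℝ) :=
  ((stdOrthonormalBasis ℝ (WithLp 2 (Euc l × ℝ))).reindex
    (finCongr (finrank_withLp_prod l))).repr.symm

/-- The linear splitting of one coordinate underlying `splitIso`. -/
def splitLast (l : ℕ) : Euc (l + 1) ≃ₗ[ℝ] Euc l × ℝ :=
  (splitIso l).toLinearEquiv.trans (WithLp.linearEquiv 2 ℝ (Euc l × ℝ))

theorem norm_sq_eq_splitLast (l : ℕ) (x : Euc (l + 1)) :
    ‖x‖ ^ 2 = ‖(splitLast l x).1‖ ^ 2 + (splitLast l x).2 ^ 2 := by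
  rw [← (splitIso l).norm_map x, WithLp.prod_norm_sq_eq_of_L2, norm_eq_abs (_ : ℝ), sq_abs]
  rfl

theorem continuous_splitLast (l : ℕ) : Continuous (splitLast l) :=
  (splitLast l).toLinearMap.continuous_of_finiteDimensional

theorem measurePreserving_splitLast (l : ℕ) : MeasurePreserving (splitLast l) :=
  (WithLp.volume_preserving_ofLp (Euc l) ℝ).comp (splitIso l).measurePreserving

theorem norm_sq_splitLast_symm (l : ℕ) (p : Euc l × ℝ) :
    ‖(splitLast l).symm p‖ ^ 2 = ‖p.1‖ ^ 2 + p.2 ^ 2 := by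
  rw [norm_sq_eq_splitLast]; simp

theorem lintegral_wgt_norm_sq (l : ℕ) {γ : ℝ} (hγ : -1 < γ) :
    ∫⁻ x : Euc l, wgt γ (‖x‖ ^ 2) =
      ENNReal.ofReal (π ^ ((l : ℝ) / 2) * Gamma (γ + 1) / Gamma (l / 2 + γ + 1)) := by
  induction l generalizing γ with
  | zero =>
    have : Gamma (γ + 1) ≠ 0 := (Gamma_pos_of_pos (by linarith)).ne'
    rw [volume_euclideanSpace_eq_dirac, lintegral_dirac]
    simp [wgt, this]
  | succ l ih =>
    have h1 : ∫⁻ x : Euc (l + 1), wgt γ (‖x‖ ^ 2) =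
        ∫⁻ p : Euc l × ℝ, wgt γ (‖p.1‖ ^ 2 + p.2 ^ 2) := by
      rw [← (measurePreserving_splitLast l).lintegral_comp (by fun_prop)]
      simp only [norm_sq_eq_splitLast]
    rw [h1, Measure.volume_eq_prod, lintegral_prod _ (by fun_prop)]
    have h2 : ∀ x : Euc l, ∫⁻ y : ℝ, wgt γ (‖x‖ ^ 2 + y ^ 2) =
        wgt (γ + 1 / 2) (‖x‖ ^ 2) * ∫⁻ y : ℝ, wgt γ (y ^ 2) := by
      intro x
      have := lintegral_wgt_add (volume : Measure ℝ) γ (‖x‖ ^ 2)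
      simpa using this
    simp only [h2]
    rw [lintegral_mul_const _ (by fun_prop), ih (by linarith), lintegral_wgt_sq hγ,
      ← ENNReal.ofReal_mul (by
        have := Gamma_nonneg_of_nonneg (show 0 ≤ γ + 1 / 2 + 1 by linarith)
        have := Gamma_nonneg_of_nonneg (show (0 : ℝ) ≤ l / 2 + (γ + 1 / 2) + 1 by
          have : (0 : ℝ) ≤ l / 2 := by positivity
          linarith)
        positivity)]
    congr 1
    have g1 := (Gamma_pos_of_pos (show 0 < γ + 1 + 1 / 2 by linarith)).ne'
    rw [show γ + 1 / 2 + 1 = γ + 1 + 1 / 2 by ring,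
      show (l : ℝ) / 2 + (γ + 1 / 2) + 1 = ((l + 1 : ℕ) : ℝ) / 2 + γ + 1 by push_cast; ring,
      show π ^ (((l + 1 : ℕ) : ℝ) / 2) = π ^ ((l : ℝ) / 2) * √π by
        rw [sqrt_eq_rpow, ← rpow_add pi_pos]; congr 1; push_cast; ring]
    generalize Gamma (γ + 1 + 1 / 2) = G at g1 ⊢
    field_simp

theorem lintegral_wgt_norm_sq_ne_zero (l : ℕ) {γ : ℝ} (hγ : -1 < γ) :
    ∫⁻ x : Euc l, wgt γ (‖x‖ ^ 2) ≠ 0 := by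
  rw [lintegral_wgt_norm_sq l hγ, ← pos_iff_ne_zero, ENNReal.ofReal_pos]
  have := Gamma_pos_of_pos (show 0 < γ + 1 by linarith)
  have := Gamma_pos_of_pos (show (0 : ℝ) < l / 2 + γ + 1 by
    have : (0 : ℝ) ≤ l / 2 := by positivity
    linarith)
  positivity

theorem lintegral_wgt_norm_sq_ne_top (l : ℕ) {γ : ℝ} (hγ : -1 < γ) :
    ∫⁻ x : Euc l, wgt γ (‖x‖ ^ 2) ≠ ⊤ := by
  rw [lintegral_wgt_norm_sq l hγ]
  exact ENNReal.ofReal_ne_top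

theorem lintegral_wgt_sq_ne_zero {γ : ℝ} (hγ : -1 < γ) : ∫⁻ t : ℝ, wgt γ (t ^ 2) ≠ 0 := by
  rw [lintegral_wgt_sq hγ, ← pos_iff_ne_zero, ENNReal.ofReal_pos]
  have := Gamma_pos_of_pos (show 0 < γ + 1 by linarith)
  have := Gamma_pos_of_pos (show (0 : ℝ) < γ + 1 + 1 / 2 by linarith)
  positivity

theorem lintegral_wgt_sq_ne_top {γ : ℝ} (hγ : -1 < γ) : ∫⁻ t : ℝ, wgt γ (t ^ 2) ≠ ⊤ := by
  rw [lintegral_wgt_sq hγ]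
  exact ENNReal.ofReal_ne_top

end BetaWeights

/-! ### Random points in general position -/

section GeneralPosition

theorem measurableSet_exists_of_isClosed {X Y : Type*} [TopologicalSpace X] [MeasurableSpace X]
    [BorelSpace X] [TopologicalSpace Y] [SigmaCompactSpace Y] {C : Set (X × Y)} (hC : IsClosed C) :
    MeasurableSet {x | ∃ y, (x, y) ∈ C} := by
  have : {x | ∃ y, (x, y) ∈ C} =
      ⋃ n, Prod.fst '' ((fun p : X × compactCovering Y n => (p.1, (p.2 : Y))) ⁻¹' C ) := by
    ext x
    simp only [Set.mem_ofPred_eq, Set.mem_iUnion, Set.mem_image, Set.mem_preimage]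
    constructor
    · rintro ⟨y, hy⟩
      obtain ⟨n, hn⟩ := exists_mem_compactCovering y
      exact ⟨n, (x, ⟨y, hn⟩), hy, rfl⟩
    · rintro ⟨n, ⟨_, y⟩, hy, rfl⟩
      exact ⟨y, hy⟩
  rw [this]
  refine MeasurableSet.iUnion fun n => ?_
  have : CompactSpace (compactCovering Y n) :=
    isCompact_iff_compactSpace.1 (isCompact_compactCovering Y n)
  exact (isClosedMap_fst_of_compactSpace _ (hC.preimage (by fun_prop))).measurableSet

theorem linearIndepOn_of_forall_notMem_span {ι V : Type*} [AddCommGroup V] [Module ℝ V]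
    {v : ι → V} {d : ℕ}
    (h : ∀ (G : Finset ι) (i : ι), i ∉ G → G.card < d → v i ∉ Submodule.span ℝ (v '' G))
    (G : Finset ι) (hG : G.card ≤ d) : LinearIndepOn ℝ v (G : Set ι) := by
  classical
  induction G using Finset.induction_on with
  | empty => simp
  | insert i G hi ih =>
    rw [Finset.card_insert_of_notMem hi] at hG
    rw [Finset.coe_insert]
    exact (ih (by omega)).insert (h G i hi (by omega))

variable {X V : Type*} [TopologicalSpace X] [SecondCountableTopology X] [MeasurableSpace X]
  [BorelSpace X] [NormedAddCommGroup V] [NormedSpace ℝ V] [FiniteDimensional ℝ V]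

theorem ae_notMem_sup_span {n : ℕ} (μ : Measure X) [SigmaFinite μ] {v : X → V} (hv : Continuous v)
    (hnull : ∀ φ : Module.Dual ℝ V, φ ≠ 0 → μ {x | φ (v x) = 0} = 0) (W : Submodule ℝ V) :
    ∀ᵐ x ∂(Measure.pi fun _ : Fin n => μ), ∀ (G : Finset (Fin n)) (i : Fin n), i ∉ G →
      Module.finrank ℝ W + G.card < Module.finrank ℝ V →
      v (x i) ∉ W ⊔ Submodule.span ℝ ((fun j => v (x j)) '' G) := by
  simp only [ae_all_iff]
  intro G i hi hcard
  obtain ⟨n, rfl⟩ : ∃ n', n = n' + 1 := ⟨n - 1, by have := i.pos; omega⟩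
  let S : Set (Fin (n + 1) → X) := {x | ∃ p : W × (G → ℝ),
    v (x i) = p.1 + ∑ j : G, p.2 j • v (x j)}
  have hS : MeasurableSet S := by
    refine measurableSet_exists_of_isClosed (C := {q : (Fin (n + 1) → X) × W × (G → ℝ) |
      v (q.1 i) = q.2.1 + ∑ j : G, q.2.2 j • v (q.1 j)}) (isClosed_eq ?_ ?_)
    · fun_prop
    · fun_prop
  have hSe : ∀ x, v (x i) ∈ W ⊔ Submodule.span ℝ ((fun j => v (x j)) '' G) ↔ x ∈ S := by
    intro x
    rw [Submodule.mem_sup]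
    simp only [Submodule.mem_span_image_finset_iff_exists_fun, S, Set.mem_ofPred_eq]
    constructor
    · rintro ⟨w, hw, -, ⟨c, rfl⟩, h⟩
      exact ⟨(⟨w, hw⟩, c), h.symm⟩
    · rintro ⟨⟨w, c⟩, h⟩
      exact ⟨w, w.2, _, ⟨c, rfl⟩, h.symm⟩
  simp only [hSe]
  have hSnull : (Measure.pi fun _ : Fin (n + 1) => μ) S = 0 := by
    rw [← ((measurePreserving_piFinSuccAbove (fun _ : Fin (n + 1) => μ) i).symm).measure_preimage
      hS.nullMeasurableSet, Measure.prod_apply_symm (by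
        exact (MeasurableEquiv.measurable _) hS)]
    refine lintegral_eq_zero_of_ae_eq_zero (Filter.Eventually.of_forall fun y => ?_)
    let G' : Finset (Fin n) := Finset.univ.filter fun j => i.succAbove j ∈ G
    have hG' : G'.card ≤ G.card :=
      Finset.card_le_card_of_injOn i.succAbove (fun j hj => by simpa [G'] using hj)
        Fin.succAbove_right_injective.injOn
    let W' : Submodule ℝ V := W ⊔ Submodule.span ℝ ((fun j => v (y j)) '' G')
    have hW' : W' ≠ ⊤ := by
      intro htop
      have h1 := Submodule.finrank_add_le_finrank_add_finrank W
        (Submodule.span ℝ ((fun j => v (y j)) '' G'))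
      have h2 : Module.finrank ℝ (Submodule.span ℝ ((fun j => v (y j)) '' G')) ≤ G'.card := by
        classical
        rw [← Finset.coe_image]
        exact (finrank_span_finset_le_card _).trans Finset.card_image_le
      have h3 : Module.finrank ℝ W' = Module.finrank ℝ V := by rw [htop, finrank_top]
      have h4 : Module.finrank ℝ W' ≤ Module.finrank ℝ W +
        Module.finrank ℝ (Submodule.span ℝ ((fun j => v (y j)) '' G')) := h1
      omega
    obtain ⟨φ, hφ, hle⟩ := Submodule.exists_le_ker_of_lt_top W' (lt_top_iff_ne_top.2 hW')
    refine measure_mono_null (fun x₀ hx₀ => ?_) (hnull φ hφ)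
    have hx₁ := (hSe (MeasurableEquiv.piFinSuccAbove (fun _ => X) i |>.symm (x₀, y))).2 hx₀
    simp only [MeasurableEquiv.piFinSuccAbove_symm_apply, Fin.insertNthEquiv_apply,
      Fin.insertNth_apply_same] at hx₁
    refine hle ((sup_le_sup_left (Submodule.span_mono ?_) W) hx₁)
    rintro _ ⟨j, hj, rfl⟩
    obtain ⟨j, rfl⟩ := Fin.exists_succAbove_eq (fun h => hi (h ▸ hj) : j ≠ i)
    exact ⟨j, by simpa [G'] using hj, by simp⟩
  exact (measure_eq_zero_iff_ae_notMem).1 hSnull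

end GeneralPosition

/-! ### Linear programs attached to point configurations -/

section PointPrograms

section General

variable {ι V : Type*} [AddCommGroup V] [Module ℝ V]

theorem DualFeas.ne_zero [Fintype ι] {v : ι → V} {F G : Finset ι} {e : V} {μ : ι → ℝ}
    (h : DualFeas v F e G μ) (he : e = 0 → Module.finrank ℝ V ≤ F.card)
    (hFG : F ⊆ G) (hG : G.card = Module.finrank ℝ V)
    (hgen : ∀ (G : Finset ι) (i : ι), i ∉ G → 1 + G.card < Module.finrank ℝ V →
      v i ∉ Submodule.span ℝ {e} ⊔ Submodule.span ℝ (v '' G))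
    {i : ι} (hi : i ∈ G) (hiF : i ∉ F) : μ i ≠ 0 := by
  classical
  intro h0
  have he0 : e ≠ 0 := by
    intro he0
    have := Finset.eq_of_subset_of_card_le hFG (hG.trans_le (he he0))
    exact hiF (this ▸ hi)
  have hsum : ∑ j ∈ G.erase i, μ j • v j = e := by
    rw [← h.2.1, ← Finset.sum_subset (Finset.subset_univ (G.erase i))]
    intro j _ hj
    by_cases hji : j = i
    · simp [hji, h0]
    · simp [h.1 j (fun hjG => hj (Finset.mem_erase.2 ⟨hji, hjG⟩))]
  obtain ⟨j, hj, hμj⟩ : ∃ j ∈ G.erase i, μ j ≠ 0 := by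
    by_contra! hcon
    exact he0 (hsum ▸ Finset.sum_eq_zero fun j hj => by simp [hcon j hj])
  have hc1 := Finset.card_erase_of_mem hi
  have hc2 := Finset.card_erase_of_mem hj
  have hpos : 0 < (G.erase i).card := Finset.card_pos.2 ⟨j, hj⟩
  refine hgen ((G.erase i).erase j) j (by simp) (by omega) ?_
  have : v j = (μ j)⁻¹ • e - ∑ l ∈ (G.erase i).erase j, ((μ j)⁻¹ * μ l) • v l := by
    rw [← hsum, ← Finset.add_sum_erase _ _ hj, smul_add, smul_smul, inv_mul_cancel₀ hμj, one_smul,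
      Finset.smul_sum]
    simp [smul_smul]
  rw [this]
  refine Submodule.sub_mem _ (Submodule.mem_sup_left (Submodule.smul_mem _ _
    (Submodule.mem_span_singleton_self e))) (Submodule.mem_sup_right (Submodule.sum_mem _
    fun l hl => Submodule.smul_mem _ _ (Submodule.subset_span ⟨l, hl, rfl⟩)))

theorem card_le_finrank_of_apply_eq [FiniteDimensional ℝ V] {v : ι → V} {z : ι → ℝ}
    (hli : ∀ H : Finset ι, H.card ≤ Module.finrank ℝ V + 1 →
      LinearIndepOn ℝ (fun i => (v i, z i)) (H : Set ι))
    {c : Module.Dual ℝ V} {H : Finset ι} (hH : ∀ i ∈ H, c (v i) = z i) :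
    H.card ≤ Module.finrank ℝ V := by
  by_contra! hlt
  obtain ⟨H', hH', hcard⟩ := Finset.exists_subset_card_eq (Nat.succ_le_of_lt hlt)
  have hspan := span_eq_top_of_card (hli H' hcard.le) (by simp [hcard])
  have hle : Submodule.span ℝ ((fun i => (v i, z i)) '' (H' : Set ι)) ≤
      LinearMap.ker (c.comp (LinearMap.fst ℝ V ℝ) - LinearMap.snd ℝ V ℝ) := by
    rw [Submodule.span_le]
    rintro _ ⟨i, hi, rfl⟩
    simp [hH i (hH' hi)]
  rw [hspan] at hle
  have := hle (Submodule.mem_top : ((0 : V), (1 : ℝ)) ∈ ⊤)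
  simp at this

end General

variable {l : ℕ}

/-- The functional `(x, t) ↦ ⟪a, x⟫ + b * t`. -/
def aff (p : Euc l × ℝ) : Module.Dual ℝ (Euc l × ℝ) :=
  (innerₛₗ ℝ p.1).coprod (p.2 • LinearMap.id)

@[simp]
theorem aff_apply (p q : Euc l × ℝ) : aff p q = inner ℝ p.1 q.1 + p.2 * q.2 := by
  simp [aff]

theorem exists_aff_eq (c : Module.Dual ℝ (Euc l × ℝ)) : ∃ p, aff p = c := by
  let c' : Euc l →L[ℝ] ℝ := LinearMap.toContinuousLinearMap (c.comp (LinearMap.inl ℝ _ ℝ))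
  refine ⟨((InnerProductSpace.toDual ℝ (Euc l)).symm c', c (0, 1)), LinearMap.ext fun q => ?_⟩
  have h1 : q = LinearMap.inl ℝ (Euc l) ℝ q.1 + q.2 • (0, 1) := by ext <;> simp
  rw [aff_apply, InnerProductSpace.toDual_symm_apply]
  conv_rhs => rw [h1, map_add, map_smul]
  simp [c', mul_comm]

theorem exists_dual_iff {P : Module.Dual ℝ (Euc l × ℝ) → Prop} : (∃ c, P c) ↔ ∃ p, P (aff p) :=
  ⟨fun ⟨c, hc⟩ => (exists_aff_eq c).imp fun p hp => by rwa [hp], fun ⟨p, hp⟩ => ⟨_, hp⟩⟩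

/-- The lift of a point to an affine chart. -/
def hom (x : Euc l) : Euc l × ℝ := (x, 1)

/-- The first `k` indices. -/
def firstK (n k : ℕ) : Finset (Fin n) := Finset.univ.filter fun i => (i : ℕ) < k

theorem mem_firstK {n k : ℕ} {i : Fin n} : i ∈ firstK n k ↔ (i : ℕ) < k := by simp [firstK]

theorem card_firstK {n k : ℕ} (h : k ≤ n) : (firstK n k).card = k := by
  rw [firstK, Fin.card_filter_val_lt, min_eq_right h]

/-- Configurations for which the ray in direction `e` leaves the tangent cone. -/
def unbddSet (n k : ℕ) (e : Euc l) : Set (Fin n → Euc l) :=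
  {x | UnboundedDir (fun i => hom (x i)) (firstK n k) (e, 0)}

/-- Configurations of points for which the first `k` span a lower face. -/
def lowerSet (n k : ℕ) : Set (Fin n → Euc l × ℝ) :=
  {y | ∃ c, PrimalFeas (fun i => hom (y i).1) (fun i => (y i).2) (firstK n k) c}

/-- Interpolating hyperplanes of `x` that stay below the further points `y`. -/
def supportSet (m N : ℕ) : Set ((Fin m → Euc l × ℝ) × (Fin N → Euc l × ℝ)) :=
  {q | ∃ c : Module.Dual ℝ (Euc l × ℝ), (∀ i, c (hom (q.1 i).1) = (q.1 i).2) ∧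
    ∀ j, c (hom (q.2 j).1) ≤ (q.2 j).2}

theorem measurableSet_mem_unbddSet (n k : ℕ) :
    MeasurableSet {q : (Fin n → Euc l) × Euc l | q.1 ∈ unbddSet n k q.2} := by
  have : {q : (Fin n → Euc l) × Euc l | q.1 ∈ unbddSet n k q.2} =
      {x | ∃ p : Euc l × ℝ, (x, p) ∈ {q : ((Fin n → Euc l) × Euc l) × (Euc l × ℝ) |
      ((∀ i ∈ firstK n k, inner ℝ q.2.1 (q.1.1 i) + q.2.2 = 0) ∧
        ∀ i, inner ℝ q.2.1 (q.1.1 i) + q.2.2 ≤ 0) ∧ inner ℝ q.2.1 q.1.2 = 1}} := by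
    ext ⟨x, e⟩
    simp only [unbddSet, UnboundedDir, exists_dual_iff, PrimalFeas, Set.mem_ofPred_eq, aff_apply, hom,
      mul_one, mul_zero, add_zero, Pi.zero_apply]
    constructor
    · rintro ⟨p, ⟨h1, h2⟩, h3⟩
      refine ⟨(inner ℝ p.1 e : ℝ)⁻¹ • p, ⟨fun i hi => ?_, fun i => ?_⟩, ?_⟩
      · simp only [Prod.smul_fst, Prod.smul_snd, smul_eq_mul, real_inner_smul_left, ← mul_add,
          h1 i hi, mul_zero]
      · simp only [Prod.smul_fst, Prod.smul_snd, smul_eq_mul, real_inner_smul_left, ← mul_add]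
        exact mul_nonpos_of_nonneg_of_nonpos (inv_pos.2 h3).le (h2 i)
      · simp only [Prod.smul_fst, real_inner_smul_left]
        exact inv_mul_cancel₀ h3.ne'
    · rintro ⟨p, h, h3⟩
      exact ⟨p, h, h3 ▸ one_pos⟩
  rw [this]
  refine measurableSet_exists_of_isClosed ?_
  simp only [Set.ofPred_and, Set.ofPred_forall]
  refine ((isClosed_iInter fun i => isClosed_iInter fun _ => isClosed_eq ?_ ?_).inter
    (isClosed_iInter fun i => isClosed_le ?_ ?_)).inter (isClosed_eq ?_ ?_) <;> fun_prop

theorem measurableSet_unbddSet (n k : ℕ) (e : Euc l) : MeasurableSet (unbddSet n k e) :=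
  (measurable_id.prodMk measurable_const) (measurableSet_mem_unbddSet n k)

theorem measurableSet_lowerSet (n k : ℕ) : MeasurableSet (lowerSet (l := l) n k) := by
  have : lowerSet (l := l) n k = {x | ∃ p : Euc l × ℝ, (x, p) ∈
      {q : (Fin n → Euc l × ℝ) × (Euc l × ℝ) |
      (∀ i ∈ firstK n k, inner ℝ q.2.1 (q.1 i).1 + q.2.2 = (q.1 i).2) ∧
        ∀ i, inner ℝ q.2.1 (q.1 i).1 + q.2.2 ≤ (q.1 i).2}} := by
    ext x
    simp only [lowerSet, exists_dual_iff, PrimalFeas, Set.mem_ofPred_eq, aff_apply, hom, mul_one]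
  rw [this]
  refine measurableSet_exists_of_isClosed ?_
  simp only [Set.ofPred_and, Set.ofPred_forall]
  refine (isClosed_iInter fun i => isClosed_iInter fun _ => isClosed_eq ?_ ?_).inter
    (isClosed_iInter fun i => isClosed_le ?_ ?_) <;> fun_prop

theorem measurableSet_supportSet (m N : ℕ) : MeasurableSet (supportSet (l := l) m N) := by
  have : supportSet (l := l) m N = {x | ∃ p : Euc l × ℝ, (x, p) ∈
      {q : ((Fin m → Euc l × ℝ) × (Fin N → Euc l × ℝ)) × (Euc l × ℝ) |
      (∀ i, inner ℝ q.2.1 (q.1.1 i).1 + q.2.2 = (q.1.1 i).2) ∧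
        ∀ i, inner ℝ q.2.1 (q.1.2 i).1 + q.2.2 ≤ (q.1.2 i).2}} := by
    ext x
    simp only [supportSet, exists_dual_iff, Set.mem_ofPred_eq, aff_apply, hom, mul_one]
  rw [this]
  refine measurableSet_exists_of_isClosed ?_
  simp only [Set.ofPred_and, Set.ofPred_forall]
  refine (isClosed_iInter fun i => isClosed_eq ?_ ?_).inter
    (isClosed_iInter fun i => isClosed_le ?_ ?_) <;> fun_prop

end PointPrograms

/-! ### Decomposition of a lower face into simplicial pieces -/

section Decomposition

theorem exists_reindex {m N n k : ℕ} {G : Finset (Fin n)} (hG : G.card = m) (hn : m + N = n)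
    (hFG : firstK n k ⊆ G) (hk : k ≤ n) : ∃ σ : Fin m ⊕ Fin N ≃ Fin n,
      (∀ i, σ (Sum.inl i) ∈ G) ∧ ∀ i, (σ (Sum.inl i) : ℕ) < k ↔ (i : ℕ) < k := by
  have hc : Gᶜ.card = N := by rw [Finset.card_compl, Fintype.card_fin]; omega
  refine ⟨finSumEquivOfFinset hG hc, fun i => ?_, fun i => ?_⟩
  · rw [finSumEquivOfFinset_inl]
    exact Finset.orderEmbOfFin_mem G hG i
  · rw [finSumEquivOfFinset_inl]
    have himg : Finset.univ.image (G.orderEmbOfFin hG) = G := by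
      ext j
      rw [Finset.mem_image, ← Finset.mem_coe (s := G), ← Finset.range_orderEmbOfFin G hG,
        Set.mem_range]
      simp only [Finset.mem_univ, true_and]
    constructor
    · intro h
      have h1 : (Finset.Iic i).image (G.orderEmbOfFin hG) ⊆ firstK n k := by
        intro j hj
        obtain ⟨j, hj', rfl⟩ := Finset.mem_image.1 hj
        rw [mem_firstK]
        exact lt_of_le_of_lt ((G.orderEmbOfFin hG).monotone (Finset.mem_Iic.1 hj')) h
      have h2 := Finset.card_le_card h1
      rw [Finset.card_image_of_injective _ (G.orderEmbOfFin hG).injective, card_firstK hk,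
        Fin.card_Iic] at h2
      omega
    · intro h
      by_contra! hcon
      have h1 : firstK n k ⊆ (Finset.Iio i).image (G.orderEmbOfFin hG) := by
        intro j hj
        have hjG := hFG hj
        rw [← himg] at hjG
        obtain ⟨j, -, rfl⟩ := Finset.mem_image.1 hjG
        rw [mem_firstK] at hj
        refine Finset.mem_image_of_mem _ (Finset.mem_Iio.2 ?_)
        exact (G.orderEmbOfFin hG).lt_iff_lt.1 (Fin.lt_def.2 (hj.trans_le hcon))
      have h2 := (Finset.card_le_card h1).trans Finset.card_image_le
      rw [card_firstK hk, Fin.card_Iio] at h2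
      omega

variable {l : ℕ}

/-- Configurations for which `G` carries an optimal basis. -/
def optSet (n k : ℕ) (e : Euc l) (G : Finset (Fin n)) : Set (Fin n → Euc l × ℝ) :=
  {y | OptimalBasis (fun i => hom (y i).1) (fun i => (y i).2) (firstK n k) (e, 0) G}

theorem mem_optSet_iff {m N n k : ℕ} {G : Finset (Fin n)} (hG : G.card = m)
    {σ : Fin m ⊕ Fin N ≃ Fin n} (hσ : ∀ i, σ (Sum.inl i) ∈ G)
    (hσk : ∀ i, (σ (Sum.inl i) : ℕ) < k ↔ (i : ℕ) < k) (e : Euc l)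
    (y : Fin n → Euc l × ℝ) :
    y ∈ optSet n k e G ↔ (fun i => (y (σ (Sum.inl i))).1) ∉ unbddSet m k e ∧
      ((fun i => y (σ (Sum.inl i))), fun j => y (σ (Sum.inr j))) ∈ supportSet m N := by
  have hinl : ∀ i, i ∈ G ↔ ∃ j, σ (Sum.inl j) = i := by
    intro i
    refine ⟨fun hi => ?_, fun ⟨j, hj⟩ => hj ▸ hσ j⟩
    have hinj : Function.Injective fun j => σ (Sum.inl j) := σ.injective.comp Sum.inl_injective
    have : Finset.univ.image (fun j => σ (Sum.inl j)) = G :=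
      Finset.eq_of_subset_of_card_le (fun x hx => by
        obtain ⟨j, -, rfl⟩ := Finset.mem_image.1 hx
        exact hσ j) (by rw [Finset.card_image_of_injective _ hinj]; simp [hG])
    rw [← this] at hi
    simpa using hi
  have hinr : ∀ j, σ (Sum.inr j) ∉ G := by
    intro j hj
    obtain ⟨i, hi⟩ := (hinl _).1 hj
    simpa using σ.injective hi
  rw [optSet, Set.mem_ofPred_eq, OptimalBasis, and_comm]
  refine and_congr ?_ (exists_congr fun c => ?_)
  · rw [show ((fun i => (y (σ (Sum.inl i))).1) ∉ unbddSet m k e) ↔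
      ∃ μ, DualFeas (fun i => hom (y (σ (Sum.inl i))).1) (firstK m k) (e, 0) Finset.univ μ from
      ⟨fun h => (unboundedDir_or_dualFeas _ _ _).resolve_right h,
        fun ⟨μ, hμ⟩ => not_unboundedDir_of_dualFeas hμ⟩]
    constructor
    · rintro ⟨μ, h1, h2, h3⟩
      refine ⟨fun i => μ (σ (Sum.inl i)), by simp, ?_, fun i hi => h3 _ ?_⟩
      · rw [← h2, ← σ.sum_comp, Fintype.sum_sum_type]
        simp [h1 _ (hinr _)]
      · rwa [mem_firstK, hσk, ← mem_firstK]
    · rintro ⟨μ, -, h2, h3⟩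
      refine ⟨fun i => Sum.elim μ 0 (σ.symm i), fun i hi => ?_, ?_, fun i hi => ?_⟩
      · obtain ⟨j | j, rfl⟩ := σ.surjective i
        · exact absurd (hσ j) hi
        · simp
      · rw [← h2, ← σ.sum_comp, Fintype.sum_sum_type]
        simp
      · obtain ⟨j | j, rfl⟩ := σ.surjective i
        · simp only [Equiv.symm_apply_apply, Sum.elim_inl]
          refine h3 j ?_
          rwa [mem_firstK, ← hσk, ← mem_firstK]
        · simp
  · rw [PrimalFeas]
    constructor
    · rintro ⟨h1, h2⟩
      exact ⟨fun i => h1 _ (hσ i), fun j => h2 _⟩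
    · rintro ⟨h1, h2⟩
      refine ⟨fun i hi => ?_, fun i => ?_⟩
      · obtain ⟨j, rfl⟩ := (hinl i).1 hi
        exact h1 j
      · obtain ⟨j | j, rfl⟩ := σ.surjective i
        · exact (h1 j).le
        · exact h2 j

theorem mem_lowerSet_iff {n k : ℕ} (hk : k ≤ l + 1) (hn : l + 1 ≤ n) {e : Euc l}
    (he : e = 0 → l + 1 ≤ k) {y : Fin n → Euc l × ℝ}
    (g1 : ∀ G : Finset (Fin n), G.card = l + 1 →
      LinearIndepOn ℝ (fun i => hom (y i).1) (G : Set (Fin n)))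
    (g3 : ∀ (G : Finset (Fin n)) (i : Fin n), i ∉ G → 1 + G.card < l + 1 →
      hom (y i).1 ∉ Submodule.span ℝ {((e, 0) : Euc l × ℝ)} ⊔
        Submodule.span ℝ ((fun i => hom (y i).1) '' G)) :
    y ∈ lowerSet n k ↔ (fun i => (y i).1) ∈ unbddSet n k e ∨
      ∃ G ∈ Finset.univ.filter (fun G : Finset (Fin n) => firstK n k ⊆ G ∧ G.card = l + 1),
        y ∈ optSet n k e G := by
  have hd : Module.finrank ℝ (Euc l × ℝ) = l + 1 := by simp
  have hF : (firstK n k).card = k := card_firstK (hk.trans hn)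
  have he' : ((e, 0) : Euc l × ℝ) = 0 → Module.finrank ℝ (Euc l × ℝ) ≤ (firstK n k).card := by
    intro h
    rw [hd, hF]
    exact he (congrArg Prod.fst h)
  constructor
  · intro h
    by_contra! hcon
    obtain ⟨G, hFG, hG, hopt⟩ := exists_optimalBasis (e := ((e, 0) : Euc l × ℝ)) (by rwa [hd])
      (fun G hFG hG μ hμ i hi hiF => hμ.ne_zero he' hFG hG (by rwa [hd]) hi hiF)
      (by rw [hd]; simpa using hn) (by rw [hd, hF]; exact hk) h hcon.1
    exact hcon.2 G (by simp [hFG, hG]) hopt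
  · rintro (h | ⟨G, hG, h⟩)
    · exact exists_primalFeas_of_unboundedDir (by rwa [hd]) (by rw [hd]; simpa using hn) h
    · exact OptimalBasis.exists_primalFeas (by simp at hG; exact hG.1) h

theorem disjoint_optSet {n k : ℕ} (hk : k ≤ l + 1) (hn : l + 1 ≤ n) {e : Euc l}
    (he : e = 0 → l + 1 ≤ k) {y : Fin n → Euc l × ℝ}
    (g2 : ∀ H : Finset (Fin n), H.card ≤ l + 2 →
      LinearIndepOn ℝ (fun i => (hom (y i).1, (y i).2)) (H : Set (Fin n)))
    (g3 : ∀ (G : Finset (Fin n)) (i : Fin n), i ∉ G → 1 + G.card < l + 1 →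
      hom (y i).1 ∉ Submodule.span ℝ {((e, 0) : Euc l × ℝ)} ⊔
        Submodule.span ℝ ((fun i => hom (y i).1) '' G)) {G G' : Finset (Fin n)}
    (hFG : firstK n k ⊆ G) (hG : G.card = l + 1) (hFG' : firstK n k ⊆ G') (hG' : G'.card = l + 1)
    (h : y ∈ optSet n k e G) (h' : y ∈ optSet n k e G') : G = G' := by
  have hd : Module.finrank ℝ (Euc l × ℝ) = l + 1 := by simp
  have hF : (firstK n k).card = k := card_firstK (hk.trans hn)
  have he' : ((e, 0) : Euc l × ℝ) = 0 → Module.finrank ℝ (Euc l × ℝ) ≤ (firstK n k).card := by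
    intro h
    rw [hd, hF]
    exact he (congrArg Prod.fst h)
  exact OptimalBasis.eq (fun c H hH => card_le_finrank_of_apply_eq (by rwa [hd]) hH)
    (fun G hFG hG μ hμ i hi hiF => hμ.ne_zero he' hFG hG (by rwa [hd]) hi hiF)
    hFG (by rwa [hd]) hFG' (by rwa [hd]) h h'

/-- The measure `μ` charges no affine hyperplane. -/
def NullHyperplanes (μ : Measure (Euc l × ℝ)) : Prop :=
  ∀ φ : Module.Dual ℝ ((Euc l × ℝ) × ℝ), φ ≠ 0 → μ {y | φ (hom y.1, y.2) = 0} = 0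

theorem continuous_hom : Continuous (hom : Euc l → Euc l × ℝ) := by
  unfold hom; fun_prop

theorem NullHyperplanes.fst {μ : Measure (Euc l × ℝ)} (h : NullHyperplanes μ)
    (φ : Module.Dual ℝ (Euc l × ℝ)) (hφ : φ ≠ 0) : μ {y | φ (hom y.1) = 0} = 0 := by
  refine h (φ.comp (LinearMap.fst ℝ _ ℝ)) fun h0 => hφ (LinearMap.ext fun x => ?_)
  simpa using LinearMap.congr_fun h0 (x, 0)

theorem ae_linearIndepOn_hom {n : ℕ} {μ : Measure (Euc l × ℝ)} [SigmaFinite μ]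
    (h : ∀ φ : Module.Dual ℝ (Euc l × ℝ), φ ≠ 0 → μ {y | φ (hom y.1) = 0} = 0) :
    ∀ᵐ y ∂(Measure.pi fun _ : Fin n => μ), ∀ G : Finset (Fin n), G.card ≤ l + 1 →
      LinearIndepOn ℝ (fun i => hom (y i).1) (G : Set (Fin n)) := by
  filter_upwards [ae_notMem_sup_span (n := n) μ (v := fun y : Euc l × ℝ => hom y.1)
    (continuous_hom.comp continuous_fst) h ⊥] with y hy
  refine linearIndepOn_of_forall_notMem_span fun G i hi hG => ?_
  have := hy G i hi (by simpa using hG)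
  rwa [bot_sup_eq] at this

theorem ae_linearIndepOn_lift {n : ℕ} {μ : Measure (Euc l × ℝ)} [SigmaFinite μ]
    (h : NullHyperplanes μ) :
    ∀ᵐ y ∂(Measure.pi fun _ : Fin n => μ), ∀ G : Finset (Fin n), G.card ≤ l + 2 →
      LinearIndepOn ℝ (fun i => (hom (y i).1, (y i).2)) (G : Set (Fin n)) := by
  filter_upwards [ae_notMem_sup_span (n := n) μ (v := fun y : Euc l × ℝ => (hom y.1, y.2))
    ((continuous_hom.comp continuous_fst).prodMk continuous_snd) h ⊥] with y hy
  refine linearIndepOn_of_forall_notMem_span fun G i hi hG => ?_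
  have := hy G i hi (by simp; omega)
  rwa [bot_sup_eq] at this

theorem ae_notMem_span_singleton_sup {n : ℕ} {μ : Measure (Euc l × ℝ)} [SigmaFinite μ]
    (h : NullHyperplanes μ) (e : Euc l × ℝ) :
    ∀ᵐ y ∂(Measure.pi fun _ : Fin n => μ), ∀ (G : Finset (Fin n)) (i : Fin n), i ∉ G →
      1 + G.card < l + 1 → hom (y i).1 ∉ Submodule.span ℝ {e} ⊔
        Submodule.span ℝ ((fun i => hom (y i).1) '' G) := by
  filter_upwards [ae_notMem_sup_span (n := n) μ (v := fun y : Euc l × ℝ => hom y.1)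
    (continuous_hom.comp continuous_fst) h.fst (Submodule.span ℝ {e})] with y hy G i hi hG
  refine hy G i hi ?_
  have h1 : Module.finrank ℝ (Submodule.span ℝ {e}) ≤ 1 := by
    simpa using finrank_span_le_card (R := ℝ) ({e} : Set (Euc l × ℝ))
  have h2 : Module.finrank ℝ (Euc l × ℝ) = l + 1 := by simp
  omega

/-- The pairs of configurations contributing to a single simplicial piece. -/
def pieceSet (m N k : ℕ) (e : Euc l) : Set ((Fin m → Euc l × ℝ) × (Fin N → Euc l × ℝ)) :=
  {q | (fun i => (q.1 i).1) ∉ unbddSet m k e} ∩ supportSet m N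

theorem measurableSet_pieceSet (m N k : ℕ) (e : Euc l) : MeasurableSet (pieceSet m N k e) := by
  have h : Measurable fun q : (Fin m → Euc l × ℝ) × (Fin N → Euc l × ℝ) =>
      fun i => (q.1 i).1 := by fun_prop
  exact (h (measurableSet_unbddSet m k e)).compl.inter (measurableSet_supportSet m N)

theorem measurePreserving_reindex {X : Type*} [MeasurableSpace X] (μ : Measure X) [SigmaFinite μ]
    {m N n : ℕ} (σ : Fin m ⊕ Fin N ≃ Fin n) :
    MeasurePreserving (fun y : Fin n → X =>
        ((fun i => y (σ (Sum.inl i))), fun j => y (σ (Sum.inr j))))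
      (Measure.pi fun _ => μ) ((Measure.pi fun _ => μ).prod (Measure.pi fun _ => μ)) :=
  (measurePreserving_sumPiEquivProdPi (fun _ : Fin m ⊕ Fin N => μ)).comp
    (measurePreserving_piCongrLeft (fun _ => μ) σ).symm

theorem optSet_eq_preimage {m N n k : ℕ} {G : Finset (Fin n)} (hG : G.card = m)
    {σ : Fin m ⊕ Fin N ≃ Fin n} (hσ : ∀ i, σ (Sum.inl i) ∈ G)
    (hσk : ∀ i, (σ (Sum.inl i) : ℕ) < k ↔ (i : ℕ) < k) (e : Euc l) :
    optSet n k e G = (fun y : Fin n → Euc l × ℝ =>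
      ((fun i => y (σ (Sum.inl i))), fun j => y (σ (Sum.inr j)))) ⁻¹' pieceSet m N k e :=
  Set.ext fun y => mem_optSet_iff hG hσ hσk e y

/-- The probability of a lower face splits according to the optimal basis. -/
theorem pi_lowerSet {N n k : ℕ} (hk : k ≤ l + 1) (hn : l + 1 + N = n) {e : Euc l}
    (he : e = 0 → l + 1 ≤ k) (μ : Measure (Euc l × ℝ)) [SigmaFinite μ] (hμ : NullHyperplanes μ) :
    (Measure.pi fun _ => μ) (lowerSet n k) =
      (Measure.pi fun _ => μ) {y | (fun i => (y i).1) ∈ unbddSet n k e} +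
      (n - k).choose (l + 1 - k) *
        ((Measure.pi fun _ => μ).prod (Measure.pi fun _ => μ)) (pieceSet (l + 1) N k e) := by
  classical
  let 𝒢 := Finset.univ.filter (fun G : Finset (Fin n) => firstK n k ⊆ G ∧ G.card = l + 1)
  have h𝒢 : ∀ G ∈ 𝒢, firstK n k ⊆ G ∧ G.card = l + 1 := fun G hG => by simpa [𝒢] using hG
  have hn' : l + 1 ≤ n := by omega
  have hpiece : ∀ G ∈ 𝒢, MeasurableSet (optSet n k e G) ∧ (Measure.pi fun _ => μ) (optSet n k e G) =
      ((Measure.pi fun _ => μ).prod (Measure.pi fun _ => μ)) (pieceSet (l + 1) N k e) := by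
    intro G hG
    obtain ⟨hFG, hG⟩ := h𝒢 G hG
    obtain ⟨σ, hσ, hσk⟩ := exists_reindex hG hn hFG (hk.trans hn')
    have hmp := measurePreserving_reindex μ σ
    rw [optSet_eq_preimage hG hσ hσk]
    exact ⟨hmp.measurable (measurableSet_pieceSet _ _ _ _),
      hmp.measure_preimage (measurableSet_pieceSet _ _ _ _).nullMeasurableSet⟩
  have hae : (lowerSet n k : Set (Fin n → Euc l × ℝ)) =ᵐ[Measure.pi fun _ => μ]
      ({y | (fun i => (y i).1) ∈ unbddSet n k e} ∪ ⋃ G ∈ 𝒢, optSet n k e G : Set _) := by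
    filter_upwards [ae_linearIndepOn_hom hμ.fst, ae_notMem_span_singleton_sup hμ (e, 0)] with y h1 h3
    refine propext ((mem_lowerSet_iff hk hn' he (fun G hG => h1 G hG.le) h3).trans ?_)
    change _ ↔ y ∈ {y | (fun i => (y i).1) ∈ unbddSet n k e} ∪ ⋃ G ∈ 𝒢, optSet n k e G
    rw [Set.mem_union, Set.mem_iUnion₂]
    simp only [exists_prop]
    rfl
  have hm : MeasurableSet {y : Fin n → Euc l × ℝ | (fun i => (y i).1) ∈ unbddSet n k e} :=
    (show Measurable fun y : Fin n → Euc l × ℝ => fun i => (y i).1 by fun_prop)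
      (measurableSet_unbddSet n k e)
  have hdisj : Disjoint {y : Fin n → Euc l × ℝ | (fun i => (y i).1) ∈ unbddSet n k e}
      (⋃ G ∈ 𝒢, optSet n k e G) := by
    rw [Set.disjoint_left]
    intro y hy hy'
    obtain ⟨G, -, -, ν, hν⟩ := Set.mem_iUnion₂.1 hy'
    exact not_unboundedDir_of_dualFeas hν hy
  rw [measure_congr hae, measure_union hdisj
    (Finset.measurableSet_biUnion _ fun G hG => (hpiece G hG).1), measure_biUnion_finset₀]
  · rw [Finset.sum_congr rfl fun G hG => (hpiece G hG).2, Finset.sum_const, nsmul_eq_mul]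
    congr 3
    have h := Finset.card_filter_powersetCard_subset (firstK n k) Finset.univ (l + 1)
      (Finset.subset_univ _) (by rw [card_firstK (hk.trans hn')]; exact hk)
    rw [card_firstK (hk.trans hn'), Finset.card_univ, Fintype.card_fin] at h
    rw [← h]
    congr 1
    ext G
    simp [𝒢, and_comm]
  · intro G hG G' hG' hne
    obtain ⟨hFG, hc⟩ := h𝒢 G hG
    obtain ⟨hFG', hc'⟩ := h𝒢 G' hG'
    rw [Function.onFun, AEDisjoint, measure_eq_zero_iff_ae_notMem]
    filter_upwards [ae_linearIndepOn_lift hμ, ae_notMem_span_singleton_sup hμ (e, 0)] with y h2 h3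
    rintro ⟨h, h'⟩
    exact hne (disjoint_optSet hk hn' he h2 h3 hFG hc hFG' hc' h h')
  · exact fun G hG => (hpiece G hG).1.nullMeasurableSet

end Decomposition

/-! ### Lower faces and the case of one extra point -/

section LowerFaces

variable {l : ℕ}

/-- The downward direction of the split coordinate. -/
def lastDir (l : ℕ) : Euc (l + 1) := (splitLast l).symm (0, -1)

theorem mem_unbddSet_lastDir_iff {n k : ℕ} (x : Fin n → Euc (l + 1)) :
    x ∈ unbddSet n k (lastDir l) ↔ (fun i => splitLast l (x i)) ∈ lowerSet n k := by
  constructor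
  · rintro ⟨d, ⟨h1, h2⟩, hd⟩
    simp only [Pi.zero_apply] at h1 h2
    set s := d (lastDir l, 0) with hs
    let c : Module.Dual ℝ (Euc l × ℝ) := s⁻¹ • d.comp (LinearMap.prodMap
      ((splitLast l).symm.toLinearMap.comp (LinearMap.inl ℝ (Euc l) ℝ)) LinearMap.id)
    have key : ∀ x : Euc (l + 1), c (hom (splitLast l x).1) =
        (splitLast l x).2 + s⁻¹ * d (hom x) := by
      intro x
      have : hom x = ((splitLast l).symm ((splitLast l x).1, 0), 1) +
          (-(splitLast l x).2) • (lastDir l, (0 : ℝ)) := by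
        refine Prod.ext ?_ (by simp [hom])
        simp only [lastDir, hom, Prod.fst_add, Prod.smul_fst, ← map_smul, ← map_add]
        rw [LinearEquiv.eq_symm_apply]
        ext <;> simp
      rw [this, map_add, map_smul, ← hs]
      simp only [c, LinearMap.smul_apply, LinearMap.comp_apply, LinearMap.prodMap_apply, hom,
        LinearMap.inl_apply, LinearMap.id_apply, smul_eq_mul, LinearEquiv.coe_coe]
      field_simp
      ring
    refine ⟨c, fun i hi => ?_, fun i => ?_⟩
    · rw [key, h1 i hi]; simp
    · rw [key]
      have := mul_nonpos_of_nonneg_of_nonpos (inv_pos.2 hd).le (h2 i)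
      linarith
  · rintro ⟨c, h1, h2⟩
    refine ⟨c.comp (LinearMap.prodMap ((LinearMap.fst ℝ _ _).comp (splitLast l).toLinearMap)
      LinearMap.id) - ((LinearMap.snd ℝ _ _).comp (splitLast l).toLinearMap).comp
      (LinearMap.fst ℝ _ _), ⟨fun i hi => ?_, fun i => ?_⟩, ?_⟩
    · simpa [hom, sub_eq_zero] using h1 i hi
    · simpa [hom] using h2 i
    · have : c (0, 0) = 0 := map_zero c
      simp [lastDir, this]

/-- With one further point, half of the configurations lie above the interpolating hyperplane. -/
theorem two_mul_measure_pieceSet_one (k : ℕ) (e : Euc l) {μ : Measure (Euc l × ℝ)}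
    [IsProbabilityMeasure μ] (hμ : NullHyperplanes μ)
    (hsymm : MeasurePreserving (fun y : Euc l × ℝ => (y.1, -y.2)) μ μ) :
    2 * ((Measure.pi fun _ => μ).prod (Measure.pi fun _ => μ)) (pieceSet (l + 1) 1 k e) =
      (Measure.pi fun _ => μ) {y | (fun i => (y i).1) ∉ unbddSet (l + 1) k e} := by
  let σ : Fin (l + 1) ⊕ Fin 1 ≃ Fin (l + 2) := finSumFinEquiv
  let r : (Fin (l + 2) → Euc l × ℝ) → (Fin (l + 1) → Euc l × ℝ) × (Fin 1 → Euc l × ℝ) :=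
    fun y => ((fun i => y (σ (Sum.inl i))), fun j => y (σ (Sum.inr j)))
  have hr : MeasurePreserving r (Measure.pi fun _ => μ)
      ((Measure.pi fun _ => μ).prod (Measure.pi fun _ => μ)) := measurePreserving_reindex μ σ
  let ρ : (Fin (l + 2) → Euc l × ℝ) → (Fin (l + 2) → Euc l × ℝ) := fun y i => ((y i).1, -(y i).2)
  have hρ : MeasurePreserving ρ (Measure.pi fun _ => μ) (Measure.pi fun _ => μ) :=
    measurePreserving_pi _ _ fun _ => hsymm
  have hP := measurableSet_pieceSet (l + 1) 1 k e
  have hA := hr.measurable hP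
  have hB := hρ.measurable hA
  have hE : MeasurableSet {y : Fin (l + 1) → Euc l × ℝ | (fun i => (y i).1) ∉ unbddSet (l + 1) k e} :=
    ((show Measurable fun y : Fin (l + 1) → Euc l × ℝ => fun i => (y i).1 by fun_prop)
      (measurableSet_unbddSet (l + 1) k e)).compl
  have hfst := measurePreserving_fst (μ := Measure.pi fun _ : Fin (l + 1) => μ)
    (ν := Measure.pi fun _ : Fin 1 => μ)
  rw [← hr.measure_preimage hP.nullMeasurableSet, ← (hfst.comp hr).measure_preimage
    hE.nullMeasurableSet, two_mul]
  nth_rewrite 2 [← hρ.measure_preimage hA.nullMeasurableSet]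
  rw [← measure_union_add_inter _ hB]
  have hgen : ∀ᵐ y ∂(Measure.pi fun _ : Fin (l + 2) => μ),
      y ∉ r ⁻¹' pieceSet (l + 1) 1 k e ∩ ρ ⁻¹' (r ⁻¹' pieceSet (l + 1) 1 k e) ∧
      (y ∈ r ⁻¹' pieceSet (l + 1) 1 k e ∪ ρ ⁻¹' (r ⁻¹' pieceSet (l + 1) 1 k e) ↔
        (fun i => (y (σ (Sum.inl i))).1) ∉ unbddSet (l + 1) k e) := by
    filter_upwards [ae_linearIndepOn_hom hμ.fst, ae_linearIndepOn_lift hμ] with y h1 h2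
    let G : Finset (Fin (l + 2)) := Finset.univ.image fun i => σ (Sum.inl i)
    have hG : G.card = l + 1 := by
      exact (Finset.card_image_of_injective _ (σ.injective.comp Sum.inl_injective)).trans (by simp)
    have hspan := span_eq_top_of_card (h1 G hG.le) (by simpa using hG)
    obtain ⟨c, hc⟩ := exists_dual_of_linearIndepOn (h1 G hG.le) fun i => (y i).2
    have hc' : ∀ i, c (hom (y (σ (Sum.inl i))).1) = (y (σ (Sum.inl i))).2 := fun i =>
      hc _ (Finset.mem_coe.2 (Finset.mem_image_of_mem _ (Finset.mem_univ i)))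
    have huniq : ∀ d : Module.Dual ℝ (Euc l × ℝ),
        (∀ i, d (hom (y (σ (Sum.inl i))).1) = (y (σ (Sum.inl i))).2) → d = c := by
      intro d hd
      refine LinearMap.ext_on hspan ?_
      rintro _ ⟨i, hi, rfl⟩
      obtain ⟨i, -, rfl⟩ := Finset.mem_image.1 (Finset.mem_coe.1 hi)
      exact (hd i).trans (hc' i).symm
    have hA : r y ∈ supportSet (l + 1) 1 ↔
        c (hom (y (σ (Sum.inr 0))).1) ≤ (y (σ (Sum.inr 0))).2 := by
      constructor
      · rintro ⟨d, hd, hd'⟩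
        rw [← huniq d hd]
        exact hd' 0
      · intro h
        exact ⟨c, hc', fun j => by rw [Subsingleton.elim j 0]; exact h⟩
    have hB : r (ρ y) ∈ supportSet (l + 1) 1 ↔
        (y (σ (Sum.inr 0))).2 ≤ c (hom (y (σ (Sum.inr 0))).1) := by
      constructor
      · rintro ⟨d, hd, hd'⟩
        rw [← huniq (-d) fun i => by simpa [r, ρ] using congrArg Neg.neg (hd i)]
        have := hd' 0
        simp only [LinearMap.neg_apply]
        exact le_neg.1 this
      · intro h
        refine ⟨-c, fun i => ?_, fun j => ?_⟩
        · simpa [r, ρ] using hc' i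
        · rw [Subsingleton.elim j 0]
          simpa [r, ρ] using h
    have hne : c (hom (y (σ (Sum.inr 0))).1) ≠ (y (σ (Sum.inr 0))).2 := by
      intro h
      have := card_le_finrank_of_apply_eq (v := fun i => hom (y i).1) (z := fun i => (y i).2)
        (c := c) (H := Finset.univ) (fun H hH => h2 H (by simpa using hH)) (fun i _ => by
          obtain ⟨i | i, rfl⟩ := σ.surjective i
          · exact hc' i
          · rw [Subsingleton.elim i 0]; exact h)
      simp at this
    refine ⟨fun h => hne (le_antisymm (hA.1 h.1.2) (hB.1 h.2.2)), ?_⟩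
    constructor
    · rintro (h | h)
      · exact h.1
      · exact h.1
    · intro h
      rcases le_total (c (hom (y (σ (Sum.inr 0))).1)) (y (σ (Sum.inr 0))).2 with h' | h'
      · exact Or.inl ⟨h, hA.2 h'⟩
      · exact Or.inr ⟨h, hB.2 h'⟩
  rw [measure_eq_zero_iff_ae_notMem.2 (hgen.mono fun y hy => hy.1), add_zero]
  exact measure_congr (hgen.mono fun y hy => propext hy.2)

end LowerFaces

/-! ### Interpolation coordinates -/

section Interpolation

theorem addHaar_affine_eq_zero {E : Type*} [NormedAddCommGroup E] [NormedSpace ℝ E]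
    [FiniteDimensional ℝ E] [MeasurableSpace E] [BorelSpace E] (μ : Measure E)
    [μ.IsAddHaarMeasure] (ψ : Module.Dual ℝ E) (b : ℝ) (h : ψ = 0 → b ≠ 0) :
    μ {x | ψ x + b = 0} = 0 := by
  by_cases hψ : ψ = 0
  · simp [hψ, h hψ]
  · rcases Set.eq_empty_or_nonempty {x | ψ x + b = 0} with h0 | ⟨x₀, hx₀⟩
    · simp [h0]
    · have hx₀ : ψ x₀ + b = 0 := hx₀
      have : {x | ψ x + b = 0} = (fun x => x + -x₀) ⁻¹' (LinearMap.ker ψ : Set E) := by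
        ext x
        simp only [Set.mem_ofPred_eq, Set.mem_preimage, SetLike.mem_coe, LinearMap.mem_ker, map_add,
          map_neg]
        constructor <;> intro h <;> linarith
      rw [this, measure_preimage_add_right]
      exact Measure.addHaar_submodule μ _ fun h => hψ (LinearMap.ker_eq_top.1 h)

variable {l : ℕ}

theorem volume_dual_hom_eq_zero (φ : Module.Dual ℝ (Euc l × ℝ)) (hφ : φ ≠ 0) :
    volume {x : Euc l | φ (hom x) = 0} = 0 := by
  have h1 : ∀ x : Euc l, φ (hom x) = φ.comp (LinearMap.inl ℝ _ ℝ) x + φ (0, 1) := fun x => by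
    simp [hom, ← map_add]
  simp only [h1]
  refine addHaar_affine_eq_zero volume _ _ fun h2 h3 => hφ ?_
  refine LinearMap.ext fun q => ?_
  have h4 : q = LinearMap.inl ℝ (Euc l) ℝ q.1 + q.2 • (0, 1) := by ext <;> simp
  rw [h4, map_add, map_smul, h3]
  simpa using LinearMap.congr_fun h2 q.1

theorem nullHyperplanes_of_absolutelyContinuous {μ : Measure (Euc l × ℝ)} (h : μ ≪ volume) :
    NullHyperplanes μ := by
  intro φ hφ
  refine h ?_
  let ι : Euc l × ℝ →ₗ[ℝ] (Euc l × ℝ) × ℝ :=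
    ((LinearMap.inl ℝ (Euc l) ℝ).comp (LinearMap.fst ℝ _ ℝ)).prod (LinearMap.snd ℝ _ ℝ)
  have h1 : ∀ y : Euc l × ℝ, φ (hom y.1, y.2) = φ.comp ι y + φ ((0, 1), 0) := fun y => by
    simp [hom, ι, ← map_add]
  simp only [h1]
  have : (volume : Measure (Euc l × ℝ)).IsAddHaarMeasure :=
    Measure.prod.instIsAddHaarMeasure volume volume
  refine addHaar_affine_eq_zero volume _ _ fun h2 h3 => hφ (LinearMap.ext fun q => ?_)
  have h4 : q = ι (q.1.1, q.2) + q.1.2 • ((0, 1), 0) := by ext <;> simp [ι]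
  rw [h4, map_add, map_smul, h3]
  simpa using LinearMap.congr_fun h2 (q.1.1, q.2)

theorem ae_linearIndependent_hom :
    ∀ᵐ x : Fin (l + 1) → Euc l, LinearIndependent ℝ fun i => hom (x i) := by
  filter_upwards [ae_notMem_sup_span (n := l + 1) (volume : Measure (Euc l)) (v := hom)
    continuous_hom volume_dual_hom_eq_zero ⊥] with x hx
  have h := linearIndepOn_of_forall_notMem_span (v := fun i => hom (x i)) (d := l + 1)
    (fun G i hi hG => ?_) Finset.univ (by simp)
  · simpa [linearIndepOn_univ_iff] using h
  · have := hx G i hi (by simpa using hG)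
    rwa [bot_sup_eq] at this

theorem aff_comm (p q : Euc l × ℝ) : aff p q = aff q p := by
  rw [aff_apply, aff_apply, real_inner_comm, mul_comm]

/-- Volume-preserving linear coordinates on `Euc l × ℝ`. -/
def coordEquiv (l : ℕ) : (Fin (l + 1) → ℝ) ≃ₗ[ℝ] Euc l × ℝ :=
  (WithLp.linearEquiv 2 ℝ (Fin (l + 1) → ℝ)).symm.trans (splitLast l)

theorem measurePreserving_coordEquiv : MeasurePreserving (coordEquiv l) :=
  (measurePreserving_splitLast l).comp (PiLp.volume_preserving_toLp (Fin (l + 1)))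

/-- The values at the points `x i` of the affine functional with given coordinates. -/
def evalMap (x : Fin (l + 1) → Euc l) : (Fin (l + 1) → ℝ) →ₗ[ℝ] (Fin (l + 1) → ℝ) :=
  LinearMap.pi fun i => (aff (hom (x i))).comp (coordEquiv l).toLinearMap

theorem evalMap_apply (x : Fin (l + 1) → Euc l) (w : Fin (l + 1) → ℝ) (i : Fin (l + 1)) :
    evalMap x w i = aff (coordEquiv l w) (hom (x i)) := by
  rw [aff_comm]; rfl

theorem det_evalMap_ne_zero {x : Fin (l + 1) → Euc l}
    (hx : LinearIndependent ℝ fun i => hom (x i)) : LinearMap.det (evalMap x) ≠ 0 := by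
  refine ((LinearMap.isUnit_iff_isUnit_det _).1 ((LinearMap.isUnit_iff_ker_eq_bot _).2 ?_)).ne_zero
  refine LinearMap.ker_eq_bot'.2 fun w hw => ?_
  have hspan := hx.span_eq_top_of_card_eq_finrank (by simp)
  have h0 : aff (coordEquiv l w) = 0 := by
    refine LinearMap.ext_on_range hspan fun i => ?_
    simpa [evalMap_apply] using congrFun hw i
  have h1 := LinearMap.congr_fun h0 (coordEquiv l w)
  rw [aff_apply, real_inner_self_eq_norm_sq, LinearMap.zero_apply] at h1
  have h2 : (coordEquiv l w).1 = 0 := by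
    rw [← norm_eq_zero]; nlinarith [sq_nonneg ‖(coordEquiv l w).1‖,
      mul_self_nonneg (coordEquiv l w).2]
  have h3 : (coordEquiv l w).2 = 0 := by nlinarith [sq_nonneg ‖(coordEquiv l w).1‖]
  exact (LinearEquiv.map_eq_zero_iff _).1 (Prod.ext h2 h3)

/-- The Jacobian of interpolation at the points `x i`. -/
def interpDet (x : Fin (l + 1) → Euc l) : ENNReal := ENNReal.ofReal |LinearMap.det (evalMap x)|

@[fun_prop]
theorem measurable_interpDet : Measurable (interpDet (l := l)) := by
  have h : Continuous fun x : Fin (l + 1) → Euc l => LinearMap.det (evalMap x) := by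
    simp only [← LinearMap.det_toMatrix']
    refine Continuous.matrix_det (continuous_matrix fun i j => ?_)
    simp only [LinearMap.toMatrix'_apply, evalMap_apply, aff_apply, hom]
    fun_prop
  exact (h.measurable.norm).ennreal_ofReal

theorem lintegral_interp {x : Fin (l + 1) → Euc l} (hx : LinearIndependent ℝ fun i => hom (x i))
    {f : (Fin (l + 1) → ℝ) → ENNReal} (hf : Measurable f) :
    ∫⁻ z, f z = interpDet x * ∫⁻ p : Euc l × ℝ, f fun i => aff p (hom (x i)) := by
  rw [lintegral_comp_affine volume (det_evalMap_ne_zero hx) 0 hf, interpDet]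
  congr 1
  rw [← (measurePreserving_coordEquiv (l := l)).lintegral_comp]
  · simp only [add_zero]
    refine lintegral_congr fun w => congrArg f (funext fun i => evalMap_apply x w i)
  · refine hf.comp (measurable_pi_lambda _ fun i => ?_)
    simp only [aff_apply, hom]
    fun_prop

theorem interpDet_smul_add (x : Fin (l + 1) → Euc l) (s : ℝ) (x₀ : Euc l) :
    interpDet (fun i => s • x i + x₀) = ENNReal.ofReal (|s| ^ l) * interpDet x := by
  let f : Module.Dual ℝ (Euc l × ℝ) := aff (x₀, 0)
  let S : Euc l × ℝ →ₗ[ℝ] Euc l × ℝ :=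
    ((s • LinearMap.id).prodMap LinearMap.id).comp (LinearMap.transvection f (0, 1))
  have hS : LinearMap.det S = s ^ l := by
    rw [LinearMap.det_comp, LinearMap.det_prodMap, LinearMap.transvection.det]
    simp [f]
  have h : evalMap (fun i => s • x i + x₀) = (evalMap x).comp
      (((coordEquiv l).symm.toLinearMap.comp S).comp (coordEquiv l).toLinearMap) := by
    refine LinearMap.ext fun w => funext fun i => ?_
    simp only [evalMap_apply, LinearMap.comp_apply, LinearEquiv.coe_coe,
      LinearEquiv.apply_symm_apply]
    simp [S, f, aff_apply, hom, LinearMap.transvection.apply, inner_add_right, inner_smul_left,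
      inner_smul_right, real_inner_comm]
    ring
  have hconj : LinearMap.det (((coordEquiv l).symm.toLinearMap.comp S).comp
      (coordEquiv l).toLinearMap) = s ^ l := by
    rw [← hS, LinearMap.comp_assoc]
    exact LinearMap.det_conj S (coordEquiv l).symm
  rw [interpDet, h, LinearMap.det_comp, hconj, abs_mul, mul_comm, abs_pow,
    ENNReal.ofReal_mul (by positivity), interpDet]

end Interpolation

/-! ### Distances of random hyperplanes -/

section HyperplaneHeights

variable {l : ℕ}

/-- The signed distance from the origin of the hyperplane `z = ⟪a, x⟫ + b`. -/
def height (p : Euc l × ℝ) : ℝ := p.2 / √(1 + ‖p.1‖ ^ 2)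

@[fun_prop]
theorem measurable_height : Measurable (height (l := l)) := by unfold height; fun_prop

theorem height_sq (p : Euc l × ℝ) : height p ^ 2 = p.2 ^ 2 / (1 + ‖p.1‖ ^ 2) := by
  rw [height, div_pow, sq_sqrt (by positivity)]

/-- The homothety carrying a hyperplane through the origin to the given hyperplane. -/
def sliceMap (p : Euc l × ℝ) (y : Euc l) : Euc l :=
  √(1 - height p ^ 2) • y + -(p.2 / (1 + ‖p.1‖ ^ 2)) • p.1

theorem height_sq_le (p : Euc l × ℝ) (x : Euc l) :
    height p ^ 2 ≤ ‖x‖ ^ 2 + aff p (hom x) ^ 2 := by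
  rw [height_sq, div_le_iff₀ (by positivity), aff_apply]
  have h1 := abs_real_inner_le_norm p.1 x
  have h2 : (inner ℝ p.1 x) ^ 2 ≤ ‖p.1‖ ^ 2 * ‖x‖ ^ 2 := by
    rw [← mul_pow, ← sq_abs]
    exact pow_le_pow_left₀ (abs_nonneg _) h1 2
  simp only [hom, mul_one]
  set u : ℝ := inner ℝ p.1 x
  by_cases h0 : ‖p.1‖ = 0
  · have : u = 0 := by rw [h0] at h1; simpa using h1
    rw [h0, this]; nlinarith [sq_nonneg ‖x‖]
  · have h3 : 0 < ‖p.1‖ ^ 2 := by positivity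
    have h4 : 0 ≤ (‖p.1‖ ^ 2 * (u + p.2) + u) ^ 2 := sq_nonneg _
    have : p.2 ^ 2 * ‖p.1‖ ^ 2 ≤ (u ^ 2 + ‖p.1‖ ^ 2 * (u + p.2) ^ 2) * (1 + ‖p.1‖ ^ 2) := by
      nlinarith
    have h5 : p.2 ^ 2 * ‖p.1‖ ^ 2 ≤
        ((‖x‖ ^ 2 + (u + p.2) ^ 2) * (1 + ‖p.1‖ ^ 2)) * ‖p.1‖ ^ 2 := by
      nlinarith [mul_le_mul_of_nonneg_right h2 (show 0 ≤ 1 + ‖p.1‖ ^ 2 by positivity)]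
    exact le_of_mul_le_mul_right h5 h3

theorem norm_sq_sliceMap_add {p : Euc l × ℝ} (hp : height p ^ 2 < 1) (y : Euc l) :
    ‖sliceMap p y‖ ^ 2 + aff p (hom (sliceMap p y)) ^ 2 =
      height p ^ 2 + (1 - height p ^ 2) * (‖y‖ ^ 2 + aff (p.1, 0) (hom y) ^ 2) := by
  have hs : √(1 - height p ^ 2) ^ 2 = 1 - height p ^ 2 := sq_sqrt (by linarith)
  rw [sliceMap]
  simp only [aff_apply, hom, mul_one, inner_add_right, inner_smul_right,
    real_inner_self_eq_norm_sq, add_zero]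
  rw [norm_add_sq_real, norm_smul, norm_smul, real_inner_smul_left, real_inner_smul_right, mul_pow,
    mul_pow, norm_eq_abs, norm_eq_abs, sq_abs, sq_abs, hs]
  rw [real_inner_comm p.1 y]
  have h2 : height p ^ 2 * (1 + ‖p.1‖ ^ 2) = p.2 ^ 2 := by
    rw [height_sq]; field_simp
  set u : ℝ := inner ℝ p.1 y
  set s := √(1 - height p ^ 2)
  set N := ‖p.1‖ ^ 2
  have hN : 0 < 1 + N := by positivity
  set t := p.2 / (1 + N)
  have ht : p.2 = t * (1 + N) := by simp only [t]; field_simp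
  have ht2 : height p ^ 2 = t ^ 2 * (1 + N) := by
    rw [ht] at h2
    have : (height p ^ 2) * (1 + N) = (t ^ 2 * (1 + N)) * (1 + N) := by rw [h2]; ring
    exact mul_right_cancel₀ hN.ne' this
  rw [ht]
  linear_combination u ^ 2 * hs - ht2

theorem wgt_sliceMap {γ : ℝ} {p : Euc l × ℝ} (hp : height p ^ 2 < 1) (y : Euc l) :
    wgt γ (‖sliceMap p y‖ ^ 2 + aff p (hom (sliceMap p y)) ^ 2) =
      ENNReal.ofReal ((1 - height p ^ 2) ^ γ) * wgt γ (‖y‖ ^ 2 + aff (p.1, 0) (hom y) ^ 2) := by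
  rw [norm_sq_sliceMap_add hp, wgt_add_mul hp]

theorem det_smul_id (s : ℝ) : LinearMap.det (s • (LinearMap.id : Euc l →ₗ[ℝ] Euc l)) = s ^ l := by
  rw [LinearMap.det_smul, LinearMap.det_id, mul_one, finrank_euclideanSpace_fin]

/-- The intercept is the height up to a factor depending on the slope. -/
theorem lintegral_height (a : Euc l) {f : ℝ → ENNReal} (hf : Measurable f) :
    ∫⁻ b, f (height (a, b)) = ENNReal.ofReal √(1 + ‖a‖ ^ 2) * ∫⁻ h, f h := by
  have hs : 0 < √(1 + ‖a‖ ^ 2) := sqrt_pos.2 (by positivity)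
  have hdet : LinearMap.det (√(1 + ‖a‖ ^ 2) • (LinearMap.id : ℝ →ₗ[ℝ] ℝ)) = √(1 + ‖a‖ ^ 2) := by
    rw [LinearMap.det_smul, LinearMap.det_id]; simp
  rw [lintegral_comp_affine volume (hdet ▸ hs.ne') 0 (f := fun b => f (height (a, b)))
    (hf.comp (measurable_height.comp (by fun_prop))), hdet, abs_of_pos hs]
  congr 1
  refine lintegral_congr fun h => congrArg f ?_
  simp [height]
  field_simp

/-- The joint density of an interpolating hyperplane factors through its height. -/
theorem lintegral_slice (γ : ℝ) {A : Set (Fin (l + 1) → Euc l)} (hA : MeasurableSet A)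
    (hinv : ∀ s : ℝ, 0 < s → ∀ x₀ x, (fun i => s • x i + x₀) ∈ A ↔ x ∈ A) (p : Euc l × ℝ) :
    ∫⁻ x : Fin (l + 1) → Euc l, A.indicator 1 x * interpDet x *
        ∏ i, wgt γ (‖x i‖ ^ 2 + aff p (hom (x i)) ^ 2) =
      wgt ((l : ℝ) * (l + 2) / 2 + γ * (l + 1)) (height p ^ 2) *
        ∫⁻ x : Fin (l + 1) → Euc l, A.indicator 1 x * interpDet x *
          ∏ i, wgt γ (‖x i‖ ^ 2 + aff (p.1, 0) (hom (x i)) ^ 2) := by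
  have hmeas : ∀ p : Euc l × ℝ, Measurable fun x : Fin (l + 1) → Euc l =>
      A.indicator 1 x * interpDet x * ∏ i, wgt γ (‖x i‖ ^ 2 + aff p (hom (x i)) ^ 2) := by
    intro p
    simp only [aff_apply, hom]
    have := measurable_one.indicator hA (f := (1 : (Fin (l + 1) → Euc l) → ENNReal))
    fun_prop
  rcases lt_or_ge (height p ^ 2) 1 with hp | hp
  · have h1 : 0 < 1 - height p ^ 2 := by linarith
    set s := √(1 - height p ^ 2) with hs_def
    have hs : 0 < s := sqrt_pos.2 h1
    rw [volume_pi, lintegral_pi_comp_affine volume (l + 1) (T := s • LinearMap.id)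
      (by rw [det_smul_id]; positivity) (-(p.2 / (1 + ‖p.1‖ ^ 2)) • p.1) (hmeas p), det_smul_id]
    have hslice : ∀ y : Euc l, (s • (LinearMap.id : Euc l →ₗ[ℝ] Euc l)) y +
        -(p.2 / (1 + ‖p.1‖ ^ 2)) • p.1 = sliceMap p y := fun y => rfl
    have hind : ∀ x : Fin (l + 1) → Euc l,
        A.indicator (1 : (Fin (l + 1) → Euc l) → ENNReal) (fun i => sliceMap p (x i)) =
        A.indicator 1 x := fun x => by
      have h : (fun i => sliceMap p (x i)) ∈ A ↔ x ∈ A := hinv s hs _ x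
      by_cases hx : x ∈ A
      · rw [Set.indicator_of_mem hx, Set.indicator_of_mem (h.2 hx)]; rfl
      · rw [Set.indicator_of_notMem hx, Set.indicator_of_notMem (mt h.1 hx)]
    have hdet : ∀ x : Fin (l + 1) → Euc l, interpDet (fun i => sliceMap p (x i)) =
        ENNReal.ofReal (|s| ^ l) * interpDet x := fun x => interpDet_smul_add x s _
    simp only [hslice, hind, hdet, wgt_sliceMap hp, Finset.prod_mul_distrib, Finset.prod_const,
      Finset.card_univ, Fintype.card_fin]
    set c := ENNReal.ofReal ((1 - height p ^ 2) ^ γ)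
    have hre : ∀ x : Fin (l + 1) → Euc l, A.indicator (1 : (Fin (l + 1) → Euc l) → ENNReal) x *
        (ENNReal.ofReal (|s| ^ l) * interpDet x) *
        (c ^ (l + 1) * ∏ i, wgt γ (‖x i‖ ^ 2 + aff (p.1, 0) (hom (x i)) ^ 2)) =
        (ENNReal.ofReal (|s| ^ l) * c ^ (l + 1)) *
          (A.indicator (1 : (Fin (l + 1) → Euc l) → ENNReal) x *
          interpDet x *
        ∏ i, wgt γ (‖x i‖ ^ 2 + aff (p.1, 0) (hom (x i)) ^ 2)) := fun x => by ring
    simp only [hre]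
    rw [lintegral_const_mul _ (hmeas _), ← mul_assoc]
    congr 1
    simp only [c]
    rw [wgt, if_pos hp, ← ENNReal.ofReal_pow (abs_nonneg _),
      ← ENNReal.ofReal_pow (rpow_nonneg h1.le _), ← ENNReal.ofReal_mul (by positivity),
      ← ENNReal.ofReal_mul (by positivity), abs_pow, abs_of_pos hs, hs_def, sqrt_eq_rpow]
    congr 1
    simp only [← rpow_mul_natCast h1.le, ← rpow_add h1]
    congr 1
    push_cast
    ring
  · rw [wgt_of_one_le hp, zero_mul]
    refine (lintegral_congr fun x => ?_).trans lintegral_zero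
    rw [Finset.prod_eq_zero (Finset.mem_univ 0), mul_zero]
    exact wgt_of_one_le (hp.trans (height_sq_le p (x 0)))

/-- The distribution of the height of the hyperplane through `l + 1` beta points. -/
theorem exists_lintegral_interp_eq (γ : ℝ) {A : Set (Fin (l + 1) → Euc l)} (hA : MeasurableSet A)
    (hinv : ∀ s : ℝ, 0 < s → ∀ x₀ x, (fun i => s • x i + x₀) ∈ A ↔ x ∈ A) :
    ∃ C : ENNReal, ∀ g : ℝ → ENNReal, Measurable g → ∀ R : (Fin (l + 1) → Euc l × ℝ) → ENNReal,
      Measurable R → (∀ (x : Fin (l + 1) → Euc l) p, LinearIndependent ℝ (fun i => hom (x i)) →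
        R (fun i => (x i, aff p (hom (x i)))) = g (height p)) →
      ∫⁻ y : Fin (l + 1) → Euc l × ℝ, A.indicator 1 (fun i => (y i).1) * R y *
          ∏ i, wgt γ (‖(y i).1‖ ^ 2 + (y i).2 ^ 2) =
        C * ∫⁻ h, g h * wgt ((l : ℝ) * (l + 2) / 2 + γ * (l + 1)) (h ^ 2) := by
  have hA1 := measurable_one.indicator hA (f := (1 : (Fin (l + 1) → Euc l) → ENNReal))
  let B : Euc l → ENNReal := fun a => ∫⁻ x : Fin (l + 1) → Euc l, A.indicator 1 x * interpDet x *
    ∏ i, wgt γ (‖x i‖ ^ 2 + aff (a, 0) (hom (x i)) ^ 2)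
  have hB : Measurable B := by
    refine Measurable.lintegral_prod_right' (f := fun q : Euc l × (Fin (l + 1) → Euc l) =>
      A.indicator 1 q.2 * interpDet q.2 *
        ∏ i, wgt γ (‖q.2 i‖ ^ 2 + aff (q.1, 0) (hom (q.2 i)) ^ 2)) ?_
    simp only [aff_apply, hom]
    fun_prop
  refine ⟨∫⁻ a, ENNReal.ofReal √(1 + ‖a‖ ^ 2) * B a, fun g hg R hR hRg => ?_⟩
  set δ := (l : ℝ) * (l + 2) / 2 + γ * (l + 1)
  have hA2 : Measurable fun y : Fin (l + 1) → Euc l × ℝ =>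
      A.indicator (1 : (Fin (l + 1) → Euc l) → ENNReal) (fun i => (y i).1) := hA1.comp (by fun_prop)
  have hF : Measurable fun y : Fin (l + 1) → Euc l × ℝ => A.indicator 1 (fun i => (y i).1) * R y *
      ∏ i, wgt γ (‖(y i).1‖ ^ 2 + (y i).2 ^ 2) := by fun_prop
  have hzip := (volume_measurePreserving_arrowProdEquivProdArrow (Euc l) ℝ (Fin (l + 1))).symm
  rw [← hzip.lintegral_comp hF, Measure.volume_eq_prod]
  refine (lintegral_prod _ (hF.comp hzip.measurable).aemeasurable).trans ?_
  have h1 : ∀ᵐ x : Fin (l + 1) → Euc l, ∫⁻ z : Fin (l + 1) → ℝ,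
      A.indicator 1 x * R (fun i => (x i, z i)) * ∏ i, wgt γ (‖x i‖ ^ 2 + z i ^ 2) =
      ∫⁻ p : Euc l × ℝ, g (height p) * (A.indicator 1 x * interpDet x *
        ∏ i, wgt γ (‖x i‖ ^ 2 + aff p (hom (x i)) ^ 2)) := by
    filter_upwards [ae_linearIndependent_hom] with x hx
    have hm : Measurable fun z : Fin (l + 1) → ℝ =>
      A.indicator 1 x * R (fun i => (x i, z i)) * ∏ i, wgt γ (‖x i‖ ^ 2 + z i ^ 2) := by fun_prop
    rw [lintegral_interp hx hm, ← lintegral_const_mul]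
    · refine lintegral_congr fun p => ?_
      rw [hRg x p hx]
      ring
    · refine hm.comp (measurable_pi_lambda _ fun i => ?_)
      simp only [aff_apply, hom]
      fun_prop
  refine (lintegral_congr_ae h1).trans ?_
  rw [lintegral_lintegral_swap]
  · have h2 : ∀ p : Euc l × ℝ, ∫⁻ x : Fin (l + 1) → Euc l, g (height p) * (A.indicator 1 x *
        interpDet x * ∏ i, wgt γ (‖x i‖ ^ 2 + aff p (hom (x i)) ^ 2)) =
        g (height p) * wgt δ (height p ^ 2) * B p.1 := by
      intro p
      rw [lintegral_const_mul, lintegral_slice γ hA hinv p, mul_assoc]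
      simp only [aff_apply, hom]
      fun_prop
    simp only [h2]
    rw [Measure.volume_eq_prod, lintegral_prod _ (by fun_prop), ← lintegral_mul_const _ (by fun_prop)]
    refine lintegral_congr fun a => ?_
    change ∫⁻ b, g (height (a, b)) * wgt δ (height (a, b) ^ 2) * B a = _
    rw [lintegral_mul_const _ (by fun_prop),
      lintegral_height a (f := fun h => g h * wgt δ (h ^ 2)) (by fun_prop)]
    ring
  · simp only [aff_apply, hom]
    fun_prop

end HyperplaneHeights

/-! ### Beta laws -/

section BetaLaws

variable {l : ℕ}

/-- The normalized beta law on `Euc l`. -/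
def betaLaw (γ : ℝ) (l : ℕ) : Measure (Euc l) :=
  volume.withDensity fun x => (∫⁻ x : Euc l, wgt γ (‖x‖ ^ 2))⁻¹ * wgt γ (‖x‖ ^ 2)

/-- The normalized beta law on `Euc l × ℝ`. -/
def pairLaw (γ : ℝ) (l : ℕ) : Measure (Euc l × ℝ) :=
  volume.withDensity fun y => (∫⁻ x : Euc (l + 1), wgt γ (‖x‖ ^ 2))⁻¹ *
    wgt γ (‖y.1‖ ^ 2 + y.2 ^ 2)

theorem isProbabilityMeasure_betaLaw {γ : ℝ} (hγ : -1 < γ) (l : ℕ) :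
    IsProbabilityMeasure (betaLaw γ l) := by
  refine ⟨?_⟩
  rw [betaLaw, withDensity_apply _ MeasurableSet.univ, setLIntegral_univ,
    lintegral_const_mul _ (by fun_prop)]
  exact ENNReal.inv_mul_cancel (lintegral_wgt_norm_sq_ne_zero l hγ)
    (lintegral_wgt_norm_sq_ne_top l hγ)

theorem map_splitLast_betaLaw (γ : ℝ) (l : ℕ) :
    (betaLaw γ (l + 1)).map (splitLast l) = pairLaw γ l := by
  ext s hs
  rw [Measure.map_apply (continuous_splitLast l).measurable hs, betaLaw, pairLaw,
    withDensity_apply _ hs, withDensity_apply _ ((continuous_splitLast l).measurable hs),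
    ← (measurePreserving_splitLast l).setLIntegral_comp_preimage hs (by fun_prop)]
  simp only [norm_sq_eq_splitLast]

theorem measurePreserving_splitLast_betaLaw (γ : ℝ) (l : ℕ) :
    MeasurePreserving (splitLast l) (betaLaw γ (l + 1)) (pairLaw γ l) :=
  ⟨(continuous_splitLast l).measurable, map_splitLast_betaLaw γ l⟩

theorem isProbabilityMeasure_pairLaw {γ : ℝ} (hγ : -1 < γ) (l : ℕ) :
    IsProbabilityMeasure (pairLaw γ l) := by
  have := isProbabilityMeasure_betaLaw hγ (l + 1)
  rw [← map_splitLast_betaLaw]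
  exact Measure.isProbabilityMeasure_map (continuous_splitLast l).measurable.aemeasurable

theorem lintegral_wgt_pair (γ : ℝ) (x : Euc l) :
    ∫⁻ t : ℝ, wgt γ (‖x‖ ^ 2 + t ^ 2) =
      wgt (γ + 1 / 2) (‖x‖ ^ 2) * ∫⁻ t : ℝ, wgt γ (t ^ 2) := by
  simpa using lintegral_wgt_add (volume : Measure ℝ) γ (‖x‖ ^ 2)

theorem lintegral_wgt_succ (γ : ℝ) (l : ℕ) :
    ∫⁻ x : Euc (l + 1), wgt γ (‖x‖ ^ 2) =
      (∫⁻ x : Euc l, wgt (γ + 1 / 2) (‖x‖ ^ 2)) * ∫⁻ t : ℝ, wgt γ (t ^ 2) := by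
  simp only [norm_sq_eq_splitLast]
  rw [(measurePreserving_splitLast l).lintegral_comp (f := fun y => wgt γ (‖y.1‖ ^ 2 + y.2 ^ 2))
    (by fun_prop), Measure.volume_eq_prod, lintegral_prod _ (by fun_prop),
    ← lintegral_mul_const _ (by fun_prop)]
  exact lintegral_congr fun x => lintegral_wgt_pair γ x

/-- The first marginal of a beta law. -/
theorem measurePreserving_fst_pairLaw {γ : ℝ} (hγ : -1 < γ) (l : ℕ) :
    MeasurePreserving Prod.fst (pairLaw γ l) (betaLaw (γ + 1 / 2) l) := by
  refine ⟨measurable_fst, ?_⟩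
  ext s hs
  rw [Measure.map_apply measurable_fst hs, betaLaw, pairLaw,
    withDensity_apply _ hs, withDensity_apply _ (measurable_fst hs), ← lintegral_indicator hs,
    ← lintegral_indicator (measurable_fst hs), Measure.volume_eq_prod, lintegral_prod]
  · refine lintegral_congr fun x => ?_
    by_cases hx : x ∈ s
    · simp only [Set.indicator_of_mem hx]
      have : ∀ t : ℝ, (Prod.fst ⁻¹' s).indicator (fun y : Euc l × ℝ =>
          (∫⁻ x : Euc (l + 1), wgt γ (‖x‖ ^ 2))⁻¹ * wgt γ (‖y.1‖ ^ 2 + y.2 ^ 2)) (x, t) =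
          (∫⁻ x : Euc (l + 1), wgt γ (‖x‖ ^ 2))⁻¹ * wgt γ (‖x‖ ^ 2 + t ^ 2) := fun t =>
        Set.indicator_of_mem (show (x, t) ∈ Prod.fst ⁻¹' s from hx) _
      simp only [this]
      have h0 := lintegral_wgt_sq_ne_zero hγ
      have h1 := lintegral_wgt_sq_ne_top hγ
      rw [lintegral_const_mul _ (by fun_prop), lintegral_wgt_pair, lintegral_wgt_succ,
        ENNReal.mul_inv (Or.inr h1) (Or.inr h0)]
      set I := ∫⁻ t : ℝ, wgt γ (t ^ 2)
      calc _ = (∫⁻ x : Euc l, wgt (γ + 1 / 2) (‖x‖ ^ 2))⁻¹ * wgt (γ + 1 / 2) (‖x‖ ^ 2) *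
            (I⁻¹ * I) := by ring
        _ = _ := by rw [ENNReal.inv_mul_cancel h0 h1, mul_one]
    · rw [Set.indicator_of_notMem hx]
      refine (lintegral_congr fun t => ?_).trans lintegral_zero
      exact Set.indicator_of_notMem (show (x, t) ∉ Prod.fst ⁻¹' s from hx) _
  · exact (Measurable.indicator (by fun_prop) (measurable_fst hs)).aemeasurable

theorem nullHyperplanes_pairLaw (γ : ℝ) (l : ℕ) : NullHyperplanes (pairLaw γ l) :=
  nullHyperplanes_of_absolutelyContinuous (withDensity_absolutelyContinuous _ _)

/-- Tails of the one-dimensional beta law. -/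
def betaTail (κ h : ℝ) : ENNReal :=
  (∫⁻ t : ℝ, wgt κ (t ^ 2))⁻¹ * ∫⁻ t in Set.Ici h, wgt κ (t ^ 2)

theorem betaTail_antitone (κ : ℝ) : Antitone (betaTail κ) := fun _ _ h => by
  unfold betaTail
  gcongr

@[fun_prop]
theorem measurable_betaTail (κ : ℝ) : Measurable (betaTail κ) := (betaTail_antitone κ).measurable

/-- Projecting a beta weight onto a line gives a beta weight. -/
theorem exists_lintegral_height_sub (γ : ℝ) (a : Euc l) :
    ∃ c : ENNReal, ∀ φ : ℝ → ENNReal, Measurable φ →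
      ∫⁻ y : Euc l × ℝ, φ (height (a, y.2 - inner ℝ a y.1)) * wgt γ (‖y.1‖ ^ 2 + y.2 ^ 2) =
        c * ∫⁻ t, φ t * wgt (γ + l / 2) (t ^ 2) := by
  have hslice : ∀ b : ℝ, ∫⁻ x : Euc l, wgt γ (‖x‖ ^ 2 + aff (a, b) (hom x) ^ 2) =
      wgt (γ + l / 2) (height (a, b) ^ 2) *
        ∫⁻ x : Euc l, wgt γ (‖x‖ ^ 2 + aff (a, 0) (hom x) ^ 2) := by
    intro b
    have hm : ∀ b : ℝ, Measurable fun x : Euc l => wgt γ (‖x‖ ^ 2 + aff (a, b) (hom x) ^ 2) := by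
      intro b
      simp only [aff_apply, hom]
      fun_prop
    rcases lt_or_ge (height (a, b) ^ 2) 1 with hp | hp
    · have h1 : 0 < 1 - height (a, b) ^ 2 := by linarith
      have hs : 0 < √(1 - height (a, b) ^ 2) := sqrt_pos.2 h1
      rw [lintegral_comp_affine volume (T := √(1 - height (a, b) ^ 2) • LinearMap.id)
        (by rw [det_smul_id]; positivity) (-(b / (1 + ‖a‖ ^ 2)) • a) (hm b), det_smul_id]
      have : ∀ y : Euc l, (√(1 - height (a, b) ^ 2) • (LinearMap.id : Euc l →ₗ[ℝ] Euc l)) y +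
        -(b / (1 + ‖a‖ ^ 2)) • a = sliceMap (a, b) y := fun y => rfl
      simp only [this, wgt_sliceMap hp]
      rw [lintegral_const_mul _ (hm 0), ← mul_assoc, wgt, if_pos hp,
        ← ENNReal.ofReal_mul (by positivity), abs_of_pos (pow_pos hs _), sqrt_eq_rpow,
        ← rpow_mul_natCast h1.le, ← rpow_add h1,
        show 1 / 2 * (l : ℝ) + γ = γ + l / 2 by ring]
    · rw [wgt_of_one_le hp, zero_mul]
      exact (lintegral_congr fun x => wgt_of_one_le (hp.trans (height_sq_le _ x))).trans
        lintegral_zero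
  refine ⟨ENNReal.ofReal √(1 + ‖a‖ ^ 2) *
    ∫⁻ x : Euc l, wgt γ (‖x‖ ^ 2 + aff (a, 0) (hom x) ^ 2), fun φ hφ => ?_⟩
  rw [Measure.volume_eq_prod, lintegral_prod _ (by fun_prop)]
  have h1 : ∀ x : Euc l, ∫⁻ z : ℝ, φ (height (a, z - inner ℝ a x)) * wgt γ (‖x‖ ^ 2 + z ^ 2) =
      ∫⁻ b : ℝ, φ (height (a, b)) * wgt γ (‖x‖ ^ 2 + aff (a, b) (hom x) ^ 2) := by
    intro x
    rw [← lintegral_add_right_eq_self _ (inner ℝ a x)]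
    refine lintegral_congr fun b => ?_
    simp [aff_apply, hom, add_comm]
  simp only [h1]
  rw [lintegral_lintegral_swap]
  · have h2 : ∀ b : ℝ, ∫⁻ x : Euc l, φ (height (a, b)) *
        wgt γ (‖x‖ ^ 2 + aff (a, b) (hom x) ^ 2) =
        φ (height (a, b)) * wgt (γ + l / 2) (height (a, b) ^ 2) *
          ∫⁻ x : Euc l, wgt γ (‖x‖ ^ 2 + aff (a, 0) (hom x) ^ 2) := by
      intro b
      rw [lintegral_const_mul, hslice, mul_assoc]
      simp only [aff_apply, hom]
      fun_prop
    simp only [h2]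
    rw [lintegral_mul_const _ (by fun_prop),
      lintegral_height a (f := fun t => φ t * wgt (γ + l / 2) (t ^ 2)) (by fun_prop)]
    ring
  · simp only [aff_apply, hom]
    fun_prop

/-- The mass of a half-space under a beta law. -/
theorem pairLaw_halfSpace {γ : ℝ} (hγ : -1 < γ) (p : Euc l × ℝ) :
    pairLaw γ l {y | aff p (hom y.1) ≤ y.2} = betaTail (γ + l / 2) (height p) := by
  obtain ⟨a, b⟩ := p
  obtain ⟨c, hc⟩ := exists_lintegral_height_sub γ a
  have hprob := isProbabilityMeasure_pairLaw hγ l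
  set κ := γ + (l : ℝ) / 2 with hκ
  have hκ1 : -1 < κ := by have : (0 : ℝ) ≤ l := by positivity
                          linarith
  set M := ∫⁻ x : Euc (l + 1), wgt γ (‖x‖ ^ 2) with hM
  set I := ∫⁻ t : ℝ, wgt κ (t ^ 2) with hI
  have hset : MeasurableSet {y : Euc l × ℝ | aff (a, b) (hom y.1) ≤ y.2} := by
    simp only [aff_apply, hom]
    exact measurableSet_le (by fun_prop) (by fun_prop)
  have h1 : M⁻¹ * (c * I) = 1 := by
    have := hprob.measure_univ
    rw [pairLaw, withDensity_apply _ MeasurableSet.univ, setLIntegral_univ,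
      lintegral_const_mul _ (by fun_prop)] at this
    rw [← this, ← hM, hI]
    congr 1
    simpa using (hc 1 measurable_one).symm
  have hmem : ∀ y : Euc l × ℝ, y ∈ {y : Euc l × ℝ | aff (a, b) (hom y.1) ≤ y.2} ↔
      height (a, y.2 - inner ℝ a y.1) ∈ Set.Ici (height (a, b)) := by
    intro y
    rw [Set.mem_Ici, height, height, div_le_div_iff_of_pos_right (by positivity),
      Set.mem_ofPred_eq, aff_apply]
    simp only [hom]
    constructor <;> intro h <;> linarith
  have h2 : pairLaw γ l {y | aff (a, b) (hom y.1) ≤ y.2} =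
      M⁻¹ * (c * ∫⁻ t in Set.Ici (height (a, b)), wgt κ (t ^ 2)) := by
    rw [pairLaw, withDensity_apply _ hset, lintegral_const_mul _ (by fun_prop),
      ← lintegral_indicator hset, ← lintegral_indicator measurableSet_Ici]
    congr 1
    have := hc ((Set.Ici (height (a, b))).indicator 1) (measurable_one.indicator measurableSet_Ici)
    refine (lintegral_congr fun y => ?_).trans
      (this.trans (congrArg _ (lintegral_congr fun t => ?_)))
    · by_cases hy : y ∈ {y : Euc l × ℝ | aff (a, b) (hom y.1) ≤ y.2}
      · rw [Set.indicator_of_mem hy, Set.indicator_of_mem ((hmem y).1 hy), Pi.one_apply, one_mul]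
      · rw [Set.indicator_of_notMem hy, Set.indicator_of_notMem (mt (hmem y).2 hy), zero_mul]
    · by_cases ht : t ∈ Set.Ici (height (a, b))
      · rw [Set.indicator_of_mem ht, Set.indicator_of_mem ht, Pi.one_apply, one_mul]
      · rw [Set.indicator_of_notMem ht, Set.indicator_of_notMem ht, zero_mul]
  rw [h2, betaTail, ← mul_assoc]
  congr 1
  have h0 : I ≠ 0 := lintegral_wgt_sq_ne_zero hκ1
  have hT : I ≠ ⊤ := lintegral_wgt_sq_ne_top hκ1
  rw [← mul_assoc] at h1
  exact ENNReal.eq_inv_of_mul_eq_one_left h1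

end BetaLaws

/-! ### Probabilities of simplicial pieces -/

section Pieces

variable {l : ℕ}

theorem smul_add_mem_unbddSet_iff {n k : ℕ} {e : Euc l} {s : ℝ} (hs : 0 < s) (x₀ : Euc l)
    (x : Fin n → Euc l) : (fun i => s • x i + x₀) ∈ unbddSet n k e ↔ x ∈ unbddSet n k e := by
  have key : ∀ (s : ℝ) (_ : 0 < s) (x₀ : Euc l) (x : Fin n → Euc l),
      (fun i => s • x i + x₀) ∈ unbddSet n k e → x ∈ unbddSet n k e := by
    rintro s hs x₀ x ⟨d, hd, hde⟩
    let S : Euc l × ℝ →ₗ[ℝ] Euc l × ℝ :=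
      (s • LinearMap.fst ℝ _ ℝ + (LinearMap.snd ℝ (Euc l) ℝ).smulRight x₀).prod
        (LinearMap.snd ℝ _ ℝ)
    have hS : ∀ x : Euc l, S (hom x) = hom (s • x + x₀) := fun x => by simp [S, hom]
    have hSe : S (e, 0) = s • (e, 0) := by simp [S]
    refine ⟨d.comp S, ?_, ?_⟩
    · simpa only [PrimalFeas, LinearMap.comp_apply, hS] using hd
    · rw [LinearMap.comp_apply, hSe, map_smul]
      exact mul_pos hs hde
  refine ⟨key s hs x₀ x, fun h => key s⁻¹ (inv_pos.2 hs) (-(s⁻¹ • x₀)) _ ?_⟩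
  convert h using 2 with i
  rw [smul_add, smul_smul, inv_mul_cancel₀ hs.ne', one_smul, add_neg_cancel_right]

/-- The chance that `N` beta points lie above a random hyperplane spanned by beta points. -/
theorem prod_pieceSet_mul {γ : ℝ} (hγ : -1 < γ) (N k : ℕ) (e : Euc l) :
    ((Measure.pi fun _ => pairLaw γ l).prod (Measure.pi fun _ => pairLaw γ l))
        (pieceSet (l + 1) N k e) *
      ∫⁻ h, wgt ((l : ℝ) * (l + 2) / 2 + γ * (l + 1)) (h ^ 2) =
    (Measure.pi fun _ => pairLaw γ l) {y | (fun i => (y i).1) ∉ unbddSet (l + 1) k e} *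
      ∫⁻ h, betaTail (γ + l / 2) h ^ N *
        wgt ((l : ℝ) * (l + 2) / 2 + γ * (l + 1)) (h ^ 2) := by
  have := isProbabilityMeasure_pairLaw hγ l
  obtain ⟨C, hC⟩ := exists_lintegral_interp_eq γ (measurableSet_unbddSet (l + 1) k e).compl
    fun s hs x₀ x => not_congr (smul_add_mem_unbddSet_iff hs x₀ x)
  set δ := (l : ℝ) * (l + 2) / 2 + γ * (l + 1)
  set A := (unbddSet (l + 1) k e)ᶜ
  set c := (∫⁻ x : Euc (l + 1), wgt γ (‖x‖ ^ 2))⁻¹ with hc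
  have hpi : ∀ f : (Fin (l + 1) → Euc l × ℝ) → ENNReal, Measurable f →
      ∫⁻ y, f y ∂(Measure.pi fun _ => pairLaw γ l) =
        c ^ (l + 1) * ∫⁻ y, f y * ∏ i, wgt γ (‖(y i).1‖ ^ 2 + (y i).2 ^ 2) := by
    intro f hf
    have : SigmaFinite ((volume : Measure (Euc l × ℝ)).withDensity
      fun y => c * wgt γ (‖y.1‖ ^ 2 + y.2 ^ 2)) := inferInstanceAs (SigmaFinite (pairLaw γ l))
    simp only [pairLaw]
    rw [pi_withDensity _ _ (by fun_prop), lintegral_withDensity_eq_lintegral_mul _ (by fun_prop) hf,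
      ← lintegral_const_mul _ (by fun_prop)]
    refine lintegral_congr fun y => ?_
    simp only [Pi.mul_apply, Finset.prod_mul_distrib, Finset.prod_const, Finset.card_univ,
      Fintype.card_fin]
    ring
  have hA : MeasurableSet {y : Fin (l + 1) → Euc l × ℝ | (fun i => (y i).1) ∈ A} :=
    (show Measurable fun y : Fin (l + 1) → Euc l × ℝ => fun i => (y i).1 by fun_prop)
      (measurableSet_unbddSet (l + 1) k e).compl
  have hAm : Measurable fun y : Fin (l + 1) → Euc l × ℝ =>
      A.indicator (1 : (Fin (l + 1) → Euc l) → ENNReal) (fun i => (y i).1) :=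
    (measurable_one.indicator (measurableSet_unbddSet (l + 1) k e).compl).comp (by fun_prop)
  let R : (Fin (l + 1) → Euc l × ℝ) → ENNReal := fun y =>
    (Measure.pi fun _ : Fin N => pairLaw γ l) (Prod.mk y ⁻¹' supportSet (l + 1) N)
  have hR : Measurable R := measurable_measure_prodMk_left (measurableSet_supportSet (l + 1) N)
  have hRg : ∀ (x : Fin (l + 1) → Euc l) p, LinearIndependent ℝ (fun i => hom (x i)) →
      R (fun i => (x i, aff p (hom (x i)))) = betaTail (γ + l / 2) (height p) ^ N := by
    intro x p hx
    have hset : Prod.mk (fun i => (x i, aff p (hom (x i)))) ⁻¹' supportSet (l + 1) N =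
        Set.univ.pi fun _ : Fin N => {y : Euc l × ℝ | aff p (hom y.1) ≤ y.2} := by
      ext z
      simp only [supportSet, Set.mem_preimage, Set.mem_ofPred_eq, Set.mem_univ_pi]
      refine ⟨?_, fun h => ⟨aff p, fun _ => rfl, h⟩⟩
      rintro ⟨d, hd, hz⟩ j
      have : d = aff p := LinearMap.ext_on_range
        (hx.span_eq_top_of_card_eq_finrank (by simp)) hd
      exact this ▸ hz j
    simp only [R]
    rw [hset, Measure.pi_pi]
    simp only [pairLaw_halfSpace hγ, Finset.prod_const, Finset.card_univ, Fintype.card_fin]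
  have h1 : ((Measure.pi fun _ => pairLaw γ l).prod (Measure.pi fun _ => pairLaw γ l))
      (pieceSet (l + 1) N k e) = c ^ (l + 1) *
        (C * ∫⁻ h, betaTail (γ + l / 2) h ^ N * wgt δ (h ^ 2)) := by
    rw [Measure.prod_apply (measurableSet_pieceSet _ _ _ _),
      ← hC _ (by fun_prop) R hR hRg,
      ← hpi (fun y => A.indicator 1 (fun i => (y i).1) * R y) (hAm.mul hR)]
    refine lintegral_congr fun y => ?_
    by_cases hy : (fun i => (y i).1) ∈ A
    · rw [Set.indicator_of_mem hy, Pi.one_apply, one_mul]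
      simp only [R]
      congr 1
      ext z
      exact ⟨fun h => h.2, fun h => ⟨hy, h⟩⟩
    · rw [Set.indicator_of_notMem hy, zero_mul]
      convert measure_empty (μ := Measure.pi fun _ : Fin N => pairLaw γ l)
      ext z
      exact ⟨fun h => hy h.1, fun h => h.elim⟩
  have h2 : (Measure.pi fun _ => pairLaw γ l) {y | (fun i => (y i).1) ∉ unbddSet (l + 1) k e} =
      c ^ (l + 1) * (C * ∫⁻ h, wgt δ (h ^ 2)) := by
    have h3 := hC 1 measurable_one 1 measurable_one fun _ _ _ => rfl
    simp only [Pi.one_apply, one_mul, mul_one] at h3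
    rw [← h3, ← hpi _ hAm]
    exact (lintegral_indicator_one hA).symm
  rw [h1, h2]
  ring

end Pieces

/-! ### Trigonometric substitution -/

section Trigonometric

theorem lintegral_wgt_eq_cos (q : ℕ) (g : ℝ → ENNReal) :
    ∫⁻ h, g h * wgt ((q : ℝ) - 1 / 2) (h ^ 2) =
      ∫⁻ t in Set.Ioo 0 π, ENNReal.ofReal (sin t ^ (2 * q)) * g (cos t) := by
  have himg : cos '' Set.Ioo 0 π = Set.Ioo (-1) 1 := by
    ext y
    constructor
    · rintro ⟨t, ht, rfl⟩
      exact ⟨by rw [← cos_pi]; exact cos_lt_cos_of_nonneg_of_le_pi ht.1.le le_rfl ht.2,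
        by rw [← cos_zero]; exact cos_lt_cos_of_nonneg_of_le_pi le_rfl ht.2.le ht.1⟩
    · intro hy
      exact ⟨arccos y, ⟨arccos_pos.2 hy.2, by
        rw [← arccos_neg_one]; exact arccos_lt_arccos le_rfl hy.1 hy.2.le⟩,
        cos_arccos hy.1.le hy.2.le⟩
  have h1 : ∫⁻ h, g h * wgt ((q : ℝ) - 1 / 2) (h ^ 2) =
      ∫⁻ h in cos '' Set.Ioo 0 π, g h * wgt ((q : ℝ) - 1 / 2) (h ^ 2) := by
    rw [himg, ← lintegral_indicator measurableSet_Ioo]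
    refine lintegral_congr fun h => ?_
    by_cases hh : h ∈ Set.Ioo (-1 : ℝ) 1
    · rw [Set.indicator_of_mem hh]
    · rw [Set.indicator_of_notMem hh, wgt_of_one_le, mul_zero]
      rw [one_le_sq_iff_one_le_abs, le_abs']
      by_contra! h'
      exact hh ⟨h'.1, h'.2⟩
  rw [h1, lintegral_image_eq_lintegral_abs_deriv_mul measurableSet_Ioo
    (fun t _ => (hasDerivAt_cos t).hasDerivWithinAt)
    (injOn_cos.mono Set.Ioo_subset_Icc_self)]
  refine setLIntegral_congr_fun measurableSet_Ioo fun t ht => ?_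
  have hs : 0 < sin t := sin_pos_of_mem_Ioo ht
  have hc : cos t ^ 2 < 1 := by nlinarith [sin_sq_add_cos_sq t]
  rw [abs_neg, abs_of_pos hs, wgt, if_pos hc, ← sin_sq, mul_left_comm, mul_comm (g _),
    ← ENNReal.ofReal_mul hs.le]
  congr 2
  rw [← rpow_natCast, ← rpow_natCast, ← rpow_mul hs.le]
  nth_rewrite 1 [← rpow_one (sin t)]
  rw [← rpow_add hs]
  congr 1
  push_cast
  ring

theorem lintegral_ofReal_Ioo {a b : ℝ} (hab : a ≤ b) {F : ℝ → ℝ} (hF : Continuous F)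
    (h0 : ∀ t ∈ Set.Ioo a b, 0 ≤ F t) :
    ∫⁻ t in Set.Ioo a b, ENNReal.ofReal (F t) = ENNReal.ofReal (∫ t in a..b, F t) := by
  rw [intervalIntegral.integral_of_le hab, integral_Ioc_eq_integral_Ioo,
    ofReal_integral_eq_lintegral_ofReal]
  · exact (hF.integrableOn_Icc (a := a) (b := b)).mono_set Set.Ioo_subset_Icc_self
  · exact (ae_restrict_iff' measurableSet_Ioo).2 (ae_of_all _ h0)

theorem lintegral_wgt_sq_eq_sin (q : ℕ) :
    ∫⁻ h : ℝ, wgt ((q : ℝ) - 1 / 2) (h ^ 2) = ENNReal.ofReal (∫ t in 0..π, sin t ^ (2 * q)) := by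
  have h := lintegral_wgt_eq_cos q 1
  simp only [Pi.one_apply, one_mul, mul_one] at h
  rw [h, lintegral_ofReal_Ioo pi_pos.le (by fun_prop)]
  exact fun t ht => pow_nonneg (sin_pos_of_mem_Ioo ht).le _

theorem betaTail_cos (p : ℕ) {t : ℝ} (ht : t ∈ Set.Ioo 0 π) :
    betaTail ((p : ℝ) - 1 / 2) (cos t) =
      ENNReal.ofReal ((∫ s in 0..t, sin s ^ (2 * p)) / ∫ s in 0..π, sin s ^ (2 * p)) := by
  have hpos : 0 < ∫ s in 0..π, sin s ^ (2 * p) := integral_sin_pow_pos _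
  have h1 : ∫⁻ h in Set.Ici (cos t), wgt ((p : ℝ) - 1 / 2) (h ^ 2) =
      ENNReal.ofReal (∫ s in 0..t, sin s ^ (2 * p)) := by
    rw [← lintegral_ofReal_Ioo ht.1.le (by fun_prop) fun s hs =>
      pow_nonneg (sin_pos_of_mem_Ioo ⟨hs.1, hs.2.trans ht.2⟩).le _,
      ← lintegral_indicator measurableSet_Ici]
    have h := lintegral_wgt_eq_cos p ((Set.Ici (cos t)).indicator 1)
    have e1 : ∀ h : ℝ, (Set.Ici (cos t)).indicator (fun h => wgt ((p : ℝ) - 1 / 2) (h ^ 2)) h =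
        (Set.Ici (cos t)).indicator 1 h * wgt ((p : ℝ) - 1 / 2) (h ^ 2) := fun h => by
      by_cases hh : h ∈ Set.Ici (cos t)
      · rw [Set.indicator_of_mem hh, Set.indicator_of_mem hh, Pi.one_apply, one_mul]
      · rw [Set.indicator_of_notMem hh, Set.indicator_of_notMem hh, zero_mul]
    simp only [e1]
    rw [h, setLIntegral_congr (Ioo_ae_eq_Ioc (a := 0) (b := t))]
    have e2 : ∀ s ∈ Set.Ioo 0 π, ENNReal.ofReal (sin s ^ (2 * p)) *
        (Set.Ici (cos t)).indicator 1 (cos s) =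
        (Set.Ioc 0 t).indicator (fun s => ENNReal.ofReal (sin s ^ (2 * p))) s := by
      intro s hs
      have : cos s ∈ Set.Ici (cos t) ↔ s ∈ Set.Ioc 0 t := by
        rw [Set.mem_Ici, strictAntiOn_cos.le_iff_ge ⟨ht.1.le, ht.2.le⟩ ⟨hs.1.le, hs.2.le⟩]
        exact ⟨fun h => ⟨hs.1, h⟩, fun h => h.2⟩
      by_cases hh : cos s ∈ Set.Ici (cos t)
      · rw [Set.indicator_of_mem hh, Set.indicator_of_mem (this.1 hh), Pi.one_apply, mul_one]
      · rw [Set.indicator_of_notMem hh, Set.indicator_of_notMem (mt this.2 hh), mul_zero]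
    rw [setLIntegral_congr_fun measurableSet_Ioo e2, setLIntegral_indicator measurableSet_Ioc,
      Set.inter_eq_left.2 (Set.Ioc_subset_Ioo_right ht.2)]
  rw [betaTail, h1, lintegral_wgt_sq_eq_sin, ← ENNReal.ofReal_inv_of_pos hpos,
    ← ENNReal.ofReal_mul (inv_nonneg.2 hpos.le), inv_mul_eq_div]

theorem betaTail_moment_mem_piSpan (p m N : ℕ) :
    ((∫⁻ h, betaTail ((p : ℝ) - 1 / 2) h ^ N * wgt (((p * m : ℕ) : ℝ) - 1 / 2) (h ^ 2)) /
      ∫⁻ h : ℝ, wgt (((p * m : ℕ) : ℝ) - 1 / 2) (h ^ 2)).toReal ∈ piSpan N := by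
  have hpos : 0 < ∫ s in 0..π, sin s ^ (2 * p) := integral_sin_pow_pos _
  have hpos' : 0 < ∫ s in 0..π, sin s ^ (2 * (p * m)) := integral_sin_pow_pos _
  have hcont : Continuous fun t => sin t ^ (2 * (p * m)) *
      ((∫ s in 0..t, sin s ^ (2 * p)) / ∫ s in 0..π, sin s ^ (2 * p)) ^ N := by
    have : Continuous fun t => ∫ s in 0..t, sin s ^ (2 * p) :=
      intervalIntegral.continuous_primitive
        (fun a b => (show Continuous fun s => sin s ^ (2 * p) by fun_prop).intervalIntegrable a b) 0
    fun_prop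
  have hnn : ∀ t ∈ Set.Ioo 0 π, 0 ≤ (∫ s in 0..t, sin s ^ (2 * p)) / ∫ s in 0..π, sin s ^ (2 * p) :=
    fun t ht => div_nonneg (intervalIntegral.integral_nonneg ht.1.le fun s hs =>
      pow_nonneg (sin_nonneg_of_nonneg_of_le_pi hs.1 (hs.2.trans ht.2.le)) _) hpos.le
  have h1 : ∫⁻ h, betaTail ((p : ℝ) - 1 / 2) h ^ N * wgt (((p * m : ℕ) : ℝ) - 1 / 2) (h ^ 2) =
      ENNReal.ofReal (∫ t in 0..π, sin t ^ (2 * (p * m)) *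
        ((∫ s in 0..t, sin s ^ (2 * p)) / ∫ s in 0..π, sin s ^ (2 * p)) ^ N) := by
    rw [lintegral_wgt_eq_cos (p * m) fun h => betaTail ((p : ℝ) - 1 / 2) h ^ N,
      ← lintegral_ofReal_Ioo pi_pos.le hcont]
    · refine setLIntegral_congr_fun measurableSet_Ioo fun t ht => ?_
      rw [betaTail_cos p ht, ← ENNReal.ofReal_pow (hnn t ht),
        ← ENNReal.ofReal_mul (pow_nonneg (sin_pos_of_mem_Ioo ht).le _)]
    · exact fun t ht => mul_nonneg (pow_nonneg (sin_pos_of_mem_Ioo ht).le _)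
        (pow_nonneg (hnn t ht) _)
  rw [h1, lintegral_wgt_sq_eq_sin, ← ENNReal.ofReal_div_of_pos hpos', ENNReal.toReal_ofReal]
  · exact integral_ratio_mem_piSpan p (p * m) N
  · refine div_nonneg (intervalIntegral.integral_nonneg_of_ae_restrict pi_pos.le ?_) hpos'.le
    rw [← restrict_Ioo_eq_restrict_Icc]
    refine (ae_restrict_iff' measurableSet_Ioo).2 (ae_of_all _ fun t ht => ?_)
    exact mul_nonneg (pow_nonneg (sin_pos_of_mem_Ioo ht).le _) (pow_nonneg (hnn t ht) _)

end Trigonometric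

/-! ### Probabilities of unbounded configurations -/

section UnboundedProbability

variable {l : ℕ}

theorem pi_lowerSet_eq_zero {n k : ℕ} (hk : l + 2 ≤ k) (hkn : k ≤ n)
    {μ : Measure (Euc l × ℝ)} [SigmaFinite μ] (hμ : NullHyperplanes μ) :
    (Measure.pi fun _ => μ) (lowerSet n k) = 0 := by
  rw [measure_eq_zero_iff_ae_notMem]
  filter_upwards [ae_linearIndepOn_lift hμ] with y hy
  rintro ⟨c, hc, -⟩
  obtain ⟨G, hG, hcard⟩ := Finset.exists_subset_card_eq (hk.trans_eq (card_firstK hkn).symm)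
  have hspan := span_eq_top_of_card (hy G hcard.le) (by simpa using hcard)
  let d : Module.Dual ℝ ((Euc l × ℝ) × ℝ) := c.comp (LinearMap.fst ℝ _ ℝ) - LinearMap.snd ℝ _ ℝ
  have hle : Submodule.span ℝ ((fun i => (hom (y i).1, (y i).2)) '' (G : Set (Fin n))) ≤
      LinearMap.ker d := by
    rw [Submodule.span_le]
    rintro _ ⟨i, hi, rfl⟩
    simpa [d, sub_eq_zero] using hc i (hG hi)
  rw [hspan] at hle
  have : d (0, 1) = 0 := hle (Submodule.mem_top : ((0, 1) : (Euc l × ℝ) × ℝ) ∈ ⊤)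
  simp [d] at this

/-- A fixed direction in each dimension. -/
def axisDir : (l : ℕ) → Euc l
  | 0 => 0
  | l + 1 => lastDir l

theorem axisDir_eq_zero : ∀ {l : ℕ}, axisDir l = 0 → l = 0
  | 0, _ => rfl
  | l + 1, h => by
    have h1 : splitLast l (axisDir (l + 1)) = (0, -1) := (splitLast l).apply_symm_apply _
    rw [h, map_zero] at h1
    simpa using congrArg Prod.snd h1

theorem pi_unbddSet_lastDir {n k : ℕ} {μ : Measure (Euc (l + 1))} {ν : Measure (Euc l × ℝ)}
    [SigmaFinite μ] [SigmaFinite ν] (h : MeasurePreserving (splitLast l) μ ν) :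
    (Measure.pi fun _ => μ) (unbddSet n k (lastDir l)) = (Measure.pi fun _ => ν) (lowerSet n k) := by
  rw [← (measurePreserving_pi _ _ fun _ : Fin n => h).measure_preimage
    (measurableSet_lowerSet n k).nullMeasurableSet]
  congr 1
  ext x
  exact mem_unbddSet_lastDir_iff x

theorem pi_unbddSet_fst {n k : ℕ} (e : Euc l) {μ : Measure (Euc l × ℝ)} {ν : Measure (Euc l)}
    [SigmaFinite μ] [SigmaFinite ν] (h : MeasurePreserving Prod.fst μ ν) :
    (Measure.pi fun _ => μ) {y | (fun i => (y i).1) ∈ unbddSet n k e} =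
      (Measure.pi fun _ => ν) (unbddSet n k e) :=
  (measurePreserving_pi _ _ fun _ : Fin n => h).measure_preimage
    (measurableSet_unbddSet n k e).nullMeasurableSet

theorem pi_notMem_unbddSet_fst {n k : ℕ} (e : Euc l) {μ : Measure (Euc l × ℝ)} {ν : Measure (Euc l)}
    [SigmaFinite μ] [IsProbabilityMeasure ν] (h : MeasurePreserving Prod.fst μ ν) :
    (Measure.pi fun _ => μ) {y | (fun i => (y i).1) ∉ unbddSet n k e} =
      1 - (Measure.pi fun _ => ν) (unbddSet n k e) := by
  rw [← prob_compl_eq_one_sub (measurableSet_unbddSet n k e)]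
  exact (measurePreserving_pi _ _ fun _ : Fin n => h).measure_preimage
    (measurableSet_unbddSet n k e).compl.nullMeasurableSet

theorem toReal_one_sub_mem_piSpan {r : ℕ} {a : ENNReal} (ha : a ≤ 1) (h : a.toReal ∈ piSpan r) :
    (1 - a).toReal ∈ piSpan r := by
  rw [ENNReal.toReal_sub_of_le ha ENNReal.one_ne_top, ENNReal.toReal_one]
  exact sub_mem (by simpa using ratCast_mem_piSpan 1 r) h

theorem pi_unbddSet_betaLaw_mem_piSpan (p : ℕ) : ∀ {l n k : ℕ} {γ : ℝ}, γ = p - (l : ℝ) / 2 →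
    -1 < γ → 1 ≤ k → k ≤ n → l < n →
    ((Measure.pi fun _ => betaLaw γ l) (unbddSet n k (axisDir l))).toReal ∈ piSpan (n - k)
  | 0, n, k, γ, _, _, _, _, _ => by
    have : unbddSet n k (axisDir 0) = ∅ := by
      refine Set.eq_empty_of_forall_notMem ?_
      rintro x ⟨d, -, hd⟩
      have h0 : d (0, 0) = 0 := map_zero d
      exact hd.ne' h0
    rw [this, measure_empty, ENNReal.toReal_zero]
    exact zero_mem _
  | l + 1, n, k, γ, hγ, h1, hk, hkn, hl => by
    have := isProbabilityMeasure_betaLaw h1 (l + 1)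
    have := isProbabilityMeasure_pairLaw h1 l
    have h1' : -1 < γ + 1 / 2 := by linarith
    have := isProbabilityMeasure_betaLaw h1' l
    have hγ' : γ + 1 / 2 = p - (l : ℝ) / 2 := by rw [hγ]; push_cast; ring
    rw [axisDir, pi_unbddSet_lastDir (measurePreserving_splitLast_betaLaw γ l)]
    rcases lt_or_ge (l + 1) k with hlk | hlk
    · rw [pi_lowerSet_eq_zero hlk hkn (nullHyperplanes_pairLaw γ l), ENNReal.toReal_zero]
      exact zero_mem _
    · obtain ⟨N, rfl⟩ := Nat.exists_eq_add_of_le hl.le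
      have ih := fun {n : ℕ} (hkn : k ≤ n) (hl : l < n) =>
        pi_unbddSet_betaLaw_mem_piSpan p hγ' h1' hk hkn hl
      have hpiece : ((((Measure.pi fun _ => pairLaw γ l).prod (Measure.pi fun _ => pairLaw γ l))
          (pieceSet (l + 1) N k (axisDir l)))).toReal ∈ piSpan (l + 1 + N - k) := by
        have hmul := prod_pieceSet_mul h1 N k (axisDir l)
        have e1 : (l : ℝ) * (l + 2) / 2 + γ * (l + 1) = ((p * (l + 1) : ℕ) : ℝ) - 1 / 2 := by
          rw [hγ]; push_cast; ring
        have e2 : γ + (l : ℝ) / 2 = p - 1 / 2 := by rw [hγ]; push_cast; ring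
        rw [e1, e2, pi_notMem_unbddSet_fst _ (measurePreserving_fst_pairLaw h1 l)] at hmul
        have hpos : (-1 : ℝ) < ((p * (l + 1) : ℕ) : ℝ) - 1 / 2 := by
          have : (0 : ℝ) ≤ ((p * (l + 1) : ℕ) : ℝ) := Nat.cast_nonneg _
          linarith
        rw [mul_comm, ← ENNReal.eq_div_iff (lintegral_wgt_sq_ne_zero hpos)
          (lintegral_wgt_sq_ne_top hpos), mul_div_assoc] at hmul
        rw [hmul, ENNReal.toReal_mul, show l + 1 + N - k = l + 1 - k + N by omega]
        exact mul_mem_piSpan (toReal_one_sub_mem_piSpan prob_le_one (ih hlk l.lt_succ_self))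
          (betaTail_moment_mem_piSpan p (l + 1) N)
      rw [pi_lowerSet hlk rfl (fun h => by have := axisDir_eq_zero h; omega) _
        (nullHyperplanes_pairLaw γ l), pi_unbddSet_fst _ (measurePreserving_fst_pairLaw h1 l),
        ENNReal.toReal_add (measure_ne_top _ _)
          (ENNReal.mul_ne_top (ENNReal.natCast_ne_top _) (measure_ne_top _ _)),
        ENNReal.toReal_mul, ENNReal.toReal_natCast]
      refine add_mem (ih hkn (by omega)) ?_
      exact_mod_cast ratCast_mul_mem (((l + 1 + N - k).choose (l + 1 - k) : ℕ) : ℚ) hpiece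

end UnboundedProbability

/-! ### Internal angles -/

section InternalAngles

theorem exists_add_smul_mem_convexHull_iff {m n k : ℕ} (hk : 1 ≤ k) (hkn : k ≤ n)
    (X : Fin n → Euc m) (u : Euc m) :
    (∃ ε : ℝ, 0 < ε ∧ (k : ℝ)⁻¹ • ∑ i ∈ Finset.univ.filter (fun i : Fin n => (i : ℕ) < k), X i +
      ε • u ∈ convexHull ℝ (Set.range X)) ↔ X ∉ unbddSet n k u := by
  change (∃ ε : ℝ, 0 < ε ∧ (k : ℝ)⁻¹ • ∑ i ∈ firstK n k, X i + ε • u ∈ _) ↔ _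
  have hk0 : (0 : ℝ) < k := by exact_mod_cast hk
  constructor
  · rintro ⟨ε, hε, hmem⟩ ⟨d, ⟨h1, h2⟩, hd⟩
    simp only [Pi.zero_apply] at h1 h2
    have hconv : Convex ℝ {x : Euc m | d (hom x) ≤ 0} := by
      intro x hx y hy a b ha hb hab
      have : hom (a • x + b • y) = a • hom x + b • hom y := by
        ext1 <;> simp [hom, hab]
      simp only [Set.mem_ofPred_eq] at hx hy ⊢
      rw [this, map_add, map_smul, map_smul, smul_eq_mul, smul_eq_mul]
      nlinarith
    have hle : d (hom _) ≤ 0 := convexHull_min (t := {x : Euc m | d (hom x) ≤ 0})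
      (by rintro _ ⟨i, rfl⟩; exact h2 i) hconv hmem
    have he : hom ((k : ℝ)⁻¹ • ∑ i ∈ firstK n k, X i + ε • u) =
        (k : ℝ)⁻¹ • ∑ i ∈ firstK n k, hom (X i) + ε • (u, (0 : ℝ)) := by
      ext1
      · simp [hom, Prod.fst_sum]
      · simp [hom, Prod.snd_sum, card_firstK hkn, hk0.ne']
    rw [he, map_add, map_smul, map_smul, map_sum, Finset.sum_eq_zero h1, smul_zero, zero_add,
      smul_eq_mul] at hle
    exact (mul_pos hε hd).not_ge hle
  · intro h
    obtain ⟨μ, -, hμ, hnn⟩ := (unboundedDir_or_dualFeas _ _ _).resolve_right h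
    have hμ1 : ∑ i, μ i • X i = u := by simpa [hom, Prod.fst_sum] using congrArg Prod.fst hμ
    have hμ2 : ∑ i, μ i = 0 := by simpa [hom, Prod.snd_sum] using congrArg Prod.snd hμ
    set M := 1 + ∑ i, |μ i| with hM
    have hle : ∀ i, |μ i| ≤ M := fun i => by
      have := Finset.single_le_sum (f := fun i => |μ i|) (fun i _ => abs_nonneg _) (Finset.mem_univ i)
      linarith
    have hM0 : 0 < M := by
      have : 0 ≤ ∑ i, |μ i| := Finset.sum_nonneg fun i _ => abs_nonneg _
      linarith
    set ε := (k : ℝ)⁻¹ * M⁻¹ with hε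
    have hε0 : 0 < ε := by positivity
    let w : Fin n → ℝ := fun i => (if i ∈ firstK n k then (k : ℝ)⁻¹ else 0) + ε * μ i
    have hw : ∑ i, w i • X i = (k : ℝ)⁻¹ • ∑ i ∈ firstK n k, X i + ε • u := by
      simp only [w, add_smul, Finset.sum_add_distrib, mul_smul, ← Finset.smul_sum, hμ1, ite_smul,
        zero_smul, Finset.sum_ite_mem, Finset.univ_inter]
    refine ⟨ε, hε0, ?_⟩
    rw [← hw]
    refine (convex_convexHull ℝ _).sum_mem (fun i _ => ?_) ?_
      fun i _ => subset_convexHull ℝ _ (Set.mem_range_self i)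
    · by_cases hi : i ∈ firstK n k
      · have h1 : ε * M = (k : ℝ)⁻¹ := by rw [hε]; field_simp
        have h2 := neg_le_of_abs_le (hle i)
        simp only [w, if_pos hi]
        nlinarith
      · simp only [w, if_neg hi, zero_add]
        exact mul_nonneg hε0.le (hnn i hi)
    · simp only [w, Finset.sum_add_distrib, ← Finset.mul_sum, hμ2, mul_zero, add_zero,
        Finset.sum_ite_mem, Finset.univ_inter, Finset.sum_const, card_firstK hkn, nsmul_eq_mul,
        mul_inv_cancel₀ hk0.ne']

theorem internalAngle_eq {m n k : ℕ} (hk : 1 ≤ k) (hkn : k ≤ n) (X : Fin n → Euc m) :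
    internalAngle ((k : ℝ)⁻¹ • ∑ i ∈ Finset.univ.filter (fun i : Fin n => (i : ℕ) < k), X i)
      (convexHull ℝ (Set.range X)) =
    (sphereUnif m {u | X ∉ unbddSet n k (u : Euc m)}).toReal := by
  rw [internalAngle]
  simp only [← exists_add_smul_mem_convexHull_iff hk hkn]

theorem isProbabilityMeasure_sphereUnif (l : ℕ) : IsProbabilityMeasure (sphereUnif (l + 1)) := by
  refine ⟨?_⟩
  rw [sphereUnif, Measure.smul_apply, smul_eq_mul]
  refine ENNReal.inv_mul_cancel ?_ (measure_ne_top _ _)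
  rw [Ne, Measure.measure_univ_eq_zero, Measure.toSphere_eq_zero_iff]
  exact not_subsingleton _

theorem unbddSet_map {m n k : ℕ} (R : Euc m ≃ₗᵢ[ℝ] Euc m) (x : Fin n → Euc m) (e : Euc m) :
    (fun i => R (x i)) ∈ unbddSet n k (R e) ↔ x ∈ unbddSet n k e := by
  have key : ∀ (R : Euc m ≃ₗᵢ[ℝ] Euc m) (x : Fin n → Euc m) (e : Euc m),
      (fun i => R (x i)) ∈ unbddSet n k (R e) → x ∈ unbddSet n k e := by
    rintro R x e ⟨d, hd, hde⟩
    exact ⟨d.comp (LinearMap.prodMap R.toLinearEquiv.toLinearMap LinearMap.id), hd, hde⟩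
  refine ⟨key R x e, fun h => key R.symm _ _ ?_⟩
  simpa using h

theorem pi_unbddSet_congr_dir {m n k : ℕ} {μ : Measure (Euc m)} [SigmaFinite μ]
    (hμ : ∀ R : Euc m ≃ₗᵢ[ℝ] Euc m, MeasurePreserving R μ μ) {e e' : Euc m} (he : ‖e‖ = ‖e'‖) :
    (Measure.pi fun _ => μ) (unbddSet n k e) = (Measure.pi fun _ => μ) (unbddSet n k e') := by
  obtain ⟨R, rfl⟩ : ∃ R : Euc m ≃ₗᵢ[ℝ] Euc m, R e = e' := ⟨_, Submodule.reflection_sub he⟩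
  rw [← (measurePreserving_pi _ _ fun _ : Fin n => hμ R).measure_preimage
    (measurableSet_unbddSet n k (R e)).nullMeasurableSet]
  congr 1
  ext x
  exact (unbddSet_map R x e).symm

theorem integral_internalAngle {l n k : ℕ} (hk : 1 ≤ k) (hkn : k ≤ n) {μ : Measure (Euc (l + 1))}
    [IsProbabilityMeasure μ] (hμ : ∀ R : Euc (l + 1) ≃ₗᵢ[ℝ] Euc (l + 1), MeasurePreserving R μ μ)
    {e : Euc (l + 1)} (he : ‖e‖ = 1) :
    ∫ X : Fin n → Euc (l + 1),
      internalAngle ((k : ℝ)⁻¹ • ∑ i ∈ Finset.univ.filter (fun i : Fin n => (i : ℕ) < k), X i)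
        (convexHull ℝ (Set.range X)) ∂(Measure.pi fun _ => μ) =
    (1 - (Measure.pi fun _ : Fin n => μ) (unbddSet n k e)).toReal := by
  have := isProbabilityMeasure_sphereUnif l
  let S : Set ((Fin n → Euc (l + 1)) × Metric.sphere (0 : Euc (l + 1)) 1) :=
    {q | q.1 ∉ unbddSet n k (q.2 : Euc (l + 1))}
  have hS : MeasurableSet S :=
    (show Measurable fun q : (Fin n → Euc (l + 1)) × Metric.sphere (0 : Euc (l + 1)) 1 =>
      (q.1, (q.2 : Euc (l + 1))) by fun_prop) (measurableSet_mem_unbddSet n k).compl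
  simp only [internalAngle_eq hk hkn]
  have h0 := integral_toReal (μ := Measure.pi fun _ : Fin n => μ)
    (measurable_measure_prodMk_left (ν := sphereUnif (l + 1)) hS).aemeasurable
    (ae_of_all _ fun _ => measure_lt_top _ _)
  refine h0.trans (congrArg ENNReal.toReal ?_)
  have h1 := Measure.prod_apply (μ := Measure.pi fun _ : Fin n => μ) (ν := sphereUnif (l + 1)) hS
  have h2 := Measure.prod_apply_symm (μ := Measure.pi fun _ : Fin n => μ)
    (ν := sphereUnif (l + 1)) hS
  refine (h1.symm.trans h2).trans ?_
  have h3 : ∀ u : Metric.sphere (0 : Euc (l + 1)) 1,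
      (Measure.pi fun _ : Fin n => μ) ((fun x => (x, u)) ⁻¹' S) =
      1 - (Measure.pi fun _ : Fin n => μ) (unbddSet n k e) := fun u => by
    rw [pi_unbddSet_congr_dir hμ (he.trans (norm_eq_of_mem_sphere u).symm),
      ← prob_compl_eq_one_sub (measurableSet_unbddSet n k _)]
    rfl
  simp only [h3, lintegral_const, measure_univ, mul_one]

theorem norm_lastDir (l : ℕ) : ‖lastDir l‖ = 1 := by
  have h := norm_sq_splitLast_symm l (0, -1)
  rw [norm_zero] at h
  norm_num at h
  exact h.resolve_right fun h' => by linarith [norm_nonneg ((splitLast l).symm (0, -1))]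

theorem measurePreserving_betaLaw (γ : ℝ) {l : ℕ} (R : Euc l ≃ₗᵢ[ℝ] Euc l) :
    MeasurePreserving R (betaLaw γ l) (betaLaw γ l) := by
  refine ⟨R.continuous.measurable, ?_⟩
  ext s hs
  rw [Measure.map_apply R.continuous.measurable hs, betaLaw, withDensity_apply _ hs,
    withDensity_apply _ (R.continuous.measurable hs),
    ← R.measurePreserving.setLIntegral_comp_preimage hs (by fun_prop)]
  simp only [LinearIsometryEquiv.norm_map]

theorem betaMeasure_eq_betaLaw {β : ℝ} (hβ : -1 < β) (d : ℕ) : betaMeasure d β = betaLaw β d := by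
  rw [betaMeasure, if_neg hβ.ne', betaLaw]
  congr 1
  ext x
  have h1 : 0 < Gamma (β + 1) := Gamma_pos_of_pos (by linarith)
  have h2 : 0 < Gamma ((d : ℝ) / 2 + β + 1) :=
    Gamma_pos_of_pos (by have : (0 : ℝ) ≤ d := d.cast_nonneg; linarith)
  have h3 : 0 < π ^ ((d : ℝ) / 2) := rpow_pos_of_pos pi_pos _
  rw [lintegral_wgt_norm_sq d hβ, ← ENNReal.ofReal_inv_of_pos (by positivity), betaDensity, inv_div,
    ENNReal.ofReal_mul (by positivity), wgt]
  simp only [sq_lt_one_iff₀ (norm_nonneg x)]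

end InternalAngles

/-! ### The uniform law on the sphere -/

section SphereLaw

variable {l : ℕ}

theorem isProbabilityMeasure_betaMeasure_neg_one (l : ℕ) :
    IsProbabilityMeasure (betaMeasure (l + 1) (-1)) := by
  have := isProbabilityMeasure_sphereUnif l
  rw [betaMeasure, if_pos rfl]
  exact Measure.isProbabilityMeasure_map measurable_subtype_coe.aemeasurable

theorem exists_betaMeasure_neg_one_apply (l : ℕ) : ∃ C : ENNReal, ∀ s : Set (Euc (l + 1)),
    MeasurableSet s → betaMeasure (l + 1) (-1) s =
      C * volume {x : Euc (l + 1) | ‖x‖ < 1 ∧ x ≠ 0 ∧ ‖x‖⁻¹ • x ∈ s} := by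
  refine ⟨((volume : Measure (Euc (l + 1))).toSphere Set.univ)⁻¹ *
    Module.finrank ℝ (Euc (l + 1)), fun s hs => ?_⟩
  rw [betaMeasure, if_pos rfl, Measure.map_apply measurable_subtype_coe hs, sphereUnif,
    Measure.smul_apply, smul_eq_mul, Measure.toSphere_apply' _ (measurable_subtype_coe hs),
    ← mul_assoc]
  congr 2
  ext x
  simp only [Set.mem_smul, Set.mem_Ioo, Set.mem_image, Set.mem_preimage, Subtype.exists,
    mem_sphere_zero_iff_norm, exists_and_right, exists_eq_right, Set.mem_ofPred_eq]
  constructor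
  · rintro ⟨r, ⟨h0, h1⟩, y, ⟨hy, hys⟩, rfl⟩
    have hn : ‖r • y‖ = r := by rw [norm_smul, hy, mul_one, norm_eq_abs, abs_of_pos h0]
    refine ⟨hn.trans_lt h1, fun h => ?_, ?_⟩
    · rw [h, norm_zero] at hn
      exact h0.ne hn
    · rwa [hn, smul_smul, inv_mul_cancel₀ h0.ne', one_smul]
  · rintro ⟨h1, h0, hs⟩
    have hx := norm_pos_iff.2 h0
    refine ⟨‖x‖, ⟨hx, h1⟩, ‖x‖⁻¹ • x, ⟨?_, hs⟩, ?_⟩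
    · rw [norm_smul, norm_inv, norm_norm, inv_mul_cancel₀ hx.ne']
    · rw [smul_smul, mul_inv_cancel₀ hx.ne', one_smul]

theorem measurePreserving_betaMeasure_neg_one (R : Euc (l + 1) ≃ₗᵢ[ℝ] Euc (l + 1)) :
    MeasurePreserving R (betaMeasure (l + 1) (-1)) (betaMeasure (l + 1) (-1)) := by
  obtain ⟨C, hC⟩ := exists_betaMeasure_neg_one_apply l
  refine ⟨R.continuous.measurable, ?_⟩
  ext s hs
  rw [Measure.map_apply R.continuous.measurable hs, hC _ hs, hC _ (R.continuous.measurable hs),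
    ← R.measurePreserving.measure_preimage_emb R.toHomeomorph.measurableEmbedding
      {x | ‖x‖ < 1 ∧ x ≠ 0 ∧ ‖x‖⁻¹ • x ∈ s}]
  congr 2
  ext x
  simp

/-- Radial stretching of the unit ball onto the whole space. -/
def stretch (c : ℝ) (w : Euc l) : Euc l := (c * (√(1 - ‖w‖ ^ 2))⁻¹) • w

theorem sq_norm_stretch_add {c : ℝ} {w : Euc l} (hw : ‖w‖ < 1) :
    ‖stretch c w‖ ^ 2 + c ^ 2 = (c * (√(1 - ‖w‖ ^ 2))⁻¹) ^ 2 := by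
  have h1 : 0 < 1 - ‖w‖ ^ 2 := by nlinarith [norm_nonneg w]
  have h2 := sq_sqrt h1.le
  have h3 := (sqrt_pos.2 h1).ne'
  rw [stretch, norm_smul, mul_pow, norm_eq_abs, sq_abs]
  field_simp
  rw [h2]
  ring

theorem inv_sqrt_smul_stretch {c : ℝ} (hc : 0 < c) {w : Euc l} (hw : ‖w‖ < 1) :
    (√(‖stretch c w‖ ^ 2 + c ^ 2))⁻¹ • stretch c w = w := by
  have h1 : 0 < 1 - ‖w‖ ^ 2 := by nlinarith [norm_nonneg w]
  have h2 : 0 < c * (√(1 - ‖w‖ ^ 2))⁻¹ := mul_pos hc (inv_pos.2 (sqrt_pos.2 h1))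
  rw [sq_norm_stretch_add hw, sqrt_sq h2.le, stretch, smul_smul, inv_mul_cancel₀ h2.ne', one_smul]

theorem stretch_image_ball {c : ℝ} (hc : 0 < c) :
    stretch c '' Metric.ball (0 : Euc l) 1 = Set.univ := by
  refine Set.eq_univ_of_forall fun z => ?_
  have h1 : 0 < ‖z‖ ^ 2 + c ^ 2 := by positivity
  have h2 := sq_sqrt h1.le
  have h3 := sqrt_pos.2 h1
  have h4 : ‖(√(‖z‖ ^ 2 + c ^ 2))⁻¹ • z‖ ^ 2 = ‖z‖ ^ 2 / (‖z‖ ^ 2 + c ^ 2) := by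
    rw [norm_smul, mul_pow, norm_inv, norm_eq_abs, inv_pow, sq_abs, h2, inv_mul_eq_div]
  refine ⟨(√(‖z‖ ^ 2 + c ^ 2))⁻¹ • z, ?_, ?_⟩
  · rw [mem_ball_zero_iff, ← sq_lt_one_iff₀ (norm_nonneg _), h4, div_lt_one h1]
    nlinarith
  · have h5 : 1 - ‖z‖ ^ 2 / (‖z‖ ^ 2 + c ^ 2) = (c / √(‖z‖ ^ 2 + c ^ 2)) ^ 2 := by
      rw [div_pow, h2]; field_simp; ring
    rw [stretch, h4, h5, sqrt_sq (by positivity), smul_smul, inv_div, mul_div_cancel₀ _ hc.ne',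
      mul_inv_cancel₀ h3.ne', one_smul]

theorem hasFDerivAt_stretch (c : ℝ) {w : Euc l} (hw : ‖w‖ < 1) :
    HasFDerivAt (stretch c) ((c * (√(1 - ‖w‖ ^ 2))⁻¹) • (ContinuousLinearMap.id ℝ (Euc l) +
      ((√(1 - ‖w‖ ^ 2))⁻¹ ^ 2 • innerSL ℝ w).smulRight w)) w := by
  have h1 : 0 < 1 - ‖w‖ ^ 2 := by nlinarith [norm_nonneg w]
  have hsq : HasFDerivAt (fun x : Euc l => ‖x‖ ^ 2) (2 • innerSL ℝ w) w :=
    (hasStrictFDerivAt_norm_sq w).hasFDerivAt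
  have hφ : HasDerivAt (fun r : ℝ => c * (√(1 - r))⁻¹) _ (‖w‖ ^ 2) :=
    ((((hasDerivAt_id (‖w‖ ^ 2)).const_sub 1).sqrt h1.ne').inv (sqrt_pos.2 h1).ne').const_mul c
  have h := (hφ.comp_hasFDerivAt w hsq).smul (hasFDerivAt_id w)
  refine h.congr_fderiv ?_
  ext x i
  simp
  field_simp

theorem det_fderiv_stretch (c : ℝ) {w : Euc l} (hw : ‖w‖ < 1) :
    ((c * (√(1 - ‖w‖ ^ 2))⁻¹) • (ContinuousLinearMap.id ℝ (Euc l) +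
      ((√(1 - ‖w‖ ^ 2))⁻¹ ^ 2 • innerSL ℝ w).smulRight w)).det =
    (c * (√(1 - ‖w‖ ^ 2))⁻¹) ^ l * (√(1 - ‖w‖ ^ 2))⁻¹ ^ 2 := by
  have h1 : 0 < 1 - ‖w‖ ^ 2 := by nlinarith [norm_nonneg w]
  have h2 := sq_sqrt h1.le
  have h3 := (sqrt_pos.2 h1).ne'
  have h := LinearMap.transvection.det (((√(1 - ‖w‖ ^ 2))⁻¹ ^ 2 • innerSL ℝ w : Euc l →L[ℝ] ℝ) :
    Module.Dual ℝ (Euc l)) w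
  have e : (((c * (√(1 - ‖w‖ ^ 2))⁻¹) • (ContinuousLinearMap.id ℝ (Euc l) +
      ((√(1 - ‖w‖ ^ 2))⁻¹ ^ 2 • innerSL ℝ w).smulRight w) : Euc l →L[ℝ] Euc l) :
        Euc l →ₗ[ℝ] Euc l) = (c * (√(1 - ‖w‖ ^ 2))⁻¹) • LinearMap.transvection
        (((√(1 - ‖w‖ ^ 2))⁻¹ ^ 2 • innerSL ℝ w : Euc l →L[ℝ] ℝ) : Module.Dual ℝ (Euc l)) w := by
    ext x
    simp [LinearMap.transvection.apply]
  rw [ContinuousLinearMap.det, e, LinearMap.det_smul, h, finrank_euclideanSpace_fin]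
  congr 1
  simp
  field_simp
  rw [h2]
  ring

theorem lintegral_stretch {c : ℝ} (hc : 0 < c) (F : Euc l → ENNReal) :
    ∫⁻ z, F z = ∫⁻ w in Metric.ball (0 : Euc l) 1,
      ENNReal.ofReal ((c * (√(1 - ‖w‖ ^ 2))⁻¹) ^ l * (√(1 - ‖w‖ ^ 2))⁻¹ ^ 2) * F (stretch c w) := by
  have hinj : Set.InjOn (stretch c) (Metric.ball (0 : Euc l) 1) :=
    Set.LeftInvOn.injOn (f₁' := fun z => (√(‖z‖ ^ 2 + c ^ 2))⁻¹ • z) fun w hw =>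
      inv_sqrt_smul_stretch hc (mem_ball_zero_iff.1 hw)
  rw [← setLIntegral_univ, ← stretch_image_ball hc,
    lintegral_image_eq_lintegral_abs_det_fderiv_mul volume Metric.isOpen_ball.measurableSet
      (fun w hw => (hasFDerivAt_stretch c (mem_ball_zero_iff.1 hw)).hasFDerivWithinAt) hinj]
  refine setLIntegral_congr_fun Metric.isOpen_ball.measurableSet fun w hw => ?_
  have hw := mem_ball_zero_iff.1 hw
  rw [det_fderiv_stretch c hw, abs_of_nonneg (by positivity)]

theorem volume_cone_slice {A : Set (Euc l)} (hA : MeasurableSet A) {t : ℝ} (ht : t ≠ 0) :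
    volume {z : Euc l | ‖z‖ ^ 2 + t ^ 2 < 1 ∧ (√(‖z‖ ^ 2 + t ^ 2))⁻¹ • z ∈ A} =
      ∫⁻ w in Metric.ball (0 : Euc l) 1, A.indicator 1 w *
        (ENNReal.ofReal ((|t| * (√(1 - ‖w‖ ^ 2))⁻¹) ^ l * (√(1 - ‖w‖ ^ 2))⁻¹ ^ 2) *
          (Set.Iio 1).indicator 1 ((|t| * (√(1 - ‖w‖ ^ 2))⁻¹) ^ 2)) := by
  have hS : MeasurableSet {z : Euc l | ‖z‖ ^ 2 + t ^ 2 < 1 ∧ (√(‖z‖ ^ 2 + t ^ 2))⁻¹ • z ∈ A} :=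
    (measurableSet_lt (f := fun z : Euc l => ‖z‖ ^ 2 + t ^ 2) (by fun_prop)
      measurable_const).inter
      ((show Measurable fun z : Euc l => (√(‖z‖ ^ 2 + t ^ 2))⁻¹ • z by fun_prop) hA)
  rw [← lintegral_indicator_one hS, lintegral_stretch (abs_pos.2 ht)]
  refine setLIntegral_congr_fun Metric.isOpen_ball.measurableSet fun w hw => ?_
  have hw := mem_ball_zero_iff.1 hw
  have hmem : stretch |t| w ∈ {z : Euc l | ‖z‖ ^ 2 + t ^ 2 < 1 ∧
      (√(‖z‖ ^ 2 + t ^ 2))⁻¹ • z ∈ A} ↔ (|t| * (√(1 - ‖w‖ ^ 2))⁻¹) ^ 2 ∈ Set.Iio 1 ∧ w ∈ A := by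
    rw [Set.mem_ofPred_eq, ← sq_abs t, inv_sqrt_smul_stretch (abs_pos.2 ht) hw,
      sq_norm_stretch_add hw, Set.mem_Iio]
  rw [mul_left_comm]
  congr 1
  by_cases h1 : (|t| * (√(1 - ‖w‖ ^ 2))⁻¹) ^ 2 ∈ Set.Iio 1
  · rw [Set.indicator_of_mem h1]
    by_cases h2 : w ∈ A
    · rw [Set.indicator_of_mem (hmem.2 ⟨h1, h2⟩), Set.indicator_of_mem h2]; simp
    · rw [Set.indicator_of_notMem fun h => h2 (hmem.1 h).2, Set.indicator_of_notMem h2]; simp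
  · rw [Set.indicator_of_notMem h1, Set.indicator_of_notMem fun h => h1 (hmem.1 h).1]; simp

theorem betaMeasure_neg_one_fst (l : ℕ) :
    ∃ C : ENNReal, ∀ A : Set (Euc l), MeasurableSet A →
      betaMeasure (l + 1) (-1) {x | (splitLast l x).1 ∈ A} =
        C * ∫⁻ w in A, wgt (-1 / 2) (‖w‖ ^ 2) := by
  obtain ⟨C, hC⟩ := exists_betaMeasure_neg_one_apply l
  let ψ : Euc l → ℝ → ENNReal := fun w t =>
    ENNReal.ofReal ((|t| * (√(1 - ‖w‖ ^ 2))⁻¹) ^ l * (√(1 - ‖w‖ ^ 2))⁻¹ ^ 2) *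
      (Set.Iio 1).indicator 1 ((|t| * (√(1 - ‖w‖ ^ 2))⁻¹) ^ 2)
  let K : ENNReal := ∫⁻ t : ℝ, ENNReal.ofReal (|t| ^ l) * (Set.Iio 1).indicator 1 (|t| ^ 2)
  have hm1 : Measurable ((Set.Iio (1 : ℝ)).indicator (1 : ℝ → ENNReal)) :=
    measurable_one.indicator measurableSet_Iio
  have hK : ∀ w ∈ Metric.ball (0 : Euc l) 1, ∫⁻ t, ψ w t = K * wgt (-1 / 2) (‖w‖ ^ 2) := by
    intro w hw
    have hw := mem_ball_zero_iff.1 hw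
    have h1 : 0 < 1 - ‖w‖ ^ 2 := by nlinarith [norm_nonneg w]
    have h2 := sqrt_pos.2 h1
    have hdet : LinearMap.det (√(1 - ‖w‖ ^ 2) • (LinearMap.id : ℝ →ₗ[ℝ] ℝ)) = √(1 - ‖w‖ ^ 2) := by
      rw [LinearMap.det_smul, LinearMap.det_id]; simp
    rw [lintegral_comp_affine volume (T := √(1 - ‖w‖ ^ 2) • (LinearMap.id : ℝ →ₗ[ℝ] ℝ))
      (by rw [hdet]; exact h2.ne') 0 (by fun_prop), hdet, abs_of_pos h2]
    have e : ∀ t, ψ w ((√(1 - ‖w‖ ^ 2) • (LinearMap.id : ℝ →ₗ[ℝ] ℝ)) t + 0) =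
        ENNReal.ofReal ((√(1 - ‖w‖ ^ 2))⁻¹ ^ 2) *
          (ENNReal.ofReal (|t| ^ l) * (Set.Iio 1).indicator 1 (|t| ^ 2)) := by
      intro t
      have : |(√(1 - ‖w‖ ^ 2) • (LinearMap.id : ℝ →ₗ[ℝ] ℝ)) t + 0| * (√(1 - ‖w‖ ^ 2))⁻¹ = |t| := by
        simp only [LinearMap.smul_apply, LinearMap.id_apply, smul_eq_mul, add_zero, abs_mul,
          abs_of_pos h2]
        field_simp
      simp only [ψ, this]
      rw [ENNReal.ofReal_mul (by positivity)]
      ring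
    simp only [e]
    rw [lintegral_const_mul _ (by fun_prop), ← mul_assoc, ← ENNReal.ofReal_mul h2.le, mul_comm]
    congr 1
    rw [wgt, if_pos (by linarith), neg_div, rpow_neg h1.le, ← sqrt_eq_rpow]
    congr 1
    field_simp
  refine ⟨C * K, fun A hA => ?_⟩
  have hmA : Measurable (A.indicator (1 : Euc l → ENNReal)) := measurable_one.indicator hA
  have hset : MeasurableSet {x : Euc (l + 1) | (splitLast l x).1 ∈ A} :=
    ((continuous_splitLast l).measurable.fst) hA
  let S : Set (Euc l × ℝ) := {y | ‖y.1‖ ^ 2 + y.2 ^ 2 < 1 ∧ y ≠ 0 ∧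
    (√(‖y.1‖ ^ 2 + y.2 ^ 2))⁻¹ • y.1 ∈ A}
  have hS : MeasurableSet S := by
    refine MeasurableSet.inter ?_ (MeasurableSet.inter ?_ ?_)
    · exact measurableSet_lt (f := fun y : Euc l × ℝ => ‖y.1‖ ^ 2 + y.2 ^ 2) (by fun_prop)
        measurable_const
    · exact (measurableSet_singleton 0).compl
    · exact (show Measurable fun y : Euc l × ℝ => (√(‖y.1‖ ^ 2 + y.2 ^ 2))⁻¹ • y.1 by fun_prop) hA
  have hpre : {x : Euc (l + 1) | ‖x‖ < 1 ∧ x ≠ 0 ∧ ‖x‖⁻¹ • x ∈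
      {x : Euc (l + 1) | (splitLast l x).1 ∈ A}} = splitLast l ⁻¹' S := by
    ext x
    simp only [S, Set.mem_ofPred_eq, Set.mem_preimage, ← norm_sq_eq_splitLast,
      sqrt_sq (norm_nonneg x), sq_lt_one_iff₀ (norm_nonneg x), map_smul, Prod.smul_fst, ne_eq,
      LinearEquiv.map_eq_zero_iff]
  have hslice : ∀ᵐ t : ℝ, volume ((fun z : Euc l => (z, t)) ⁻¹' S) =
      ∫⁻ w in Metric.ball (0 : Euc l) 1, A.indicator 1 w * ψ w t := by
    filter_upwards [compl_mem_ae_iff.2 (measure_singleton (0 : ℝ))] with t ht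
    have ht : t ≠ 0 := ht
    rw [← volume_cone_slice hA ht]
    congr 1
    ext z
    simp [S, ht]
  rw [hC _ hset, hpre, (measurePreserving_splitLast l).measure_preimage hS.nullMeasurableSet,
    Measure.volume_eq_prod, Measure.prod_apply_symm hS, lintegral_congr_ae hslice,
    lintegral_lintegral_swap (by fun_prop), mul_assoc]
  congr 1
  rw [← lintegral_const_mul _ (by fun_prop), ← lintegral_indicator hA,
    ← lintegral_indicator Metric.isOpen_ball.measurableSet]
  refine lintegral_congr fun w => ?_
  by_cases hw : w ∈ Metric.ball (0 : Euc l) 1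
  · rw [Set.indicator_of_mem hw, lintegral_const_mul _ (by fun_prop), hK w hw]
    by_cases hwA : w ∈ A
    · rw [Set.indicator_of_mem hwA, Set.indicator_of_mem hwA, Pi.one_apply, one_mul]
    · rw [Set.indicator_of_notMem hwA, Set.indicator_of_notMem hwA, zero_mul]
  · have hw1 : 1 ≤ ‖w‖ := by simpa using hw
    rw [Set.indicator_of_notMem hw]
    by_cases hwA : w ∈ A
    · rw [Set.indicator_of_mem hwA, wgt_of_one_le (by nlinarith), mul_zero]
    · rw [Set.indicator_of_notMem hwA]

/-- The split coordinates of a uniform point on the sphere. -/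
def spherePairLaw (l : ℕ) : Measure (Euc l × ℝ) := (betaMeasure (l + 1) (-1)).map (splitLast l)

theorem measurePreserving_splitLast_sphere (l : ℕ) :
    MeasurePreserving (splitLast l) (betaMeasure (l + 1) (-1)) (spherePairLaw l) :=
  ⟨(continuous_splitLast l).measurable, rfl⟩

theorem isProbabilityMeasure_spherePairLaw (l : ℕ) : IsProbabilityMeasure (spherePairLaw l) := by
  have := isProbabilityMeasure_betaMeasure_neg_one l
  exact Measure.isProbabilityMeasure_map (continuous_splitLast l).measurable.aemeasurable

theorem measurePreserving_fst_spherePairLaw (l : ℕ) :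
    MeasurePreserving Prod.fst (spherePairLaw l) (betaLaw (-1 / 2) l) := by
  have := isProbabilityMeasure_betaMeasure_neg_one l
  obtain ⟨C, hC⟩ := betaMeasure_neg_one_fst l
  have h1 : (1 : ENNReal) = C * ∫⁻ w : Euc l, wgt (-1 / 2) (‖w‖ ^ 2) := by
    rw [← setLIntegral_univ, ← hC _ MeasurableSet.univ]
    simp
  refine ⟨measurable_fst, ?_⟩
  ext A hA
  rw [Measure.map_apply measurable_fst hA, (measurePreserving_splitLast_sphere l).measure_preimage
    (measurable_fst hA).nullMeasurableSet |>.symm]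
  refine (hC A hA).trans ?_
  rw [betaLaw, withDensity_apply _ hA, lintegral_const_mul _ (by fun_prop),
    ENNReal.eq_inv_of_mul_eq_one_left h1.symm]

theorem measurePreserving_neg_spherePairLaw (l : ℕ) :
    MeasurePreserving (fun y : Euc l × ℝ => (y.1, -y.2)) (spherePairLaw l) (spherePairLaw l) := by
  let R : Euc (l + 1) ≃ₗᵢ[ℝ] Euc (l + 1) :=
    ⟨((splitLast l).trans ((LinearEquiv.refl ℝ (Euc l)).prodCongr (LinearEquiv.neg ℝ))).trans
      (splitLast l).symm, fun x => by
        rw [← sq_eq_sq₀ (norm_nonneg _) (norm_nonneg _)]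
        simp [norm_sq_eq_splitLast]⟩
  have hm : Measurable fun y : Euc l × ℝ => (y.1, -y.2) := by fun_prop
  have hs := (continuous_splitLast l).measurable
  have hR : (fun y : Euc l × ℝ => (y.1, -y.2)) ∘ splitLast l = splitLast l ∘ R := by
    ext x <;> simp [R]
  refine ⟨hm, ?_⟩
  rw [spherePairLaw, Measure.map_map hm hs, hR, ← Measure.map_map hs R.continuous.measurable,
    (measurePreserving_betaMeasure_neg_one R).map_eq]

theorem inner_splitLast_symm (z : Euc l) (x : Euc (l + 1)) :
    inner ℝ ((splitLast l).symm (z, 0)) x = inner ℝ z (splitLast l x).1 := by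
  have h : splitIso l ((splitLast l).symm (z, 0)) = WithLp.toLp 2 (z, 0) :=
    (splitIso l).apply_symm_apply _
  rw [← (splitIso l).inner_map_map, h, WithLp.prod_inner_apply]
  simp [splitLast]

theorem nullHyperplanes_spherePairLaw (hl : 1 ≤ l) : NullHyperplanes (spherePairLaw l) := by
  intro φ hφ
  let L : Module.Dual ℝ (Euc (l + 1)) := φ.comp ((LinearMap.prodMap (LinearMap.inl ℝ (Euc l) ℝ)
    LinearMap.id).comp (splitLast l).toLinearMap)
  set b : ℝ := φ ((0, 1), 0)
  have hL : ∀ x, φ (hom (splitLast l x).1, (splitLast l x).2) = L x + b := fun x => by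
    simp only [L, b, LinearMap.comp_apply, ← map_add]
    simp [hom]
  have hnz : L = 0 → b ≠ 0 := by
    intro h0 hb
    refine hφ (LinearMap.ext fun y => ?_)
    have h1 : L ((splitLast l).symm (y.1.1, y.2)) = 0 := by rw [h0, LinearMap.zero_apply]
    have h2 : y = ((y.1.1, 0), y.2) + y.1.2 • ((0, 1), 0) := by ext <;> simp
    rw [h2, map_add, map_smul]
    change φ ((y.1.1, 0), y.2) + y.1.2 • b = 0
    rw [hb, smul_zero, add_zero]
    simpa [L] using h1
  obtain ⟨a, ha⟩ : ∃ a : Euc (l + 1), ∀ x, L x = inner ℝ a x :=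
    ⟨(InnerProductSpace.toDual ℝ (Euc (l + 1))).symm (LinearMap.toContinuousLinearMap L), fun x => by
      rw [InnerProductSpace.toDual_symm_apply]; rfl⟩
  have hmeas : ∀ a : Euc (l + 1), MeasurableSet {x : Euc (l + 1) | inner ℝ a x + b = 0} := fun a =>
    (isClosed_eq (by fun_prop) continuous_const).measurableSet
  have : Nontrivial (Euc l) := by
    have : Nonempty (Fin l) := ⟨⟨0, hl⟩⟩
    infer_instance
  obtain ⟨z, hz⟩ := exists_norm_eq (Euc l) (norm_nonneg a)
  let a' : Euc (l + 1) := (splitLast l).symm (z, 0)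
  have hnorm : ‖a‖ = ‖a'‖ := by
    rw [← sq_eq_sq₀ (norm_nonneg _) (norm_nonneg _), norm_sq_splitLast_symm]
    simp [hz]
  have hz0 : innerSL ℝ z = 0 → b ≠ 0 := fun h => hnz <| by
    have h1 : z = 0 := norm_eq_zero.1 (by rw [← innerSL_apply_norm ℝ z, h, norm_zero])
    have h2 : a = 0 := norm_eq_zero.1 (by rw [← hz, h1, norm_zero])
    ext x
    rw [ha, h2, inner_zero_left, LinearMap.zero_apply]
  let R : Euc (l + 1) ≃ₗᵢ[ℝ] Euc (l + 1) := (ℝ ∙ (a - a'))ᗮ.reflection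
  have hR : {x | L x + b = 0} = R ⁻¹' {x | inner ℝ a' x + b = 0} := by
    ext x
    have : inner ℝ a' (R x) = inner ℝ a x := by
      rw [← Submodule.reflection_sub hnorm]
      exact R.inner_map_map a x
    simp only [Set.mem_preimage, Set.mem_ofPred_eq, this, ha]
  have hset : {x | inner ℝ a' x + b = 0} =
      splitLast l ⁻¹' (Prod.fst ⁻¹' {w : Euc l | inner ℝ z w + b = 0}) := by
    ext x
    simp only [Set.mem_preimage, Set.mem_ofPred_eq, a', inner_splitLast_symm]
  have hmz : MeasurableSet {w : Euc l | inner ℝ z w + b = 0} :=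
    (isClosed_eq (by fun_prop) continuous_const).measurableSet
  have hmφ : MeasurableSet {y : Euc l × ℝ | φ (hom y.1, y.2) = 0} := by
    have := φ.continuous_of_finiteDimensional
    exact (isClosed_eq (this.comp (by unfold hom; fun_prop)) continuous_const).measurableSet
  rw [← (measurePreserving_splitLast_sphere l).measure_preimage hmφ.nullMeasurableSet]
  have : splitLast l ⁻¹' {y : Euc l × ℝ | φ (hom y.1, y.2) = 0} = {x | L x + b = 0} := by
    ext x
    simp only [Set.mem_preimage, Set.mem_ofPred_eq, hL]
  rw [this, hR, (measurePreserving_betaMeasure_neg_one R).measure_preimage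
    (hmeas a').nullMeasurableSet, hset, (measurePreserving_splitLast_sphere l).measure_preimage
    (measurable_fst hmz).nullMeasurableSet, (measurePreserving_fst_spherePairLaw l).measure_preimage
    hmz.nullMeasurableSet]
  exact withDensity_absolutelyContinuous _ _ (addHaar_affine_eq_zero _
    (innerSL ℝ z).toLinearMap b fun h => hz0 (ContinuousLinearMap.coe_injective h))

end SphereLaw

/-! ### Expected angles -/

section ExpectedAngles

theorem pi_unbddSet_sphere_mem_piSpan {p l k : ℕ} (hl : l = 2 * p + 1) (hk : 1 ≤ k)
    (hkl : k ≤ l + 2) :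
    ((Measure.pi fun _ => betaMeasure (l + 1) (-1))
      (unbddSet (l + 2) k (axisDir (l + 1)))).toReal ∈ piSpan (l + 2 - k) := by
  have := isProbabilityMeasure_betaMeasure_neg_one l
  have := isProbabilityMeasure_spherePairLaw l
  have := isProbabilityMeasure_betaLaw (γ := -1 / 2) (by norm_num) l
  have hμ := nullHyperplanes_spherePairLaw (l := l) (by omega)
  have hfst := measurePreserving_fst_spherePairLaw l
  rw [show axisDir (l + 1) = lastDir l from rfl,
    pi_unbddSet_lastDir (measurePreserving_splitLast_sphere l)]
  rcases hkl.eq_or_lt with rfl | hlt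
  · rw [pi_lowerSet_eq_zero le_rfl le_rfl hμ, ENNReal.toReal_zero]
    exact zero_mem _
  have hkl' : k ≤ l + 1 := by omega
  have hγ : (-1 / 2 : ℝ) = p - (l : ℝ) / 2 := by rw [hl]; push_cast; ring
  have h1 := pi_unbddSet_betaLaw_mem_piSpan p hγ (by norm_num) hk hkl (by omega)
  have h2 := toReal_one_sub_mem_piSpan prob_le_one
    (pi_unbddSet_betaLaw_mem_piSpan p hγ (by norm_num) hk hkl' (by omega))
  have hpiece := two_mul_measure_pieceSet_one k (axisDir l) hμ (measurePreserving_neg_spherePairLaw l)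
  rw [pi_notMem_unbddSet_fst _ hfst] at hpiece
  have hpiece' := congrArg ENNReal.toReal hpiece
  rw [ENNReal.toReal_mul, ENNReal.toReal_ofNat] at hpiece'
  rw [pi_lowerSet hkl' (N := 1) rfl (e := axisDir l)
      (fun h => absurd (axisDir_eq_zero h) (by omega)) _ hμ, pi_unbddSet_fst _ hfst,
    ENNReal.toReal_add (by finiteness) (by finiteness), ENNReal.toReal_mul, ENNReal.toReal_natCast]
  refine add_mem h1 ?_
  have h3 := ratCast_mul_mem (((l + 2 - k).choose (l + 1 - k) : ℚ) / 2)
    (piSpan_mono (by omega : l + 1 - k ≤ l + 2 - k) h2)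
  rw [← hpiece'] at h3
  convert h3 using 1
  push_cast
  ring

theorem J_eq {l n k : ℕ} (hn : n = l + 2) (hk : 1 ≤ k) (hkn : k ≤ n) {β : ℝ}
    [IsProbabilityMeasure (betaMeasure (l + 1) β)]
    (hR : ∀ R : Euc (l + 1) ≃ₗᵢ[ℝ] Euc (l + 1),
      MeasurePreserving R (betaMeasure (l + 1) β) (betaMeasure (l + 1) β)) :
    J n k β = (1 - (Measure.pi fun _ : Fin n => betaMeasure (l + 1) β)
      (unbddSet n k (axisDir (l + 1)))).toReal := by
  subst hn
  exact integral_internalAngle hk hkn hR (norm_lastDir l)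

theorem J_one (k : ℕ) (β : ℝ) : J 1 k β = 0 := by
  have h : ∀ (g : Euc 0) (P : Set (Euc 0)), internalAngle g P = 0 := fun g P => by
    have : IsEmpty (Metric.sphere (0 : Euc 0) 1) := ⟨fun u => by
      have h1 := mem_sphere_zero_iff_norm.1 u.2
      rw [Subsingleton.elim (u : Euc 0) 0, norm_zero] at h1
      exact zero_ne_one h1⟩
    rw [internalAngle, Set.eq_empty_of_isEmpty {u : Metric.sphere (0 : Euc 0) 1 | _}, measure_empty,
      ENNReal.toReal_zero]
  rw [J]
  exact (integral_congr_ae (Filter.Eventually.of_forall fun X => h _ _)).trans (integral_zero _ _)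

theorem J_mem_piSpan {β : ℝ} (hβ : -1 ≤ β) {n k : ℕ} (hk1 : 1 ≤ k) (hk2 : k ≤ n)
    (hodd : ∃ m : ℤ, 2 * β + n = 2 * (m : ℝ) + 1) : J n k β ∈ piSpan (n - k) := by
  obtain ⟨m, hm⟩ := hodd
  obtain rfl | ⟨l, rfl⟩ : n = 1 ∨ ∃ l, n = l + 2 := by
    rcases n with _ | _ | l
    · omega
    · exact Or.inl rfl
    · exact Or.inr ⟨l, rfl⟩
  · rw [J_one]
    exact zero_mem _
  push_cast at hm
  rcases hβ.eq_or_lt with rfl | hlt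
  · have := isProbabilityMeasure_betaMeasure_neg_one l
    have hl : (l : ℤ) = 2 * m + 1 := by exact_mod_cast (by linarith : (l : ℝ) = 2 * m + 1)
    rw [J_eq rfl hk1 hk2 measurePreserving_betaMeasure_neg_one]
    exact toReal_one_sub_mem_piSpan prob_le_one
      (pi_unbddSet_sphere_mem_piSpan (p := m.toNat) (by omega) hk1 hk2)
  · have hprob : IsProbabilityMeasure (betaMeasure (l + 1) β) :=
      betaMeasure_eq_betaLaw hlt (l + 1) ▸ isProbabilityMeasure_betaLaw hlt (l + 1)
    have hm0 : 0 ≤ m := by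
      have : (-1 : ℝ) < 2 * m := by linarith [(Nat.cast_nonneg l : (0 : ℝ) ≤ l)]
      have : (-1 : ℤ) < 2 * m := by exact_mod_cast this
      omega
    obtain ⟨p, rfl⟩ := Int.eq_ofNat_of_zero_le hm0
    rw [J_eq rfl hk1 hk2 (by
      rw [betaMeasure_eq_betaLaw hlt]; exact measurePreserving_betaLaw β)]
    refine toReal_one_sub_mem_piSpan prob_le_one ?_
    rw [betaMeasure_eq_betaLaw hlt]
    refine pi_unbddSet_betaLaw_mem_piSpan p ?_ hlt hk1 hk2 (by omega)
    push_cast at hm ⊢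
    linarith

end ExpectedAngles

theorem Jb_pi_expansion (β : ℝ) (hβ : -1 ≤ β) (hhalf : ∃ m : ℤ, 2 * β = (m : ℝ))
    (n k : ℕ) (hk1 : 1 ≤ k) (hk2 : k ≤ n)
    (hodd : ∃ m : ℤ, 2 * β + n = 2 * (m : ℝ) + 1) :
    (Even (n - k) → ∃ q : ℕ → ℚ,
      Jb n k β =
        ∑ j ∈ Finset.range ((n - k) / 2 + 1), (q j : ℝ) * Real.pi ^ (-(2 * (j : ℤ)))) ∧
    (¬ Even (n - k) → ∃ q : ℕ → ℚ,
      Jb n k β =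
        ∑ j ∈ Finset.range ((n - k - 1) / 2 + 1), (q j : ℝ) * Real.pi ^ (-(2 * (j : ℤ)))) := by
  have h : Jb n k β ∈ piSpan (n - k) := by
    simpa [Jb] using ratCast_mul_mem (n.choose k : ℚ) (J_mem_piSpan hβ hk1 hk2 hodd)
  refine ⟨fun _ => exists_coeff_of_mem_piSpan h, fun hne => ?_⟩
  rw [show (n - k - 1) / 2 = (n - k) / 2 by grind]
  exact exists_coeff_of_mem_piSpan h

end
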